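/- arXiv:1603.00207 — 5 statements merged into one kernel-verified Lean document; each statement's English description precedes it below -/
import Mathlib

section
/- Let S be a fixed polygon contained in [0,1)². Then for almost every α > 0 (with respect to Lebesgue measure) and every starting point x ∈ [0,1)², the set S is a bounded remainder set for the continuous irrational rotation with slope α and starting point x. -/
open MeasureTheory

/-- The distributional error `Δ_T(S, α, x)` of the continuous irrational rotation
with slope `α` and starting point `(x₁, x₂)` for the set `S ⊆ [0,1)²`. -/
noncomputable def rotDelta (S : Set (ℝ × ℝ)) (α x₁ x₂ T : ℝ) : ℝ :=
  (∫ t in (0:ℝ)..T,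
    Set.indicator S (fun _ => (1:ℝ)) (Int.fract (x₁ + t), Int.fract (x₂ + α * t))) -
    T * (volume S).toReal

/-- `S` is a bounded remainder set for the continuous rotation with slope `α`
and starting point `(x₁, x₂)`. -/
def IsBoundedRemainderSet (S : Set (ℝ × ℝ)) (α x₁ x₂ : ℝ) : Prop :=
  ∃ C : ℝ, ∀ T : ℝ, 0 < T → |rotDelta S α x₁ x₂ T| ≤ C

/-- `S` is a polygon: a plane region whose boundary is the union of finitely many
straight line segments joining consecutive vertices `v i`, `v (i+1)`. -/
def IsPolygon (S : Set (ℝ × ℝ)) : Prop :=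
  ∃ n : ℕ, 3 ≤ n ∧ ∃ v : ZMod n → ℝ × ℝ,
    frontier S = ⋃ i : ZMod n, segment ℝ (v i) (v (i + 1))


open scoped FourierTransform

noncomputable def Wc (θ : UnitAddCircle) : ℝ := ‖fourier 1 θ - 1‖ ^ (-(3/4) : ℝ)

lemma Wc_meas : Measurable Wc := by
  unfold Wc
  have : Continuous fun θ : UnitAddCircle => ‖fourier 1 θ - 1‖ := by fun_prop
  exact this.measurable.pow_const _

lemma Wc_bound (u : ℝ) (hu : u ∈ Set.Ioc (-(1/2):ℝ) (1/2)) : Wc (u : UnitAddCircle) ≤ |u| ^ (-(3/4) : ℝ) := by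
  unfold Wc
  rcases eq_or_ne u 0 with h0 | h0
  · subst h0
    simp
  · apply Real.rpow_le_rpow_of_nonpos (abs_pos.mpr h0) _ (by norm_num)
    rw [fourier_coe_apply]
    have e : (2 * (Real.pi:ℂ) * Complex.I * ((1:ℤ):ℂ) * (u:ℂ) / ((1:ℝ):ℂ)) = Complex.I * ((2 * Real.pi * u : ℝ) : ℂ) := by
      push_cast; ring
    rw [e, Complex.norm_exp_I_mul_ofReal_sub_one]
    have h1 := Real.mul_abs_le_abs_sin (x := Real.pi * u) (by
      rw [abs_mul, abs_of_pos Real.pi_pos]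
      have : |u| ≤ 1/2 := abs_le.mpr ⟨by linarith [hu.1], hu.2⟩
      nlinarith [Real.pi_pos])
    rw [abs_mul, abs_of_pos Real.pi_pos] at h1
    have h2 : 2 / Real.pi * (Real.pi * |u|) = 2 * |u| := by field_simp
    rw [h2] at h1
    rw [norm_mul, Real.norm_eq_abs, Real.norm_eq_abs, show 2 * Real.pi * u / 2 = Real.pi * u by ring]
    norm_num
    linarith [abs_nonneg u]

lemma Wc_int : ∫⁻ θ : UnitAddCircle, ENNReal.ofReal (Wc θ) < ⊤ := by
  rw [← UnitAddCircle.lintegral_preimage (-(1/2))]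
  have hIntg : IntegrableOn (fun u : ℝ => |u| ^ (-(3/4) : ℝ)) (Set.Ioc (-(1/2):ℝ) (-(1/2)+1)) := by
    have h1 : IntervalIntegrable (fun x : ℝ => x ^ (-(3/4) : ℝ)) volume 0 (1/2) :=
      intervalIntegral.intervalIntegrable_rpow' (by norm_num)
    have h2 : IntervalIntegrable (fun x : ℝ => |x| ^ (-(3/4) : ℝ)) volume 0 (1/2) := by
      refine h1.congr ?_
      intro x hx
      rw [Set.uIoc_of_le (by norm_num)] at hx
      simp only
      rw [abs_of_pos hx.1]
    have h3 : IntervalIntegrable (fun x : ℝ => |x| ^ (-(3/4) : ℝ)) volume (-(1/2)) 0 := by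
      have := (IntervalIntegrable.iff_comp_neg (f := fun x : ℝ => |x| ^ (-(3/4) : ℝ)) (a := 0) (b := 1/2)).mp h2
      simp only [abs_neg, neg_zero] at this
      exact this.symm
    have := h3.trans h2
    rw [intervalIntegrable_iff_integrableOn_Ioc_of_le (by norm_num)] at this
    norm_num at this ⊢
    exact this
  refine lt_of_le_of_lt ?_ hIntg.lintegral_lt_top
  apply setLIntegral_mono' measurableSet_Ioc
  intro u hu
  apply ENNReal.ofReal_le_ofReal
  exact Wc_bound u ⟨hu.1, by linarith [hu.2]⟩

lemma Wc_k (k : ℤ) (hk : k ≠ 0) :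
    ∫⁻ θ : UnitAddCircle, ENNReal.ofReal (Wc (k • θ)) = ∫⁻ θ : UnitAddCircle, ENNReal.ofReal (Wc θ) := by
  have hm : MeasurePreserving (fun θ : UnitAddCircle => k • θ) volume volume := by
    rcases lt_or_ge 1 |k| with h | h
    · exact (AddCircle.ergodic_zsmul h).toMeasurePreserving
    · have : k = 1 ∨ k = -1 := by
        rw [abs_le] at h; omega
      rcases this with h | h
      · subst h; simp only [one_smul]; exact MeasurePreserving.id _
      · subst h; simp only [neg_smul, one_smul]; exact Measure.measurePreserving_neg _
  exact hm.lintegral_comp (f := fun θ => ENNReal.ofReal (Wc θ)) (ENNReal.measurable_ofReal.comp Wc_meas)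

lemma dioph_circle : ∀ᵐ θ : UnitAddCircle,
    Summable fun k : ℤ => ((k:ℝ)^2 * ‖fourier k θ - 1‖)⁻¹ := by
  have hfin : ∫⁻ θ : UnitAddCircle, ∑' k : ℤ, ENNReal.ofReal (|(k:ℝ)| ^ (-(3/2):ℝ) * Wc (k • θ)) ≠ ⊤ := by
    rw [lintegral_tsum]
    · have : ∀ k : ℤ, ∫⁻ θ : UnitAddCircle, ENNReal.ofReal (|(k:ℝ)| ^ (-(3/2):ℝ) * Wc (k • θ))
          = ENNReal.ofReal (|(k:ℝ)| ^ (-(3/2):ℝ)) * ∫⁻ θ : UnitAddCircle, ENNReal.ofReal (Wc θ) := by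
        intro k
        simp_rw [ENNReal.ofReal_mul (Real.rpow_nonneg (abs_nonneg (k:ℝ)) _)]
        rw [lintegral_const_mul' _ _ ENNReal.ofReal_ne_top]
        rcases eq_or_ne k 0 with h | h
        · subst h; simp
        · rw [Wc_k k h]
      simp_rw [this]
      rw [ENNReal.tsum_mul_right]
      apply ENNReal.mul_ne_top _ Wc_int.ne
      have := (Real.summable_abs_int_rpow (b := 3/2) (by norm_num))
      exact this.tsum_ofReal_ne_top
    · intro k
      have : Measurable fun θ : UnitAddCircle => k • θ := (continuous_zsmul k).measurable
      exact (ENNReal.measurable_ofReal.comp ((Wc_meas.comp this).const_mul _)).aemeasurable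
  have hae := ae_lt_top' (by
    refine AEMeasurable.tsum fun k => ?_
    have : Measurable fun θ : UnitAddCircle => k • θ := (continuous_zsmul k).measurable
    exact (ENNReal.measurable_ofReal.comp ((Wc_meas.comp this).const_mul _)).aemeasurable) hfin
  filter_upwards [hae] with θ hθ
  have hW0 : ∀ θ, 0 ≤ Wc θ := fun θ => Real.rpow_nonneg (norm_nonneg _) _
  have hs : Summable fun k : ℤ => (|(k:ℝ)| ^ (-(3/2):ℝ) * Wc (k • θ)) := by
    have := ENNReal.summable_toReal hθ.ne
    refine this.congr fun k => ?_
    rw [ENNReal.toReal_ofReal (mul_nonneg (Real.rpow_nonneg (abs_nonneg _) _) (hW0 _))]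
  have heq : ∀ k : ℤ, |(k:ℝ)| ^ (-(3/2):ℝ) * Wc (k • θ) = (((k:ℝ)^2 * ‖fourier k θ - 1‖)⁻¹) ^ (3/4:ℝ) := by
    intro k
    have h1 : fourier 1 (k • θ) = fourier k θ := by simp [fourier_apply]
    unfold Wc
    rw [h1, Real.inv_rpow (by positivity), ← Real.rpow_neg (by positivity), Real.mul_rpow (by positivity) (by positivity)]
    congr 1
    rw [← sq_abs, ← Real.rpow_natCast, ← Real.rpow_mul (abs_nonneg _)]
    norm_num
  simp_rw [heq] at hs
  have h0 := hs.tendsto_cofinite_zero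
  have hev := h0.eventually (gt_mem_nhds (zero_lt_one))
  refine Summable.of_norm_bounded_eventually hs ?_
  filter_upwards [hev] with k hk
  set a := (((k:ℝ)^2 * ‖fourier k θ - 1‖)⁻¹) with ha
  have ha0 : 0 ≤ a := by positivity
  rw [Real.norm_eq_abs, abs_of_nonneg ha0]
  have ha1 : a < 1 := by
    by_contra h
    push Not at h
    have := Real.one_le_rpow h (by norm_num : (0:ℝ) ≤ 3/4)
    linarith
  rcases ha0.eq_or_lt with h | h
  · rw [← h]; simp
  · calc a = a ^ (1:ℝ) := (Real.rpow_one a).symm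
      _ ≤ a ^ (3/4:ℝ) := Real.rpow_le_rpow_of_exponent_ge h ha1.le (by norm_num)

lemma dioph : ∀ᵐ α : ℝ,
    Summable fun k : ℤ => ((k:ℝ)^2 * ‖fourier k (α : UnitAddCircle) - 1‖)⁻¹ := by
  have key : ∀ n : ℤ, ∀ᵐ α : ℝ ∂(volume.restrict (Set.Ioc (n:ℝ) (n+1))),
    Summable fun k : ℤ => ((k:ℝ)^2 * ‖fourier k (α : UnitAddCircle) - 1‖)⁻¹ := fun n =>
    (UnitAddCircle.measurePreserving_mk (n:ℝ)).quasiMeasurePreserving.ae dioph_circle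
  have := (ae_restrict_iUnion_iff (μ := (volume : Measure ℝ)) (fun n : ℤ => Set.Ioc (n:ℝ) (n+1)) _).mpr key
  rw [iUnion_Ioc_intCast ℝ] at this
  simpa using this

def GoodDC (F : ℝ → ℝ) : Prop :=
  ∃ (P Q : ℝ → ℝ) (K L : NNReal) (R : ℝ), ConvexOn ℝ Set.univ P ∧ ConvexOn ℝ Set.univ Q ∧
    LipschitzWith K P ∧ LipschitzWith L Q ∧ (∀ y, F y = P y - Q y) ∧ (∀ y, R < |y| → F y = 0)

lemma GoodDC.zero : GoodDC (fun _ => 0) :=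
  ⟨fun _ => 0, fun _ => 0, 0, 0, 0, convexOn_const _ convex_univ, convexOn_const _ convex_univ,
    LipschitzWith.const _, LipschitzWith.const _, by simp, by simp⟩

lemma GoodDC.add {F G : ℝ → ℝ} (hF : GoodDC F) (hG : GoodDC G) : GoodDC (fun y => F y + G y) := by
  obtain ⟨P, Q, K, L, R, hP, hQ, hK, hL, hd, hR⟩ := hF
  obtain ⟨P', Q', K', L', R', hP', hQ', hK', hL', hd', hR'⟩ := hG
  refine ⟨fun y => P y + P' y, fun y => Q y + Q' y, K + K', L + L', max R R', hP.add hP', hQ.add hQ',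
    hK.add hK', hL.add hL', ?_, ?_⟩
  · intro y; simp only [hd, hd']; ring
  · intro y hy
    simp only
    rw [hR y (lt_of_le_of_lt (le_max_left _ _) hy), hR' y (lt_of_le_of_lt (le_max_right _ _) hy)]
    simp

lemma GoodDC.sum {ι : Type*} (s : Finset ι) (F : ι → ℝ → ℝ) (h : ∀ i ∈ s, GoodDC (F i)) :
    GoodDC (fun y => ∑ i ∈ s, F i y) := by
  classical
  induction s using Finset.induction_on with
  | empty => simpa using GoodDC.zero
  | insert a s ha ih =>
    simp_rw [Finset.sum_insert ha]
    exact (h a (by simp)).add (ih fun i hi => h i (by simp [hi]))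

lemma GoodDC.continuous {F : ℝ → ℝ} (hF : GoodDC F) : Continuous F := by
  obtain ⟨P, Q, K, L, R, hP, hQ, hK, hL, hd, hR⟩ := hF
  rw [show F = fun y => P y - Q y from funext hd]
  exact hK.continuous.sub hL.continuous

lemma GoodDC.compactSupp {F : ℝ → ℝ} (hF : GoodDC F) : HasCompactSupport F := by
  obtain ⟨P, Q, K, L, R, hP, hQ, hK, hL, hd, hR⟩ := hF
  refine HasCompactSupport.intro (isCompact_Icc (a := -R) (b := R)) ?_
  intro x hx
  apply hR
  by_contra h
  push Not at h
  exact hx (abs_le.mp h)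

lemma second_diff_nonneg {P : ℝ → ℝ} (hP : ConvexOn ℝ Set.univ P) (y h : ℝ) :
    0 ≤ P (y + h) - 2 * P y + P (y - h) := by
  have := hP.2 (Set.mem_univ (y + h)) (Set.mem_univ (y - h)) (by norm_num : (0:ℝ) ≤ 1/2) (by norm_num : (0:ℝ) ≤ 1/2) (by norm_num)
  simp only [smul_eq_mul] at this
  rw [show 1/2 * (y+h) + 1/2 * (y-h) = y by ring] at this
  linarith

lemma second_diff_int {P : ℝ → ℝ} {K : NNReal} (hK : LipschitzWith K P) (a b h : ℝ) (hh : 0 ≤ h) :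
    ∫ y in a..b, (P (y + h) - 2 * P y + P (y - h)) ≤ 2 * K * h ^ 2 := by
  have hc := hK.continuous
  set D : ℝ → ℝ := fun y => P (y + h) - P y with hD
  have hDc : Continuous D := by fun_prop
  have hi : ∀ u v, IntervalIntegrable D volume u v := fun u v => hDc.intervalIntegrable u v
  have hDb : ∀ y, ‖D y‖ ≤ K * h := by
    intro y
    have := hK.dist_le_mul (y + h) y
    rw [Real.dist_eq, Real.dist_eq] at this
    simpa [hD, abs_of_nonneg hh] using this
  have e1 : ∫ y in a..b, (P (y + h) - 2 * P y + P (y - h)) = (∫ y in a..b, D y) - ∫ y in a..b, D (y - h) := by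
    rw [← intervalIntegral.integral_sub (hi _ _) ((by fun_prop : Continuous fun y => D (y - h)).intervalIntegrable _ _)]
    congr 1; ext y
    simp only [hD, sub_add_cancel]; ring
  rw [e1, intervalIntegral.integral_comp_sub_right]
  have e2 : (∫ y in a..b, D y) - ∫ y in (a-h)..(b-h), D y = (∫ y in (b-h)..b, D y) - ∫ y in (a-h)..a, D y := by
    have h1 := intervalIntegral.integral_add_adjacent_intervals (hi (a-h) a) (hi a b)
    have h2 := intervalIntegral.integral_add_adjacent_intervals (hi (a-h) (b-h)) (hi (b-h) b)
    linarith
  rw [e2]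
  have h3 := intervalIntegral.norm_integral_le_of_norm_le_const (a := b-h) (b := b) (f := D) (C := K*h) (fun y _ => hDb y)
  have h4 := intervalIntegral.norm_integral_le_of_norm_le_const (a := a-h) (b := a) (f := D) (C := K*h) (fun y _ => hDb y)
  simp only [sub_sub_cancel, abs_of_nonneg hh, Real.norm_eq_abs] at h3 h4
  have h3' := (abs_le.mp h3).2
  have h4' := (abs_le.mp h4).1
  nlinarith

lemma GoodDC.second_diff {F : ℝ → ℝ} (hF : GoodDC F) :
    ∃ C : ℝ, ∀ h : ℝ, 0 ≤ h → h ≤ 1 → ∫ y, |F (y + h) - 2 * F y + F (y - h)| ≤ C * h ^ 2 := by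
  have hFc := hF.continuous
  obtain ⟨P, Q, K, L, R, hP, hQ, hK, hL, hd, hR⟩ := hF
  have hPc := hK.continuous
  have hQc := hL.continuous
  refine ⟨2 * K + 2 * L, fun h h0 h1 => ?_⟩
  set R' := |R| + 1 with hR'
  have hsupp : ∀ y, y ∉ Set.Ioc (-(R'+1)) (R'+1) → |F (y + h) - 2 * F y + F (y - h)| = 0 := by
    intro y hy
    have hy' : R' + 1 ≤ |y| := by
      by_contra hlt
      push Not at hlt
      have := abs_lt.mp hlt
      exact hy ⟨this.1, this.2.le⟩
    have hRle := le_abs_self R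
    have t1 : |y| ≤ |y + h| + h := by
      have := abs_sub_abs_le_abs_sub y (y+h)
      rw [show y - (y+h) = -h by ring, abs_neg, abs_of_nonneg h0] at this
      linarith
    have t2 : |y| ≤ |y - h| + h := by
      have := abs_sub_abs_le_abs_sub y (y-h)
      rw [show y - (y-h) = h by ring, abs_of_nonneg h0] at this
      linarith
    rw [hR _ (by linarith), hR _ (by linarith), hR _ (by linarith)]
    simp
  rw [← setIntegral_eq_integral_of_forall_compl_eq_zero hsupp,
    ← intervalIntegral.integral_of_le (by have := abs_nonneg R; linarith)]
  have hle : ∫ y in (-(R'+1))..(R'+1), |F (y + h) - 2 * F y + F (y - h)| ≤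
      ∫ y in (-(R'+1))..(R'+1), ((P (y + h) - 2 * P y + P (y - h)) + (Q (y + h) - 2 * Q y + Q (y - h))) := by
    apply intervalIntegral.integral_mono_on (by have := abs_nonneg R; linarith)
      ((by fun_prop : Continuous fun y => |F (y + h) - 2 * F y + F (y - h)|).intervalIntegrable _ _)
      ((by fun_prop : Continuous fun y => ((P (y + h) - 2 * P y + P (y - h)) + (Q (y + h) - 2 * Q y + Q (y - h)))).intervalIntegrable _ _)
    intro y _
    have n1 := second_diff_nonneg hP y h
    have n2 := second_diff_nonneg hQ y h
    rw [hd, hd, hd, abs_le]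
    constructor <;> linarith
  rw [intervalIntegral.integral_add ((by fun_prop : Continuous fun y => ((P (y + h) - 2 * P y + P (y - h)))).intervalIntegrable _ _)
     ((by fun_prop : Continuous fun y => ((Q (y + h) - 2 * Q y + Q (y - h)))).intervalIntegrable _ _)] at hle
  have b1 := second_diff_int hK (-(R'+1)) (R'+1) h h0
  have b2 := second_diff_int hL (-(R'+1)) (R'+1) h h0
  linarith

lemma GoodDC.fourier_bound {F : ℝ → ℝ} (hF : GoodDC F) :
    ∃ C : ℝ, 0 ≤ C ∧ ∀ k : ℤ, k ≠ 0 → ‖𝓕 (fun y => (F y : ℂ)) (k:ℝ)‖ ≤ C * ((k:ℝ)^2)⁻¹ := by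
  obtain ⟨C, hC⟩ := hF.second_diff
  have hFc := hF.continuous
  have hFs := hF.compactSupp
  have hFi : ∀ (e : ℝ → ℂ) , Continuous e → ∀ h : ℝ, Integrable fun y => e y * (F (y + h) : ℂ) := by
    intro e he h
    refine Continuous.integrable_of_hasCompactSupport (by fun_prop) ?_
    have h1 : HasCompactSupport fun y => F (y + h) := hFs.comp_homeomorph (Homeomorph.addRight h)
    have h2 : HasCompactSupport fun y => (F (y + h) : ℂ) := h1.comp_left (g := fun x : ℝ => (x:ℂ)) (by simp)
    exact h2.mul_left
  refine ⟨|C|, abs_nonneg _, fun k hk => ?_⟩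
  have hk1 : (1:ℝ) ≤ |(k:ℝ)| := by exact_mod_cast Int.one_le_abs hk
  set h : ℝ := 1 / (2 * |(k:ℝ)|) with hh
  have h0 : 0 ≤ h := by positivity
  have h1 : h ≤ 1 := by rw [hh, div_le_one (by positivity)]; linarith
  rw [Real.fourier_real_eq_integral_exp_smul]
  simp only [smul_eq_mul]
  set e : ℝ → ℂ := fun v => Complex.exp (((-2 * Real.pi * v * k : ℝ) : ℂ) * Complex.I) with he
  have hec : Continuous e := by fun_prop
  have hen : ∀ y, ‖e y‖ = 1 := fun y => Complex.norm_exp_ofReal_mul_I _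
  have heh : ∀ y, e (y + h) = - e y := by
    intro y
    simp only [he]
    have : ((-2 * Real.pi * (y + h) * k : ℝ) : ℂ) * Complex.I =
       ((-2 * Real.pi * y * k : ℝ) : ℂ) * Complex.I + ((-2 * Real.pi * h * k : ℝ) : ℂ) * Complex.I := by
      push_cast; ring
    rw [this, Complex.exp_add]
    have : Complex.exp (((-2 * Real.pi * h * k : ℝ) : ℂ) * Complex.I) = -1 := by
      rcases abs_choice (k:ℝ) with hc | hc
      · have : -2 * Real.pi * h * k = -Real.pi := by
          rw [hh, hc]
          have : (k:ℝ) ≠ 0 := by exact_mod_cast hk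
          field_simp
        rw [this]; push_cast; rw [neg_mul, Complex.exp_neg, Complex.exp_pi_mul_I]; norm_num
      · have : -2 * Real.pi * h * k = Real.pi := by
          rw [hh, hc]
          have : (k:ℝ) ≠ 0 := by exact_mod_cast hk
          field_simp
        rw [this, Complex.exp_pi_mul_I]
    rw [this]; ring
  have heh' : ∀ y, e (y - h) = - e y := by
    intro y
    have := heh (y - h)
    rw [sub_add_cancel] at this
    rw [this, neg_neg]
  have i1 : ∫ y, e y * (F (y + h) : ℂ) = - ∫ y, e y * (F y : ℂ) := by
    rw [← integral_sub_right_eq_self (fun y => e y * (F (y + h) : ℂ)) h]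
    simp only [sub_add_cancel, heh', neg_mul]
    rw [integral_neg]
  have i2 : ∫ y, e y * (F (y - h) : ℂ) = - ∫ y, e y * (F y : ℂ) := by
    rw [← integral_add_right_eq_self (fun y => e y * (F (y - h) : ℂ)) h]
    simp only [add_sub_cancel_right, heh, neg_mul]
    rw [integral_neg]
  have j0 : Integrable fun y => e y * (F y : ℂ) := by simpa using hFi e hec 0
  have j2 : Integrable fun y => e y * (F (y - h) : ℂ) := by simpa [sub_eq_add_neg] using hFi e hec (-h)
  have i3 : ∫ y, e y * ((F (y + h) - 2 * F y + F (y - h) : ℝ) : ℂ) = - 4 * ∫ y, e y * (F y : ℂ) := by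
    have : ∀ y, e y * ((F (y + h) - 2 * F y + F (y - h) : ℝ) : ℂ) =
        (e y * (F (y + h) : ℂ) - 2 * (e y * (F y : ℂ))) + e y * (F (y - h) : ℂ) := by
      intro y; push_cast; ring
    simp_rw [this]
    have j3 : Integrable fun y => e y * (F (y + h) : ℂ) - 2 * (e y * (F y : ℂ)) :=
      (hFi e hec h).sub (j0.const_mul 2)
    rw [integral_add j3 j2, integral_sub (hFi e hec h) (j0.const_mul 2),
      i1, i2, integral_const_mul]
    ring
  have b := norm_integral_le_integral_norm (μ := volume) (fun y => e y * ((F (y + h) - 2 * F y + F (y - h) : ℝ) : ℂ))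
  rw [i3] at b
  simp only [norm_mul, hen, one_mul, Complex.norm_real, Real.norm_eq_abs] at b
  have b2 := hC h h0 h1
  have hsq : h ^ 2 = (1/4) * ((k:ℝ)^2)⁻¹ := by
    rw [hh, div_pow, mul_pow, sq_abs]; field_simp; norm_num
  rw [hsq] at b2
  norm_num at b
  have hp : 0 ≤ ((k:ℝ)^2)⁻¹ := by positivity
  have := mul_le_mul_of_nonneg_right (le_abs_self C) hp
  have := mul_nonneg (abs_nonneg C) hp
  linarith

lemma GoodDC.birkhoff {F : ℝ → ℝ} (hF : GoodDC F) {α : ℝ} (hα : Irrational α)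
    (hs : Summable fun k : ℤ => ((k:ℝ)^2 * ‖fourier k (α : UnitAddCircle) - 1‖)⁻¹) :
    ∃ C : ℝ, ∀ (y : ℝ) (N : ℕ),
      |∑ n ∈ Finset.range N, ∑' m : ℤ, F (y + n * α + m) - N * ∫ y, F y| ≤ C := by
  obtain ⟨C, hC0, hC⟩ := hF.fourier_bound
  have hFc := hF.continuous
  have hFs := hF.compactSupp
  set c : ℤ → ℂ := fun k => 𝓕 (fun y => (F y : ℂ)) (k:ℝ) with hc
  have hsum : Summable c := by
    have h1 : Summable fun k : ℤ => C * ((k:ℝ)^2)⁻¹ := by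
      have := (Real.summable_one_div_int_pow (p := 2)).mpr (by norm_num)
      simpa [one_div] using this.mul_left C
    refine Summable.of_norm_bounded_eventually h1 ?_
    have : ∀ᶠ k : ℤ in Filter.cofinite, k ≠ 0 := by
      simpa using (Set.finite_singleton (0:ℤ)).eventually_cofinite_notMem
    filter_upwards [this] with k hk using hC k hk
  have hpoisson : ∀ x : ℝ, ∑' m : ℤ, (F (x + m) : ℂ) = ∑' k : ℤ, c k * fourier k (x : UnitAddCircle) := by
    intro x
    refine Real.tsum_eq_tsum_fourier_of_rpow_decay_of_summable (f := fun y => (F y : ℂ)) (by fun_prop) (b := 2) (by norm_num) ?_ hsum x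
    have h2 : HasCompactSupport fun y => (F y : ℂ) := hFs.comp_left (g := fun x : ℝ => (x:ℂ)) (by simp)
    have h3 : (fun y => (F y : ℂ)) =ᶠ[Filter.cocompact ℝ] 0 := hasCompactSupport_iff_eventuallyEq.mp h2 |>.filter_mono (by
      exact Filter.cocompact_le_coclosedCompact)
    exact h3.trans_isBigO (Asymptotics.isBigO_zero _ _)
  have hc0 : c 0 = ((∫ y, F y : ℝ) : ℂ) := by
    simp only [hc]
    rw [Real.fourier_real_eq_integral_exp_smul]
    simp
    exact integral_ofReal
  refine ⟨∑' k : ℤ, 2 * C * ((k:ℝ)^2 * ‖fourier k (α : UnitAddCircle) - 1‖)⁻¹, fun y N => ?_⟩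
  have hfn : ∀ (k : ℤ) (θ : UnitAddCircle), ‖fourier k θ‖ = 1 := fun k θ => by
    rw [fourier_apply]; exact Circle.norm_coe _
  have hne : ∀ k : ℤ, k ≠ 0 → fourier k (α : UnitAddCircle) ≠ 1 := by
    intro k hk h
    rw [fourier_coe_apply, Complex.exp_eq_one_iff] at h
    obtain ⟨n, hn⟩ := h
    have hpi : (2 * (Real.pi:ℂ) * Complex.I) ≠ 0 := Complex.two_pi_I_ne_zero
    have h2 : (2 * (Real.pi:ℂ) * Complex.I) * ((k:ℂ) * α) = (2 * (Real.pi:ℂ) * Complex.I) * n := by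
      push_cast at hn
      linear_combination hn
    have h3 := mul_left_cancel₀ hpi h2
    have h4 : (k:ℝ) * α = n := by exact_mod_cast h3
    have := hα.intCast_mul hk
    rw [h4] at this
    exact Int.not_irrational n this
  have hsmn : ∀ n : ℕ, Summable fun k : ℤ => c k * fourier k ((y + n * α : ℝ) : UnitAddCircle) := by
    intro n
    refine Summable.of_norm ?_
    simp only [norm_mul, hfn, mul_one]
    exact hsum.norm
  have hA : ∀ (k : ℤ) (n : ℕ), fourier k ((y + n * α : ℝ) : UnitAddCircle) =
      fourier k (y : UnitAddCircle) * (fourier k (α : UnitAddCircle)) ^ n := by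
    intro k n
    simp only [fourier_coe_apply]
    rw [← Complex.exp_nat_mul, ← Complex.exp_add]
    congr 1; push_cast; ring
  set A : ℤ → ℂ := fun k => ∑ n ∈ Finset.range N, c k * fourier k ((y + n * α : ℝ) : UnitAddCircle) with hAdef
  have hAs : Summable A := summable_sum fun n _ => hsmn n
  have e1 : ((∑ n ∈ Finset.range N, ∑' m : ℤ, F (y + n * α + m) - N * ∫ y, F y : ℝ) : ℂ) =
      ∑' k : ℤ, if k = 0 then 0 else A k := by
    have := hAs.tsum_eq_add_tsum_ite 0
    have e2 : ∑' k, A k = ∑ n ∈ Finset.range N, ∑' k : ℤ, c k * fourier k ((y + n * α : ℝ) : UnitAddCircle) := by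
      rw [hAdef, Summable.tsum_finsetSum fun n _ => hsmn n]
    have e3 : A 0 = N * c 0 := by
      simp [hAdef]
    push_cast
    rw [← hc0, ← e3, eq_sub_of_add_eq' this.symm, e2]
    congr 1
    refine Finset.sum_congr rfl fun n _ => ?_
    rw [← hpoisson]
  have hterm : ∀ k : ℤ, ‖if k = 0 then 0 else A k‖ ≤ 2 * C * ((k:ℝ)^2 * ‖fourier k (α : UnitAddCircle) - 1‖)⁻¹ := by
    intro k
    split_ifs with hk
    · subst hk; simp
    · simp only [hAdef, hA]
      simp_rw [← mul_assoc]
      rw [← Finset.mul_sum, geom_sum_eq (hne k hk)]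
      rw [norm_mul, norm_mul, hfn, norm_div, mul_one]
      have g1 : ‖(fourier k (α : UnitAddCircle)) ^ N - 1‖ ≤ 2 := by
        refine (norm_sub_le _ _).trans ?_
        rw [norm_pow, hfn]; norm_num
      have g2 := hC k hk
      calc _ ≤ (C * ((k:ℝ)^2)⁻¹) * (2 / ‖fourier k (α : UnitAddCircle) - 1‖) := by
            gcongr
        _ = _ := by rw [mul_inv]; ring
  have hfin := tsum_of_norm_bounded (hs.mul_left (2*C)).hasSum hterm
  rw [← e1, Complex.norm_real, Real.norm_eq_abs] at hfin
  exact hfin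

lemma cell_section {ι : Type*} (s : Finset ι) (a b c : ι → ℝ) (α : ℝ)
    (h : ∀ j ∈ s, a j + b j * α ≠ 0) :
    ∃ (l u : ℝ → ℝ) (K L : NNReal), ConvexOn ℝ Set.univ l ∧ ConcaveOn ℝ Set.univ u ∧
      LipschitzWith K l ∧ LipschitzWith L u ∧
      ∀ y t, (l y < t ∧ t < u y) ↔
        (-1 < t ∧ t < 2 ∧ ∀ j ∈ s, 0 < a j * t + b j * (y + α * t) - c j) := by
  classical
  induction s using Finset.induction_on with
  | empty =>
    refine ⟨fun _ => -1, fun _ => 2, 0, 0, convexOn_const _ convex_univ, concaveOn_const _ convex_univ,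
      LipschitzWith.const _, LipschitzWith.const _, ?_⟩
    intro y t; simp
  | insert i s hi ih =>
    obtain ⟨l, u, K, L, hl, hu, hK, hL, hiff⟩ := ih fun j hj => h j (by simp [hj])
    have he := h i (by simp)
    set e := a i + b i * α with hedef
    set g : ℝ → ℝ := fun y => (c i - b i * y) / e with hg
    have hgK : LipschitzWith ‖b i / e‖₊ g := by
      refine LipschitzWith.of_dist_le_mul fun x y => ?_
      rw [Real.dist_eq, Real.dist_eq, coe_nnnorm, Real.norm_eq_abs, ← abs_mul, ← abs_neg]
      apply le_of_eq
      congr 1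
      simp only [hg]; field_simp; ring
    have hgeq : ∀ x y p q : ℝ, p + q = 1 → g (p • x + q • y) = p • g x + q • g y := by
      intro x y p q hpq
      have : q = 1 - p := by linarith
      subst this
      simp only [hg, smul_eq_mul]; field_simp; ring
    have hgx : ConvexOn ℝ Set.univ g :=
      ⟨convex_univ, fun x _ y _ p q _ _ hpq => (hgeq x y p q hpq).le⟩
    have hgv : ConcaveOn ℝ Set.univ g :=
      ⟨convex_univ, fun x _ y _ p q _ _ hpq => (hgeq x y p q hpq).ge⟩
    have hexp : ∀ y t, a i * t + b i * (y + α * t) - c i = e * (t - g y) := by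
      intro y t
      simp only [hg]
      rw [mul_sub, mul_div_cancel₀ _ he, hedef]; ring
    rcases lt_or_gt_of_ne he with hneg | hpos
    · refine ⟨l, fun y => min (u y) (g y), K, max L ‖b i / e‖₊, hl, hu.inf hgv, hK, hL.min hgK, ?_⟩
      intro y t
      have key : 0 < a i * t + b i * (y + α * t) - c i ↔ t < g y := by
        rw [hexp]
        constructor
        · intro h1; by_contra h2; push Not at h2; nlinarith
        · intro h1; nlinarith
      rw [Finset.forall_mem_insert, key, lt_min_iff, ← and_assoc, hiff]
      tauto
    · refine ⟨fun y => max (l y) (g y), u, max K ‖b i / e‖₊, L, hl.sup hgx, hu, hK.max hgK, hL, ?_⟩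
      intro y t
      have key : 0 < a i * t + b i * (y + α * t) - c i ↔ g y < t := by
        rw [hexp]
        constructor
        · intro h1; by_contra h2; push Not at h2; nlinarith
        · intro h1; nlinarith
      have h3 := hiff y t
      rw [Finset.forall_mem_insert, key, max_lt_iff]
      tauto

noncomputable def secF (S : Set (ℝ × ℝ)) (α y : ℝ) : ℝ :=
  ∫ t, Set.indicator S (fun _ => (1:ℝ)) (t, y + α * t)

lemma cell_good {ι : Type*} [Fintype ι] (a b c : ι → ℝ) (α : ℝ)
    (h : ∀ j, a j + b j * α ≠ 0) (C : Set (ℝ × ℝ))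
    (hC : C = {p | ∀ j, 0 < a j * p.1 + b j * p.2 - c j})
    (hsub : C ⊆ Set.Ico (0:ℝ) 1 ×ˢ Set.Ico (0:ℝ) 1) :
    GoodDC (secF C α) ∧
      ∀ y, Integrable fun t => Set.indicator C (fun _ => (1:ℝ)) (t, y + α * t) := by
  obtain ⟨l, u, K, L, hl, hu, hK, hL, hiff⟩ := cell_section Finset.univ a b c α fun j _ => h j
  have hsec : ∀ y t, (t, y + α * t) ∈ C ↔ t ∈ Set.Ioo (l y) (u y) := by
    intro y t
    rw [Set.mem_Ioo, hiff]
    constructor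
    · intro ht
      have h1 := (Set.mem_prod.mp (hsub ht)).1
      simp only at h1
      rw [hC] at ht
      exact ⟨by linarith [h1.1], by linarith [h1.2], fun j _ => ht j⟩
    · rintro ⟨_, _, h3⟩
      rw [hC]
      exact fun j => h3 j (Finset.mem_univ j)
  have hind : ∀ y, (fun t => Set.indicator C (fun _ => (1:ℝ)) (t, y + α * t)) =
      Set.indicator (Set.Ioo (l y) (u y)) (fun _ => (1:ℝ)) := by
    intro y; ext t
    by_cases ht : (t, y + α * t) ∈ C
    · rw [Set.indicator_of_mem ht, Set.indicator_of_mem ((hsec y t).mp ht)]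
    · rw [Set.indicator_of_notMem ht, Set.indicator_of_notMem (fun h' => ht ((hsec y t).mpr h'))]
  have hF : ∀ y, secF C α y = max (u y - l y) 0 := by
    intro y
    unfold secF
    rw [hind, integral_indicator measurableSet_Ioo, setIntegral_const, Real.volume_real_Ioo]
    simp
  constructor
  · refine ⟨fun y => max (l y - u y) 0, fun y => l y - u y, max (K + L) 0, K + L, 1 + |α|, ?_, ?_, ?_, ?_, ?_, ?_⟩
    · exact (hl.sub hu).sup (convexOn_const _ convex_univ)
    · exact hl.sub hu
    · exact (hK.sub hL).max (LipschitzWith.const 0)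
    · exact hK.sub hL
    · intro y
      rw [hF]
      simp only
      rcases le_total (u y) (l y) with h1 | h1
      · rw [max_eq_right (by linarith), max_eq_left (by linarith)]; ring
      · rw [max_eq_left (by linarith), max_eq_right (by linarith)]; ring
    · intro y hy
      unfold secF
      have : ∀ t, (t, y + α * t) ∉ C := by
        intro t ht
        have h1 := Set.mem_prod.mp (hsub ht)
        obtain ⟨⟨h2, h3⟩, h4, h5⟩ := h1
        simp only at h2 h3 h4 h5
        have h6 : |α * t| ≤ |α| := by
          rw [abs_mul, abs_of_nonneg h2]
          nlinarith [abs_nonneg α]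
        have h7 := abs_le.mp h6
        have : |y| ≤ 1 + |α| := by
          rw [abs_le]
          constructor <;> linarith
        linarith
      simp [Set.indicator_of_notMem (this _)]
  · intro y
    rw [hind]
    exact (integrable_indicator_iff measurableSet_Ioo).mpr (by simp)

lemma preconn_frontier {X : Type*} [TopologicalSpace X] {C S : Set X} (hC : IsPreconnected C)
    (hd : Disjoint C (frontier S)) (hne : (C ∩ S).Nonempty) : C ⊆ S := by
  have hcov : C ⊆ interior S ∪ (closure S)ᶜ := by
    intro p hp
    by_contra h
    simp only [Set.mem_union, not_or, Set.mem_compl_iff, not_not] at h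
    exact Set.disjoint_left.mp hd hp ⟨h.2, h.1⟩
  obtain ⟨q, hqC, hqS⟩ := hne
  have := hC.subset_left_of_subset_union isOpen_interior isClosed_closure.isOpen_compl
    (Set.disjoint_left.mpr fun x hx hx' => hx' (interior_subset_closure hx)) hcov ⟨q, hqC, by
      rcases hcov hqC with h | h
      · exact h
      · exact absurd (subset_closure hqS) h⟩
  exact this.trans interior_subset

lemma poly_good {ι : Type*} [Fintype ι] (a b c : ι → ℝ) (α : ℝ)
    (h : ∀ j, a j + b j * α ≠ 0) (S : Set (ℝ × ℝ))
    (hS : S ⊆ Set.Ico (0:ℝ) 1 ×ˢ Set.Ico (0:ℝ) 1)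
    (hfr : ∀ p ∈ frontier S, ∃ j, a j * p.1 + b j * p.2 - c j = 0) :
    GoodDC (secF (S \ {p | ∃ j, a j * p.1 + b j * p.2 - c j = 0}) α) := by
  classical
  set S' := S \ {p | ∃ j, a j * p.1 + b j * p.2 - c j = 0} with hS'
  let sg : Bool → ℝ := fun x => if x then 1 else -1
  have hsg : ∀ x, sg x ≠ 0 := by intro x; cases x <;> simp [sg]
  let C : (ι → Bool) → Set (ℝ × ℝ) := fun σ =>
    {p | ∀ j, 0 < (sg (σ j) * a j) * p.1 + (sg (σ j) * b j) * p.2 - sg (σ j) * c j}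
  have hCmem : ∀ σ p, p ∈ C σ ↔ ∀ j, 0 < sg (σ j) * (a j * p.1 + b j * p.2 - c j) := by
    intro σ p
    simp only [C, Set.mem_ofPred_eq]
    refine forall_congr' fun j => ?_
    rw [show (sg (σ j) * a j) * p.1 + (sg (σ j) * b j) * p.2 - sg (σ j) * c j =
      sg (σ j) * (a j * p.1 + b j * p.2 - c j) by ring]
  have hconv : ∀ σ, Convex ℝ (C σ) := by
    intro σ p hp q hq x y hx hy hxy
    intro j
    have h1 := hp j
    have h2 := hq j
    simp only [Prod.fst_add, Prod.snd_add, Prod.smul_fst, Prod.smul_snd, smul_eq_mul]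
    have hy' : y = 1 - x := by linarith
    have : (sg (σ j) * a j) * (x * p.1 + y * q.1) + (sg (σ j) * b j) * (x * p.2 + y * q.2) - sg (σ j) * c j
      = x * ((sg (σ j) * a j) * p.1 + (sg (σ j) * b j) * p.2 - sg (σ j) * c j) +
        y * ((sg (σ j) * a j) * q.1 + (sg (σ j) * b j) * q.2 - sg (σ j) * c j) := by
      subst hy'; ring
    rw [this]
    rcases hx.eq_or_lt with h0 | h0
    · have : y = 1 := by linarith
      rw [← h0, this]; linarith
    · have := mul_pos h0 h1
      have := mul_nonneg hy h2.le
      linarith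
  have hCS : ∀ σ p, p ∈ C σ → p ∈ S → C σ ⊆ S := by
    intro σ p hp hpS
    refine preconn_frontier (hconv σ).isPreconnected ?_ ⟨p, hp, hpS⟩
    rw [Set.disjoint_left]
    intro q hq hqf
    obtain ⟨j, hj⟩ := hfr q hqf
    have := (hCmem σ q).mp hq j
    rw [hj] at this
    simp at this
  let Sel : Finset (ι → Bool) := Finset.univ.filter fun σ => C σ ⊆ S
  have hind : ∀ p, Set.indicator S' (fun _ => (1:ℝ)) p = ∑ σ ∈ Sel, Set.indicator (C σ) (fun _ => (1:ℝ)) p := by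
    intro p
    by_cases hp : p ∈ S'
    · rw [Set.indicator_of_mem hp]
      let σ₀ : ι → Bool := fun j => decide (0 < a j * p.1 + b j * p.2 - c j)
      have hmem : p ∈ C σ₀ := by
        rw [hCmem]
        intro j
        rcases lt_trichotomy (a j * p.1 + b j * p.2 - c j) 0 with h1 | h1 | h1
        · simp only [σ₀, sg, not_lt.mpr h1.le, decide_false]
          simp; linarith
        · exact absurd ⟨j, h1⟩ hp.2
        · simp only [σ₀, sg, h1, decide_true]
          simp; linarith
      have huniq : ∀ σ, p ∈ C σ → σ = σ₀ := by
        intro σ hσ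
        ext1 j
        have h1 := (hCmem σ p).mp hσ j
        simp only [σ₀]
        cases hs : σ j
        · rw [hs] at h1; simp [sg] at h1
          symm; rw [decide_eq_false_iff_not]; linarith
        · rw [hs] at h1; simp [sg] at h1
          symm; rw [decide_eq_true_eq]; linarith
      rw [Finset.sum_eq_single σ₀]
      · rw [Set.indicator_of_mem hmem]
      · intro σ _ hne
        exact Set.indicator_of_notMem (fun h' => hne (huniq σ h')) _
      · intro hn
        exact absurd (Finset.mem_filter.mpr ⟨Finset.mem_univ σ₀, hCS σ₀ p hmem hp.1⟩ : σ₀ ∈ Sel) hn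
    · rw [Set.indicator_of_notMem hp]
      symm
      refine Finset.sum_eq_zero fun σ hσ => ?_
      refine Set.indicator_of_notMem (fun h' => hp ⟨(Finset.mem_filter.mp hσ).2 h', ?_⟩) _
      rintro ⟨j, hj⟩
      have := (hCmem σ p).mp h' j
      rw [hj] at this
      simp at this
  have hgood : ∀ σ ∈ Sel, GoodDC (secF (C σ) α) ∧
      ∀ y, Integrable fun t => Set.indicator (C σ) (fun _ => (1:ℝ)) (t, y + α * t) := by
    intro σ hσ
    refine cell_good (fun j => sg (σ j) * a j) (fun j => sg (σ j) * b j) (fun j => sg (σ j) * c j) α ?_ (C σ) rfl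
      ((Finset.mem_filter.mp hσ).2.trans hS)
    intro j
    rw [mul_assoc, ← mul_add]
    exact mul_ne_zero (hsg _) (h j)
  have heq : secF S' α = fun y => ∑ σ ∈ Sel, secF (C σ) α y := by
    ext y
    unfold secF
    simp_rw [hind]
    rw [integral_finsetSum]
    intro σ hσ
    exact (hgood σ hσ).2 y
  rw [heq]
  exact GoodDC.sum _ _ fun σ hσ => (hgood σ hσ).1

lemma ind_meas {S : Set (ℝ × ℝ)} (hm : MeasurableSet S) :
    Measurable (Set.indicator S (fun _ => (1:ℝ))) := measurable_const.indicator hm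

lemma ind_bound (S : Set (ℝ × ℝ)) (p : ℝ × ℝ) : ‖Set.indicator S (fun _ => (1:ℝ)) p‖ ≤ 1 := by
  by_cases h : p ∈ S
  · rw [Set.indicator_of_mem h]; simp
  · rw [Set.indicator_of_notMem h]; simp

lemma sec_integrable {S : Set (ℝ × ℝ)} (hm : MeasurableSet S)
    (hS : S ⊆ Set.Ico (0:ℝ) 1 ×ˢ Set.Ico (0:ℝ) 1) (α y : ℝ) :
    Integrable fun t => Set.indicator S (fun _ => (1:ℝ)) (t, y + α * t) := by
  have hmt : Measurable fun t : ℝ => (t, y + α * t) := by fun_prop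
  have e : (fun t => Set.indicator S (fun _ => (1:ℝ)) (t, y + α * t)) =
      Set.indicator ((fun t : ℝ => (t, y + α * t)) ⁻¹' S) (fun _ => (1:ℝ)) := by
    ext t; rfl
  rw [e, integrable_indicator_iff (hmt hm)]
  have hsub : ((fun t : ℝ => (t, y + α * t)) ⁻¹' S) ⊆ Set.Ico (0:ℝ) 1 := fun t ht => (hS ht).1
  exact (integrableOn_const (C := (1:ℝ)) (by simp : volume (Set.Ico (0:ℝ) 1) ≠ ⊤)).mono_set hsub

lemma sec_per {S : Set (ℝ × ℝ)} (hm : MeasurableSet S)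
    (hS : S ⊆ Set.Ico (0:ℝ) 1 ×ˢ Set.Ico (0:ℝ) 1) (α y : ℝ) :
    ∫ t in (0:ℝ)..1, Set.indicator S (fun _ => (1:ℝ)) (Int.fract t, Int.fract (y + α * t)) =
      ∑' m : ℤ, secF S α (y + m) := by
  obtain ⟨M, hM⟩ := exists_int_gt (|y| + |α| + 2)
  have hin : ∀ (t : ℝ) (m : ℤ), (t, y + m + α * t) ∈ S → m ∈ Finset.Icc (-M) M ∧ m = - ⌊y + α * t⌋ ∧ t ∈ Set.Ico (0:ℝ) 1 := by
    intro t m h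
    obtain ⟨⟨h2, h3⟩, h4, h5⟩ := Set.mem_prod.mp (hS h)
    simp only at h2 h3 h4 h5
    have h6 : |α * t| ≤ |α| := by
      rw [abs_mul, abs_of_nonneg h2]
      nlinarith [abs_nonneg α]
    have h7 := abs_le.mp h6
    have h8 := abs_le.mp (le_refl |y|)
    refine ⟨?_, ?_, h2, h3⟩
    · rw [Finset.mem_Icc]
      have : (-M:ℝ) ≤ m := by linarith
      have : (m:ℝ) ≤ M := by linarith
      exact ⟨by exact_mod_cast ‹(-M:ℝ) ≤ m›, by exact_mod_cast this⟩
    · have : ⌊y + α * t⌋ = -m := by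
        rw [Int.floor_eq_iff]
        push_cast
        constructor <;> linarith
      omega
  rw [tsum_eq_sum (s := Finset.Icc (-M) M)]
  · unfold secF
    rw [← integral_finsetSum _ fun (m : ℤ) _ => sec_integrable hm hS α (y + m)]
    rw [intervalIntegral.integral_of_le (by norm_num), ← integral_Ico_eq_integral_Ioc,
      ← integral_indicator measurableSet_Ico]
    congr 1; ext t
    by_cases ht : t ∈ Set.Ico (0:ℝ) 1
    · rw [Set.indicator_of_mem ht, Int.fract_eq_self.mpr ht]
      have hf : Int.fract (y + α * t) = y + ((-⌊y + α * t⌋ : ℤ):ℝ) + α * t := by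
        rw [Int.fract]; push_cast; ring
      rw [hf]
      rw [Finset.sum_eq_single (-⌊y + α * t⌋)]
      · intro m _ hne
        exact Set.indicator_of_notMem (fun h => hne (hin t m h).2.1) _
      · intro hn
        exact Set.indicator_of_notMem (fun h => hn (hin t _ h).1) _
    · rw [Set.indicator_of_notMem ht]
      symm
      refine Finset.sum_eq_zero fun m _ => ?_
      exact Set.indicator_of_notMem (fun h => ht (hin t m h).2.2) _
  · intro m hn
    unfold secF
    have : ∀ t, Set.indicator S (fun _ => (1:ℝ)) (t, y + m + α * t) = 0 := fun t =>
      Set.indicator_of_notMem (fun h => hn (hin t m h).1) _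
    simp_rw [this]; simp

lemma sec_total {S : Set (ℝ × ℝ)} (hm : MeasurableSet S)
    (hS : S ⊆ Set.Ico (0:ℝ) 1 ×ˢ Set.Ico (0:ℝ) 1) (α : ℝ) :
    ∫ y, secF S α y = (volume S).toReal := by
  have hmt : Measurable fun p : ℝ × ℝ => (p.2, p.1 + α * p.2) := by fun_prop
  have hIntg : Integrable (Function.uncurry fun y t : ℝ => Set.indicator S (fun _ => (1:ℝ)) (t, y + α * t))
      (volume.prod volume) := by
    have e : (Function.uncurry fun y t : ℝ => Set.indicator S (fun _ => (1:ℝ)) (t, y + α * t)) =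
      Set.indicator ((fun p : ℝ × ℝ => (p.2, p.1 + α * p.2)) ⁻¹' S) (fun _ => (1:ℝ)) := by
      ext ⟨y, t⟩; rfl
    rw [e, integrable_indicator_iff (hmt hm)]
    have hsub : ((fun p : ℝ × ℝ => (p.2, p.1 + α * p.2)) ⁻¹' S) ⊆
        Set.Icc (-(1 + |α|)) (1 + |α|) ×ˢ Set.Icc (0:ℝ) 1 := by
      rintro ⟨y, t⟩ h
      obtain ⟨⟨h2, h3⟩, h4, h5⟩ := Set.mem_prod.mp (hS h)
      simp only at h2 h3 h4 h5
      have h6 : |α * t| ≤ |α| := by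
        rw [abs_mul, abs_of_nonneg h2]
        nlinarith [abs_nonneg α]
      have h7 := abs_le.mp h6
      refine ⟨⟨?_, ?_⟩, h2, h3.le⟩ <;> simp only <;> linarith
    refine (integrableOn_const (C := (1:ℝ)) ?_).mono_set hsub
    exact (isCompact_Icc.prod isCompact_Icc).measure_lt_top.ne
  unfold secF
  rw [integral_integral_swap hIntg]
  have h1 : ∀ t : ℝ, ∫ y, Set.indicator S (fun _ => (1:ℝ)) (t, y + α * t) =
      ∫ y, Set.indicator S (fun _ => (1:ℝ)) (t, y) := fun t =>
    integral_add_right_eq_self (fun y => Set.indicator S (fun _ => (1:ℝ)) (t, y)) (α * t)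
  simp_rw [h1]
  have hIntg2 : Integrable (Set.indicator S (fun _ => (1:ℝ))) ((volume : Measure ℝ).prod volume) := by
    rw [integrable_indicator_iff hm]
    refine (integrableOn_const (C := (1:ℝ)) ?_).mono_set (hS.trans (Set.prod_mono Set.Ico_subset_Icc_self Set.Ico_subset_Icc_self))
    exact (isCompact_Icc.prod isCompact_Icc).measure_lt_top.ne
  rw [integral_integral (f := fun t y => Set.indicator S (fun _ => (1:ℝ)) (t, y)) hIntg2]
  change ∫ z : ℝ × ℝ, Set.indicator S (fun _ => (1:ℝ)) z ∂((volume : Measure ℝ).prod volume) = _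
  rw [integral_indicator hm, setIntegral_const]
  simp [Measure.real, Measure.volume_eq_prod]

lemma rot_bounded {S : Set (ℝ × ℝ)} (hm : MeasurableSet S)
    (hS : S ⊆ Set.Ico (0:ℝ) 1 ×ˢ Set.Ico (0:ℝ) 1) {α : ℝ} (hα : Irrational α)
    (hs : Summable fun k : ℤ => ((k:ℝ)^2 * ‖fourier k (α : UnitAddCircle) - 1‖)⁻¹)
    (hgood : GoodDC (secF S α)) (x₁ x₂ : ℝ) (hx₁ : x₁ ∈ Set.Ico (0:ℝ) 1) :
    IsBoundedRemainderSet S α x₁ x₂ := by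
  obtain ⟨C, hC⟩ := hgood.birkhoff hα hs
  refine ⟨C + 3, fun T hT => ?_⟩
  set V := (volume S).toReal with hV
  have hVtot : ∫ y, secF S α y = V := sec_total hm hS α
  have hV0 : 0 ≤ V := ENNReal.toReal_nonneg
  have hV1 : V ≤ 1 := by
    have h1 : volume S ≤ 1 := by
      refine (measure_mono hS).trans ?_
      rw [Measure.volume_eq_prod, Measure.prod_prod]
      simp
    exact ENNReal.toReal_le_of_le_ofReal zero_le_one (by simpa using h1)
  set y₀ := x₂ - α * x₁ with hy₀
  set G : ℝ → ℝ := fun s => Set.indicator S (fun _ => (1:ℝ)) (Int.fract s, Int.fract (y₀ + α * s)) with hG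
  have hGm : Measurable G := (ind_meas hm).comp (by fun_prop)
  have hGb : ∀ s, ‖G s‖ ≤ 1 := fun s => ind_bound S _
  have hGi : ∀ u v : ℝ, IntervalIntegrable G volume u v := by
    intro u v
    rw [intervalIntegrable_iff]
    have : IsFiniteMeasure (volume.restrict (Set.uIoc u v)) :=
      ⟨by rw [Measure.restrict_apply_univ, Set.uIoc]; exact measure_Ioc_lt_top⟩
    exact Integrable.of_bound hGm.aestronglyMeasurable 1 (Filter.Eventually.of_forall hGb)
  have e0 : ∫ t in (0:ℝ)..T, Set.indicator S (fun _ => (1:ℝ)) (Int.fract (x₁ + t), Int.fract (x₂ + α * t))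
      = ∫ s in x₁..(x₁ + T), G s := by
    have := intervalIntegral.integral_comp_add_left (a := 0) (b := T) G x₁
    rw [add_zero] at this
    rw [← this]
    congr 1; ext t
    simp only [hG]
    rw [show y₀ + α * (x₁ + t) = x₂ + α * t by rw [hy₀]; ring]
  set N := ⌊x₁ + T⌋₊ with hN
  have hN1 : (N:ℝ) ≤ x₁ + T := Nat.floor_le (by linarith [hx₁.1])
  have hN2 : x₁ + T < N + 1 := Nat.lt_floor_add_one _
  have e1 : ∫ s in (0:ℝ)..N, G s = ∑ n ∈ Finset.range N, ∑' m : ℤ, secF S α (y₀ + n * α + m) := by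
    have := intervalIntegral.sum_integral_adjacent_intervals (f := G) (μ := volume) (a := fun n : ℕ => (n:ℝ)) (n := N)
      (fun k _ => hGi _ _)
    rw [Nat.cast_zero] at this
    rw [← this]
    refine Finset.sum_congr rfl fun n _ => ?_
    rw [← sec_per hm hS]
    have h2 := intervalIntegral.integral_comp_add_left (a := 0) (b := 1) G (n:ℝ)
    rw [add_zero] at h2
    push_cast
    rw [← h2]
    congr 1; ext t
    simp only [hG]
    rw [Int.fract_natCast_add, show y₀ + α * (n + t) = y₀ + n * α + α * t by ring]
  have e2 : ∫ s in x₁..(x₁ + T), G s = (∫ s in (0:ℝ)..N, G s) + (∫ s in (N:ℝ)..(x₁ + T), G s) - ∫ s in (0:ℝ)..x₁, G s := by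
    have a1 := intervalIntegral.integral_add_adjacent_intervals (hGi 0 x₁) (hGi x₁ (x₁ + T))
    have a2 := intervalIntegral.integral_add_adjacent_intervals (hGi 0 N) (hGi N (x₁ + T))
    linarith
  have b1 := intervalIntegral.norm_integral_le_of_norm_le_const (a := (N:ℝ)) (b := x₁ + T) (f := G) (C := 1) (fun y _ => hGb y)
  have b2 := intervalIntegral.norm_integral_le_of_norm_le_const (a := (0:ℝ)) (b := x₁) (f := G) (C := 1) (fun y _ => hGb y)
  rw [Real.norm_eq_abs, one_mul, abs_of_nonneg (a := x₁ + T - N) (by linarith)] at b1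
  rw [Real.norm_eq_abs, one_mul, sub_zero, abs_of_nonneg hx₁.1] at b2
  have hB := hC y₀ N
  rw [hVtot, ← e1] at hB
  unfold rotDelta
  rw [e0, e2, ← hV]
  have c1 := abs_le.mp b1
  have c2 := abs_le.mp b2
  have c3 := abs_le.mp hB
  have c4 := hx₁.1
  have c5 := hx₁.2
  have t1 : -V ≤ (T - N) * V := by nlinarith
  have t2 : (T - N) * V ≤ V := by nlinarith
  rw [abs_le]
  constructor <;> nlinarith

lemma line_null (a b c : ℝ) (h : ¬ (a = 0 ∧ b = 0)) :
    volume {p : ℝ × ℝ | a * p.1 + b * p.2 - c = 0} = 0 := by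
  have hcl : IsClosed {p : ℝ × ℝ | a * p.1 + b * p.2 - c = 0} :=
    isClosed_eq (by fun_prop) continuous_const
  rw [Measure.volume_eq_prod, Measure.measure_prod_null hcl.measurableSet]
  by_cases hb : b = 0
  · have ha : a ≠ 0 := fun h0 => h ⟨h0, hb⟩
    have : ∀ᵐ x : ℝ, x ≠ c / a := by simp [ae_iff]
    filter_upwards [this] with x hx
    have : (Prod.mk x ⁻¹' {p : ℝ × ℝ | a * p.1 + b * p.2 - c = 0}) = ∅ := by
      ext y
      simp only [Set.mem_preimage, Set.mem_ofPred_eq, Set.mem_empty_iff_false, iff_false]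
      intro h1
      apply hx
      rw [eq_div_iff ha]
      rw [hb] at h1
      linarith
    rw [this]; simp
  · refine Filter.Eventually.of_forall fun x => ?_
    have : (Prod.mk x ⁻¹' {p : ℝ × ℝ | a * p.1 + b * p.2 - c = 0}) ⊆ {(c - a * x) / b} := by
      intro y hy
      simp only [Set.mem_preimage, Set.mem_ofPred_eq] at hy
      rw [Set.mem_singleton_iff, eq_div_iff hb]
      linarith
    exact measure_mono_null this (by simp)

lemma rot_eq {ι : Type*} [Finite ι] (a b c : ι → ℝ) (α : ℝ)
    (h : ∀ j, a j + b j * α ≠ 0) (S : Set (ℝ × ℝ)) (x₁ x₂ T : ℝ) :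
    rotDelta S α x₁ x₂ T =
      rotDelta (S \ {p | ∃ j, a j * p.1 + b j * p.2 - c j = 0}) α x₁ x₂ T := by
  set Z : Set (ℝ × ℝ) := {p | ∃ j, a j * p.1 + b j * p.2 - c j = 0} with hZ
  have hZ0 : volume Z = 0 := by
    have : Z = ⋃ j, {p : ℝ × ℝ | a j * p.1 + b j * p.2 - c j = 0} := by
      ext p; simp [hZ]
    rw [this, measure_iUnion_null_iff]
    intro j
    apply line_null
    rintro ⟨ha, hb⟩
    apply h j
    rw [ha, hb]; simp
  unfold rotDelta
  rw [measure_sdiff_null hZ0]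
  congr 1
  apply intervalIntegral.integral_congr_ae
  have hcount : (⋃ q : ι × ℤ × ℤ, {(c q.1 - a q.1 * (x₁ - q.2.1) - b q.1 * (x₂ - q.2.2)) / (a q.1 + b q.1 * α)} : Set ℝ).Countable :=
    Set.countable_iUnion fun _ => Set.countable_singleton _
  filter_upwards [hcount.ae_notMem volume] with t ht _
  set p : ℝ × ℝ := (Int.fract (x₁ + t), Int.fract (x₂ + α * t)) with hp
  have hpZ : p ∉ Z := by
    rintro ⟨j, hj⟩
    apply ht
    rw [Set.mem_iUnion]
    refine ⟨(j, ⌊x₁ + t⌋, ⌊x₂ + α * t⌋), ?_⟩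
    rw [Set.mem_singleton_iff, eq_div_iff (h j)]
    simp only [hp, Int.fract] at hj
    linear_combination hj
  by_cases hpS : p ∈ S
  · rw [Set.indicator_of_mem hpS, Set.indicator_of_mem (show p ∈ S \ Z from ⟨hpS, hpZ⟩)]
  · rw [Set.indicator_of_notMem hpS, Set.indicator_of_notMem fun h' => hpS h'.1]

theorem statement3 (S : Set (ℝ × ℝ))
    (hS : S ⊆ Set.Ico (0:ℝ) 1 ×ˢ Set.Ico (0:ℝ) 1) (hpoly : IsPolygon S) :
    ∀ᵐ α : ℝ ∂volume, 0 < α →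
      ∀ x₁ x₂ : ℝ, x₁ ∈ Set.Ico (0:ℝ) 1 → x₂ ∈ Set.Ico (0:ℝ) 1 →
        IsBoundedRemainderSet S α x₁ x₂ := by
  classical
  obtain ⟨n, hn, v, hv⟩ := hpoly
  haveI : NeZero n := ⟨by omega⟩
  -- a line through each edge
  have hline : ∀ i : ZMod n, ∃ a b c : ℝ, ¬ (a = 0 ∧ b = 0) ∧
      ∀ p ∈ segment ℝ (v i) (v (i + 1)), a * p.1 + b * p.2 - c = 0 := by
    intro i
    by_cases hd : v i = v (i + 1)
    · refine ⟨1, 0, (v i).1, by simp, ?_⟩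
      intro p hp
      rw [← hd, segment_same, Set.mem_singleton_iff] at hp
      rw [hp]; ring
    · refine ⟨-((v (i+1)).2 - (v i).2), (v (i+1)).1 - (v i).1,
        ((v (i+1)).1 - (v i).1) * (v i).2 - ((v (i+1)).2 - (v i).2) * (v i).1, ?_, ?_⟩
      · rintro ⟨h1, h2⟩
        apply hd
        ext <;> linarith
      · rintro p ⟨s, t, hs, ht, hst, rfl⟩
        have : s = 1 - t := by linarith
        subst this
        simp only [Prod.fst_add, Prod.snd_add, Prod.smul_fst, Prod.smul_snd, smul_eq_mul]
        ring
  choose a b c hab hseg using hline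
  have hfr : ∀ p ∈ frontier S, ∃ j, a j * p.1 + b j * p.2 - c j = 0 := by
    intro p hp
    rw [hv, Set.mem_iUnion] at hp
    obtain ⟨i, hi⟩ := hp
    exact ⟨i, hseg i p hi⟩
  have hbad : ∀ᵐ α : ℝ, ∀ j, a j + b j * α ≠ 0 := by
    rw [ae_all_iff]
    intro j
    have : ∀ᵐ α : ℝ, α ≠ -a j / b j := by simp [ae_iff]
    filter_upwards [this] with α hα h0
    by_cases hb : b j = 0
    · rw [hb] at h0
      exact hab j ⟨by linarith, hb⟩
    · apply hα
      rw [eq_div_iff hb]; linarith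
  have hirr : ∀ᵐ α : ℝ, Irrational α := by
    have : (Set.range ((↑) : ℚ → ℝ)).Countable := Set.countable_range _
    filter_upwards [this.ae_notMem volume] with α hα using hα
  filter_upwards [hbad, hirr, dioph] with α h1 h2 h3 _ x₁ x₂ hx₁ _
  set S' := S \ {p | ∃ j, a j * p.1 + b j * p.2 - c j = 0} with hS'
  have hZc : IsClosed {p : ℝ × ℝ | ∃ j, a j * p.1 + b j * p.2 - c j = 0} := by
    have : {p : ℝ × ℝ | ∃ j, a j * p.1 + b j * p.2 - c j = 0} =
        ⋃ j, {p : ℝ × ℝ | a j * p.1 + b j * p.2 - c j = 0} := by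
      ext p; simp
    rw [this]
    exact isClosed_iUnion_of_finite fun j => isClosed_eq (by fun_prop) continuous_const
  have hm : MeasurableSet S' := by
    have : S' = interior S \ {p | ∃ j, a j * p.1 + b j * p.2 - c j = 0} := by
      ext p
      constructor
      · rintro ⟨hp, hpZ⟩
        refine ⟨?_, hpZ⟩
        by_contra hni
        exact hpZ (hfr p ⟨subset_closure hp, hni⟩)
      · rintro ⟨hp, hpZ⟩
        exact ⟨interior_subset hp, hpZ⟩
    rw [this]
    exact isOpen_interior.measurableSet.diff hZc.measurableSet
  have hS'sub : S' ⊆ Set.Ico (0:ℝ) 1 ×ˢ Set.Ico (0:ℝ) 1 := Set.sdiff_subset.trans hS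
  obtain ⟨C, hC⟩ := rot_bounded hm hS'sub h2 h3 (poly_good a b c α h1 S hS hfr) x₁ x₂ hx₁
  refine ⟨C, fun T hT => ?_⟩
  rw [rot_eq a b c α h1 S x₁ x₂ T]
  exact hC T hT
end

section
/- Let S be a fixed convex set contained in [0,1)² whose boundary ∂S is a twice continuously differentiable curve with strictly positive curvature at every point. Then for almost every α > 0 (with respect to Lebesgue measure) and every starting point x ∈ [0,1)², the set S is a bounded remainder set for the continuous irrational rotation with slope α and starting point x. -/
open MeasureTheory

/-- The boundary of `S` is a closed twice continuously differentiable curve,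
parametrized by arc length (`|C'(s)| = 1` in the Euclidean norm), whose
curvature `κ(s) = |C''(s)|` is strictly positive at every point. -/
def HasC2PosCurvBoundary (S : Set (ℝ × ℝ)) : Prop :=
  ∃ (L : ℝ) (c₁ c₂ : ℝ → ℝ), 0 < L ∧
    ContDiff ℝ 2 c₁ ∧ ContDiff ℝ 2 c₂ ∧
    Function.Periodic c₁ L ∧ Function.Periodic c₂ L ∧
    (∀ s : ℝ, (deriv c₁ s) ^ 2 + (deriv c₂ s) ^ 2 = 1) ∧
    (∀ s : ℝ, 0 < (deriv (deriv c₁) s) ^ 2 + (deriv (deriv c₂) s) ^ 2) ∧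
    frontier S = Set.range (fun s => (c₁ s, c₂ s))

section Aux
open Set Filter Topology
open scoped FourierTransform

lemma quad_lower (φ : ℝ → ℝ) (hφ : ContDiff ℝ 2 φ) (s : ℝ) (h1 : deriv φ s = 0)
    (h2 : 0 < deriv (deriv φ) s) :
    ∃ m > 0, ∀ᶠ x in 𝓝 s, φ s + m * (x - s) ^ 2 ≤ φ x := by
  set m := deriv (deriv φ) s / 4 with hm
  refine ⟨m, by positivity, ?_⟩
  have hd : Differentiable ℝ φ := hφ.differentiable (by norm_num)
  have hd' : Differentiable ℝ (deriv φ) := by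
    have : ContDiff ℝ 1 (deriv φ) := by
      have := (contDiff_succ_iff_deriv (n := 1) (f := φ)).1 (by rw [one_add_one_eq_two]; exact hφ)
      exact this.2.2
    exact this.differentiable (by norm_num)
  have hg : deriv (fun x => φ x - m * (x - s) ^ 2) = fun x => deriv φ x - 2 * m * (x - s) := by
    funext x
    have : HasDerivAt (fun x => φ x - m * (x - s) ^ 2)
        (deriv φ x - m * (2 * (x - s) ^ 1 * 1)) x := by
      refine (hd x).hasDerivAt.sub (HasDerivAt.const_mul m ?_)
      exact (((hasDerivAt_id x).sub_const s).pow 2).congr_deriv (by simp)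
    rw [this.deriv]; ring
  have hg2 : deriv (deriv (fun x => φ x - m * (x - s) ^ 2)) s = deriv (deriv φ) s - 2 * m := by
    rw [hg]
    have : HasDerivAt (fun x => deriv φ x - 2 * m * (x - s)) (deriv (deriv φ) s - 2 * m * 1) s := by
      refine (hd' s).hasDerivAt.sub (HasDerivAt.const_mul _ ?_)
      exact (hasDerivAt_id s).sub_const s
    rw [this.deriv]; ring
  have key : IsLocalMin (fun x => φ x - m * (x - s) ^ 2) s := by
    apply isLocalMin_of_deriv_deriv_pos
    · rw [hg2, hm]; linarith
    · rw [hg]; simp [h1]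
    · have := hd.continuous; fun_prop
  filter_upwards [key] with x hx
  simp at hx
  linarith

lemma lip_of_deriv (c : ℝ → ℝ) (hc : Differentiable ℝ c) (h : ∀ s, |deriv c s| ≤ 1) (x y : ℝ) :
    (c x - c y) ^ 2 ≤ (x - y) ^ 2 := by
  have := Convex.norm_image_sub_le_of_norm_deriv_le (f := c) (C := 1) (s := univ)
    (fun x _ => hc x) (fun x _ => by simpa using h x) convex_univ (mem_univ y) (mem_univ x)
  rw [one_mul] at this
  exact sq_le_sq.2 this

lemma geom (S : Set (ℝ × ℝ)) (hS : Bornology.IsBounded S)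
    (hconv : Convex ℝ S) (L : ℝ) (c₁ c₂ : ℝ → ℝ) (hL : 0 < L)
    (hc₁ : ContDiff ℝ 2 c₁) (hc₂ : ContDiff ℝ 2 c₂)
    (hp₁ : Function.Periodic c₁ L) (hp₂ : Function.Periodic c₂ L)
    (hu : ∀ s : ℝ, (deriv c₁ s) ^ 2 + (deriv c₂ s) ^ 2 = 1)
    (hk : ∀ s : ℝ, 0 < (deriv (deriv c₁) s) ^ 2 + (deriv (deriv c₂) s) ^ 2)
    (hfr : frontier S = Set.range (fun s => (c₁ s, c₂ s)))
    (u v : ℝ) (huv : 0 < u ^ 2 + v ^ 2) :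
    ∃ p₀ ∈ closure S, ∃ C : ℝ, 0 ≤ C ∧ ∀ p ∈ closure S,
      (p.1 - p₀.1) ^ 2 + (p.2 - p₀.2) ^ 2 ≤ C * ((u * p.1 + v * p.2) - (u * p₀.1 + v * p₀.2)) := by
  have hK : IsCompact (closure S) := hS.isCompact_closure
  have hKc : Convex ℝ (closure S) := hconv.closure
  have hfrK : ∀ s, (c₁ s, c₂ s) ∈ closure S := fun s =>
    frontier_subset_closure (hfr ▸ mem_range_self s)
  have hw : Continuous (fun p : ℝ × ℝ => u * p.1 + v * p.2) := by fun_prop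
  obtain ⟨p₀, hp₀, hmin⟩ := hK.exists_isMinOn ⟨_, hfrK 0⟩ hw.continuousOn
  rw [isMinOn_iff] at hmin
  set a := u * p₀.1 + v * p₀.2 with ha
  set φ : ℝ → ℝ := fun s => u * c₁ s + v * c₂ s with hφ
  have hφ2 : ContDiff ℝ 2 φ := by fun_prop
  have hφa : ∀ s, a ≤ φ s := fun s => hmin _ (hfrK s)
  have hd₁ : Differentiable ℝ c₁ := hc₁.differentiable (by norm_num)
  have hd₂ : Differentiable ℝ c₂ := hc₂.differentiable (by norm_num)
  have hD : ∀ {c : ℝ → ℝ}, ContDiff ℝ 2 c → Differentiable ℝ (deriv c) := by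
    intro c hc
    have : ContDiff ℝ 1 (deriv c) := by
      have := (contDiff_succ_iff_deriv (n := 1) (f := c)).1 (by rw [one_add_one_eq_two]; exact hc)
      exact this.2.2
    exact this.differentiable (by norm_num)
  have hdφ : deriv φ = fun s => u * deriv c₁ s + v * deriv c₂ s := by
    funext s
    exact (((hd₁ s).hasDerivAt.const_mul u).add ((hd₂ s).hasDerivAt.const_mul v)).deriv
  have hddφ : ∀ s, deriv (deriv φ) s = u * deriv (deriv c₁) s + v * deriv (deriv c₂) s := by
    intro s
    rw [hdφ]
    exact (((hD hc₁ s).hasDerivAt.const_mul u).add ((hD hc₂ s).hasDerivAt.const_mul v)).deriv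
  have horth : ∀ s, deriv c₁ s * deriv (deriv c₁) s + deriv c₂ s * deriv (deriv c₂) s = 0 := by
    intro s
    have h1 := (((hD hc₁ s).hasDerivAt.pow 2).add ((hD hc₂ s).hasDerivAt.pow 2)).deriv
    have h2 : (deriv c₁ ^ 2 + deriv c₂ ^ 2 : ℝ → ℝ) = fun _ => 1 := by
      funext s; exact hu s
    rw [h2] at h1
    simp at h1
    linarith
  have hquad : ∀ s, φ s = a → ∃ m > 0, ∀ᶠ x in 𝓝 s, φ s + m * (x - s) ^ 2 ≤ φ x := by
    intro s hs
    have hloc : IsLocalMin φ s := Filter.Eventually.of_forall (fun x => by rw [hs]; exact hφa x)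
    have h1 : deriv φ s = 0 := hloc.deriv_eq_zero
    apply quad_lower φ hφ2 s h1
    rcases lt_trichotomy 0 (deriv (deriv φ) s) with h | h | h
    · exact h
    · exfalso
      rw [hddφ] at h
      rw [hdφ] at h1
      simp only at h1
      have h3 := horth s
      have h4 := hu s
      have h5 := hk s
      set A := deriv c₁ s
      set B := deriv c₂ s
      set P := deriv (deriv c₁) s
      set Q := deriv (deriv c₂) s
      have e1 : (u * B - v * A) ^ 2 = u ^ 2 + v ^ 2 := by
        linear_combination (u ^ 2 + v ^ 2) * h4 - (u * A + v * B) * h1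
      have e2 : (P * B - Q * A) ^ 2 = P ^ 2 + Q ^ 2 := by
        linear_combination (P ^ 2 + Q ^ 2) * h4 - (A * P + B * Q) * h3
      have e3 : (u * B - v * A) * (P * B - Q * A) = 0 := by
        linear_combination (u * P + v * Q) * h4 - (u * A + v * B) * h3 - h
      rcases mul_eq_zero.1 e3 with e | e
      · rw [e] at e1; simp at e1; linarith
      · rw [e] at e2; simp at e2; linarith
    · exfalso
      obtain ⟨m, hm, hev⟩ := quad_lower (fun x => - φ x) hφ2.neg s
        (by rw [deriv.fun_neg, h1, neg_zero])
        (by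
          have : deriv (fun x => - φ x) = fun x => - deriv φ x := by
            funext x; exact deriv.fun_neg
          rw [this, deriv.fun_neg]; linarith)
      have := (hev.filter_mono nhdsWithin_le_nhds).and
        (self_mem_nhdsWithin : {s}ᶜ ∈ 𝓝[≠] s)
      obtain ⟨x, hx, hxs⟩ := this.exists
      have h6 : 0 < m * (x - s) ^ 2 := by
        have : x - s ≠ 0 := sub_ne_zero.2 hxs
        positivity
      have := hφa x
      linarith
  -- parametrise by one period
  have hper : ∀ p ∈ frontier S, ∃ s ∈ Icc 0 L, p = (c₁ s, c₂ s) := by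
    intro p hp
    rw [hfr] at hp
    obtain ⟨s, rfl⟩ := hp
    have hpp : Function.Periodic (fun s => (c₁ s, c₂ s)) L := fun x => by simp [hp₁ x, hp₂ x]
    obtain ⟨y, hy, hxy⟩ := hpp.exists_mem_Ico₀ hL s
    exact ⟨y, Ico_subset_Icc_self hy, hxy⟩
  -- the minimising face is a point
  have hfin : {s ∈ Icc 0 L | φ s = a}.Finite := by
    have : ∀ t : Set ℝ, t = Icc 0 L → {s ∈ t | φ s = a}.Finite := by
      rintro t rfl
      refine (isCompact_Icc (a := (0:ℝ)) (b := L)).induction_on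
        (p := fun t => {s ∈ t | φ s = a}.Finite) (by simp) ?_ ?_ ?_
      · intro s t hst ht
        exact ht.subset (fun x hx => ⟨hst hx.1, hx.2⟩)
      · intro s t hs ht
        refine (hs.union ht).subset ?_
        rintro x ⟨hx | hx, h⟩
        · exact Or.inl ⟨hx, h⟩
        · exact Or.inr ⟨hx, h⟩
      · intro s _
        by_cases hsa : φ s = a
        · obtain ⟨m, hm, hev⟩ := hquad s hsa
          refine ⟨_, mem_nhdsWithin_of_mem_nhds hev, (finite_singleton s).subset ?_⟩
          rintro x ⟨hx, hxa⟩
          simp only [mem_ofPred_eq] at hx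
          have : m * (x - s) ^ 2 ≤ 0 := by linarith
          have h2 : (x - s) ^ 2 ≤ 0 := by
            by_contra hcon
            push Not at hcon
            have := mul_pos hm hcon
            linarith
          have : x - s = 0 := by
            have := le_antisymm h2 (sq_nonneg _)
            exact pow_eq_zero_iff (two_ne_zero) |>.1 this
          exact mem_singleton_iff.2 (by linarith)
        · have hev : {x | φ x ≠ a} ∈ 𝓝 s := hφ2.continuous.continuousAt.eventually_ne hsa
          refine ⟨_, mem_nhdsWithin_of_mem_nhds hev, ?_⟩
          convert finite_empty
          ext x; simp; 
    exact this _ rfl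
  have hface : ∀ p ∈ closure S, u * p.1 + v * p.2 = a → p ∈ frontier S := by
    intro p hp hpa
    refine ⟨hp, fun hitg => ?_⟩
    have hcont : ContinuousAt (fun ε : ℝ => (p.1 - ε * u, p.2 - ε * v)) 0 := by fun_prop
    have hev : ∀ᶠ ε : ℝ in 𝓝 0, (p.1 - ε * u, p.2 - ε * v) ∈ interior S := by
      apply hcont.eventually_mem
      simpa using isOpen_interior.mem_nhds hitg
    have := (hev.filter_mono nhdsWithin_le_nhds).and (self_mem_nhdsWithin : Ioi (0:ℝ) ∈ 𝓝[>] 0)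
    obtain ⟨ε, hε, hε0⟩ := this.exists
    have h1 := hmin _ (subset_closure (interior_subset hε))
    have h2 : 0 < ε * (u ^ 2 + v ^ 2) := mul_pos hε0 huv
    simp only at h1
    nlinarith
  have huniq : ∀ p ∈ closure S, u * p.1 + v * p.2 = a → p = p₀ := by
    intro p hp hpa
    set F : Set (ℝ × ℝ) := {p ∈ closure S | u * p.1 + v * p.2 = a} with hF
    have hFfin : F.Finite := by
      refine (hfin.image (fun s => (c₁ s, c₂ s))).subset ?_
      rintro q ⟨hq, hqa⟩
      obtain ⟨s, hs, rfl⟩ := hper q (hface q hq hqa)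
      exact ⟨s, ⟨hs, hqa⟩, rfl⟩
    have hFc : Convex ℝ F := by
      refine hKc.inter ?_
      intro x hx y hy s t hs ht hst
      have hx' : u * x.1 + v * x.2 = a := hx
      have hy' : u * y.1 + v * y.2 = a := hy
      change u * (s * x.1 + t * y.1) + v * (s * x.2 + t * y.2) = a
      linear_combination s * hx' + t * hy' + a * hst
    by_contra hne
    exact hFc.isPreconnected.infinite_of_nontrivial
      ⟨p, ⟨hp, hpa⟩, p₀, ⟨hp₀, ha.symm⟩, hne⟩ hFfin
  -- quadratic bound on the frontier
  have hab : ∀ (x y : ℝ), x ^ 2 + y ^ 2 = 1 → |x| ≤ 1 ∧ |y| ≤ 1 := by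
    intro x y h
    constructor <;> rw [← sq_le_one_iff_abs_le_one] <;> nlinarith [sq_nonneg x, sq_nonneg y]
  have hcover : ∃ C : ℝ, 0 ≤ C ∧ ∀ s ∈ Icc 0 L,
      (c₁ s - p₀.1) ^ 2 + (c₂ s - p₀.2) ^ 2 ≤ C * (φ s - a) := by
    refine (isCompact_Icc (a := (0:ℝ)) (b := L)).induction_on
      (p := fun t => ∃ C : ℝ, 0 ≤ C ∧ ∀ s ∈ t,
        (c₁ s - p₀.1) ^ 2 + (c₂ s - p₀.2) ^ 2 ≤ C * (φ s - a)) ⟨0, le_rfl, by simp⟩ ?_ ?_ ?_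
    · rintro s t hst ⟨C, hC, h⟩
      exact ⟨C, hC, fun x hx => h x (hst hx)⟩
    · rintro s t ⟨C, hC, h⟩ ⟨C', hC', h'⟩
      refine ⟨max C C', le_max_of_le_left hC, ?_⟩
      rintro x (hx | hx)
      · exact (h x hx).trans (mul_le_mul_of_nonneg_right (le_max_left _ _) (sub_nonneg.2 (hφa x)))
      · exact (h' x hx).trans (mul_le_mul_of_nonneg_right (le_max_right _ _) (sub_nonneg.2 (hφa x)))
    · intro s _
      by_cases hsa : φ s = a
      · obtain ⟨m, hm, hev⟩ := hquad s hsa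
        refine ⟨_, mem_nhdsWithin_of_mem_nhds hev, 2 / m, by positivity, ?_⟩
        intro x hx
        simp only [mem_ofPred_eq] at hx
        have hcs := huniq _ (hfrK s) hsa
        rw [← hcs]
        have l1 := lip_of_deriv c₁ hd₁ (fun s => (hab _ _ (hu s)).1) x s
        have l2 := lip_of_deriv c₂ hd₂ (fun s => (hab _ _ (hu s)).2) x s
        have : 2 * (x - s) ^ 2 ≤ 2 / m * (φ x - a) := by
          rw [div_mul_eq_mul_div, le_div_iff₀ hm]; nlinarith
        simp only
        linarith
      · have hlt : a < φ s := lt_of_le_of_ne (hφa s) (Ne.symm hsa)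
        set M := (c₁ s - p₀.1) ^ 2 + (c₂ s - p₀.2) ^ 2 + 1 with hM
        have hcc₁ := hc₁.continuous
        have hcc₂ := hc₂.continuous
        have ev1 : ∀ᶠ x in 𝓝 s, (a + φ s) / 2 < φ x :=
          hφ2.continuous.continuousAt.eventually (lt_mem_nhds (by linarith))
        have ev2 : ∀ᶠ x in 𝓝 s, (c₁ x - p₀.1) ^ 2 + (c₂ x - p₀.2) ^ 2 < M := by
          have : ContinuousAt (fun x => (c₁ x - p₀.1) ^ 2 + (c₂ x - p₀.2) ^ 2) s := by fun_prop
          exact this.eventually (gt_mem_nhds (by linarith))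
        have hM0 : 0 < M := by positivity
        have hq : 0 < φ s - a := by linarith
        refine ⟨_, mem_nhdsWithin_of_mem_nhds (ev1.and ev2), 2 * M / (φ s - a), by positivity, ?_⟩
        rintro x ⟨hx1, hx2⟩
        refine hx2.le.trans ?_
        rw [div_mul_eq_mul_div, le_div_iff₀ hq]
        nlinarith
  obtain ⟨C, hC, hCb⟩ := hcover
  refine ⟨p₀, hp₀, C, hC, ?_⟩
  set E : Set (ℝ × ℝ) := {p | (p.1 - p₀.1) ^ 2 + (p.2 - p₀.2) ^ 2 ≤ C * ((u * p.1 + v * p.2) - a)}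
    with hE
  have hEcl : IsClosed E := isClosed_le (by fun_prop) (by fun_prop)
  have hEcv : Convex ℝ E := by
    intro x hx y hy s t hs ht hst
    have hx' : (x.1 - p₀.1) ^ 2 + (x.2 - p₀.2) ^ 2 ≤ C * ((u * x.1 + v * x.2) - a) := hx
    have hy' : (y.1 - p₀.1) ^ 2 + (y.2 - p₀.2) ^ 2 ≤ C * ((u * y.1 + v * y.2) - a) := hy
    change ((s * x.1 + t * y.1) - p₀.1) ^ 2 + ((s * x.2 + t * y.2) - p₀.2) ^ 2 ≤
      C * ((u * (s * x.1 + t * y.1) + v * (s * x.2 + t * y.2)) - a)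
    have ht' : t = 1 - s := by linarith
    have h1 := mul_le_mul_of_nonneg_left hx' hs
    have h2 := mul_le_mul_of_nonneg_left hy' ht
    have h3 : 0 ≤ s * t * ((x.1 - y.1) ^ 2 + (x.2 - y.2) ^ 2) := by positivity
    subst ht'
    nlinarith
  have hsub : closure S ⊆ E := by
    rw [← closure_convexHull_extremePoints hK hKc]
    refine closure_minimal (convexHull_min ?_ hEcv) hEcl
    intro p hp
    have hpf : p ∈ frontier S := by
      refine ⟨hp.1, fun hitg => ?_⟩
      have hcont : ContinuousAt (fun ε : ℝ => (p.1 - ε, p.2)) 0 := by fun_prop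
      have hev : ∀ᶠ ε : ℝ in 𝓝 0, (p.1 - ε, p.2) ∈ interior S := by
        apply hcont.eventually_mem
        simpa using isOpen_interior.mem_nhds hitg
      have hcont' : ContinuousAt (fun ε : ℝ => (p.1 + ε, p.2)) 0 := by fun_prop
      have hev' : ∀ᶠ ε : ℝ in 𝓝 0, (p.1 + ε, p.2) ∈ interior S := by
        apply hcont'.eventually_mem
        simpa using isOpen_interior.mem_nhds hitg
      have := ((hev.and hev').filter_mono nhdsWithin_le_nhds).and
        (self_mem_nhdsWithin : Ioi (0:ℝ) ∈ 𝓝[>] 0)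
      obtain ⟨ε, ⟨hε, hε'⟩, hε0⟩ := this.exists
      have h := hp.2 (subset_closure (interior_subset hε)) (subset_closure (interior_subset hε'))
        ⟨1/2, 1/2, by norm_num, by norm_num, by norm_num, by
          ext <;> simp <;> ring⟩
      have := congrArg Prod.fst h
      simp at this
      exact absurd this (ne_of_gt hε0)
    obtain ⟨s, hs, rfl⟩ := hper p hpf
    exact hCb s hs
  exact fun p hp => hsub hp


lemma fourier_decay (f : ℝ → ℝ) (hf : Continuous f) (hf0 : ∀ y, 0 ≤ f y) (a b K : ℝ) (hK : 0 ≤ K)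
    (hfa : ∀ y, f y ≤ K * √(y - a)) (hfb : ∀ y, f y ≤ K * √(b - y))
    (hconc : ConcaveOn ℝ (Ioo a b) f) (hitg : Integrable f) (k : ℤ) (hk : k ≠ 0) :
    ‖𝓕 (fun y => (f y : ℂ)) (k : ℝ)‖ ≤ 2 * K * |(k : ℝ)| ^ (-(3/2) : ℝ) := by
  have hza : ∀ y, y ≤ a → f y = 0 := fun y hy => le_antisymm
    (by have := hfa y; rwa [Real.sqrt_eq_zero_of_nonpos (by linarith), mul_zero] at this) (hf0 y)
  have hzb : ∀ y, b ≤ y → f y = 0 := fun y hy => le_antisymm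
    (by have := hfb y; rwa [Real.sqrt_eq_zero_of_nonpos (by linarith), mul_zero] at this) (hf0 y)
  have hk' : 0 < |(k : ℝ)| := abs_pos.2 (by exact_mod_cast hk)
  set h : ℝ := 1 / (2 * |(k:ℝ)|) with hh
  have hh0 : 0 < h := by positivity
  set D : ℝ → ℝ := fun y => 2 * f y - f (y - h) - f (y + h) with hD
  have i1 : Integrable (fun y => f (y - h)) := hitg.comp_sub_right h
  have i2 : Integrable (fun y => f (y + h)) := hitg.comp_add_right h
  have hDi : Integrable D := ((hitg.const_mul 2).sub i1).sub i2
  have hD0 : ∫ y, D y = 0 := by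
    have i3 : Integrable (fun y => 2 * f y - f (y - h)) := (hitg.const_mul 2).sub i1
    simp only [hD]
    rw [integral_sub i3 i2, integral_sub (hitg.const_mul 2) i1,
      integral_const_mul, integral_sub_right_eq_self, integral_add_right_eq_self]
    ring
  set B : ℝ := 2 * (K * √(2 * h)) with hB
  have hB0 : 0 ≤ B := by positivity
  set U : Set ℝ := Icc (a - h) (a + h) ∪ Icc (b - h) (b + h) with hU
  have hUm : MeasurableSet U := measurableSet_Icc.union measurableSet_Icc
  have hUv : volume U ≤ ENNReal.ofReal (4 * h) := by
    refine (measure_union_le _ _).trans ?_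
    rw [Real.volume_Icc, Real.volume_Icc, ← ENNReal.ofReal_add (by linarith) (by linarith)]
    apply ENNReal.ofReal_le_ofReal; linarith
  have hptw : ∀ y, |D y| ≤ D y + 2 * U.indicator (fun _ => B) y := by
    intro y
    have hind : 0 ≤ U.indicator (fun _ => B) y := indicator_nonneg (fun _ _ => hB0) y
    have hy0 := hf0 y
    by_cases hyU : y ∈ U
    · rw [indicator_of_mem hyU]
      have hle : f (y - h) + f (y + h) ≤ B := by
        have mono : ∀ t, t ≤ 2 * h → K * √t ≤ K * √(2 * h) := fun t ht =>
          mul_le_mul_of_nonneg_left (Real.sqrt_le_sqrt ht) hK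
        rcases hyU with hy | hy
        · have h1 := (hfa (y - h)).trans (mono _ (by linarith [hy.2]))
          have h2 := (hfa (y + h)).trans (mono _ (by linarith [hy.2]))
          linarith
        · have h1 := (hfb (y - h)).trans (mono _ (by linarith [hy.1]))
          have h2 := (hfb (y + h)).trans (mono _ (by linarith [hy.1]))
          linarith
      rw [abs_le]
      constructor
      · simp only [hD]; linarith
      · linarith
    · have hDn : 0 ≤ D y := by
        have hyU' : ¬ (y ∈ Icc (a - h) (a + h)) ∧ ¬ (y ∈ Icc (b - h) (b + h)) := by
          simpa [hU, not_or] using hyU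
        rcases lt_or_ge y (a - h) with hy | hy
        · simp only [hD]
          rw [hza (y - h) (by linarith), hza (y + h) (by linarith)]; linarith
        rcases lt_or_ge (b + h) y with hy' | hy'
        · simp only [hD]
          rw [hzb (y - h) (by linarith), hzb (y + h) (by linarith)]; linarith
        have g1 : a + h < y := by
          by_contra hcon; exact hyU'.1 ⟨hy, not_lt.1 hcon⟩
        have g2 : y < b - h := by
          by_contra hcon; exact hyU'.2 ⟨not_lt.1 hcon, hy'⟩
        have := hconc.2 (show y - h ∈ Ioo a b from ⟨by linarith, by linarith⟩)
          (show y + h ∈ Ioo a b from ⟨by linarith, by linarith⟩)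
          (show (0:ℝ) ≤ 1/2 by norm_num) (show (0:ℝ) ≤ 1/2 by norm_num) (by norm_num)
        simp only [smul_eq_mul] at this
        rw [show (1/2 : ℝ) * (y - h) + 1/2 * (y + h) = y by ring] at this
        simp only [hD]; linarith
      rw [abs_of_nonneg hDn]; linarith
  have hindi : Integrable (U.indicator (fun _ => B)) :=
    (integrable_indicator_iff hUm).2 (integrableOn_const (hs := (hUv.trans_lt ENNReal.ofReal_lt_top).ne))
  have hDabs : ∫ y, |D y| ≤ 8 * h * B := by
    calc ∫ y, |D y| ≤ ∫ y, (D y + 2 * U.indicator (fun _ => B) y) :=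
          integral_mono hDi.abs (hDi.add (hindi.const_mul 2)) hptw
      _ = 2 * (volume.real U * B) := by
          rw [integral_add hDi (hindi.const_mul 2), hD0, integral_const_mul,
            integral_indicator_const _ hUm]; simp
      _ ≤ 2 * (4 * h * B) := by
          have : volume.real U ≤ 4 * h := ENNReal.toReal_le_of_le_ofReal (by positivity) hUv
          gcongr
      _ = _ := by ring
  -- the Fourier identity
  have hchar : ∀ σ : ℝ, |σ| = h → ∀ y : ℝ, (Real.fourierChar (-((y + σ) * (k:ℝ))) : ℂ)
      = - (Real.fourierChar (-(y * (k:ℝ))) : ℂ) := by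
    intro σ hσ y
    have hσk : σ * k = 1/2 ∨ σ * k = -(1/2) := by
      have : |σ * k| = 1/2 := by rw [abs_mul, hσ, hh]; field_simp
      rcases abs_eq (by norm_num) |>.1 this with h | h
      · exact Or.inl h
      · exact Or.inr h
    rw [Real.fourierChar_apply, Real.fourierChar_apply]
    rcases hσk with e | e
    · have : ((2 * Real.pi * -((y + σ) * (k:ℝ)) : ℝ) : ℂ) * Complex.I =
        ((2 * Real.pi * -(y * (k:ℝ)) : ℝ) : ℂ) * Complex.I - Real.pi * Complex.I := by
        rw [show 2 * Real.pi * -((y + σ) * (k:ℝ)) = 2 * Real.pi * -(y * (k:ℝ)) - Real.pi by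
          linear_combination (-2 * Real.pi) * e]
        push_cast; ring
      rw [this, Complex.exp_sub, Complex.exp_pi_mul_I, div_neg, div_one]
    · have : ((2 * Real.pi * -((y + σ) * (k:ℝ)) : ℝ) : ℂ) * Complex.I =
        ((2 * Real.pi * -(y * (k:ℝ)) : ℝ) : ℂ) * Complex.I + Real.pi * Complex.I := by
        rw [show 2 * Real.pi * -((y + σ) * (k:ℝ)) = 2 * Real.pi * -(y * (k:ℝ)) + Real.pi by
          linear_combination (-2 * Real.pi) * e]
        push_cast; ring
      rw [this, Complex.exp_add, Complex.exp_pi_mul_I]; simp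
  set e : ℝ → ℂ := fun y => (Real.fourierChar (-(y * (k:ℝ))) : ℂ) with he
  have hF : 𝓕 (fun y => (f y : ℂ)) (k : ℝ) = ∫ y, e y * (f y : ℂ) := by
    rw [Real.fourier_real_eq]; rfl
  have hec : Continuous e := by
    simp only [he, Real.fourierChar_apply]; fun_prop
  have hen : ∀ y, ‖e y‖ = 1 := fun y => Circle.norm_coe _
  have hmulI : ∀ g : ℝ → ℝ, Integrable g → Integrable (fun y => e y * (g y : ℂ)) := by
    intro g hg
    exact hg.ofReal.bdd_mul (c := 1) hec.aestronglyMeasurable (Eventually.of_forall (fun y => (hen y).le))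
  have hs1 : ∫ y, e y * (f (y - h) : ℂ) = - ∫ y, e y * (f y : ℂ) := by
    have := integral_sub_right_eq_self (μ := volume) (fun y => e (y + h) * (f y : ℂ)) h
    simp only [sub_add_cancel] at this
    rw [this, ← integral_neg]
    congr 1; funext y
    simp only [he]
    rw [hchar h (abs_of_pos hh0) y]; ring
  have hs2 : ∫ y, e y * (f (y + h) : ℂ) = - ∫ y, e y * (f y : ℂ) := by
    have := integral_add_right_eq_self (μ := volume) (fun y => e (y - h) * (f y : ℂ)) h
    simp only [add_sub_cancel_right] at this
    rw [this, ← integral_neg]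
    congr 1; funext y
    simp only [he, sub_eq_add_neg]
    rw [hchar (-h) (by rw [abs_neg, abs_of_pos hh0]) y]; ring
  have hF4 : 4 * 𝓕 (fun y => (f y : ℂ)) (k : ℝ) = ∫ y, e y * (D y : ℂ) := by
    have : (fun y => e y * (D y : ℂ)) = fun y => 2 * (e y * (f y : ℂ)) - e y * (f (y - h) : ℂ)
        - e y * (f (y + h) : ℂ) := by
      funext y; simp only [hD]; push_cast; ring
    have i4 : Integrable (fun y => 2 * (e y * (f y : ℂ)) - e y * (f (y - h) : ℂ)) :=
      ((hmulI f hitg).const_mul 2).sub (hmulI _ i1)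
    rw [this, integral_sub i4 (hmulI _ i2),
      integral_sub ((hmulI f hitg).const_mul 2) (hmulI _ i1), integral_const_mul, hs1, hs2, hF]
    ring
  have hfin : 4 * ‖𝓕 (fun y => (f y : ℂ)) (k : ℝ)‖ ≤ 8 * h * B := by
    calc 4 * ‖𝓕 (fun y => (f y : ℂ)) (k : ℝ)‖ = ‖∫ y, e y * (D y : ℂ)‖ := by rw [← hF4]; simp
      _ ≤ ∫ y, ‖e y * (D y : ℂ)‖ := norm_integral_le_integral_norm _
      _ = ∫ y, |D y| := by congr 1; funext y; simp [hen]
      _ ≤ _ := hDabs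
  have h2 : 2 * h = |(k:ℝ)| ^ (-1 : ℝ) := by rw [hh, Real.rpow_neg_one]; field_simp
  have h3 : √(2 * h) = |(k:ℝ)| ^ (-(1/2) : ℝ) := by
    rw [h2, Real.sqrt_eq_rpow, ← Real.rpow_mul hk'.le]; norm_num
  have h4 : 2 * h * √(2 * h) = |(k:ℝ)| ^ (-(3/2) : ℝ) := by
    rw [h3, h2, ← Real.rpow_add hk']; norm_num
  rw [← h4]
  rw [hB] at hfin
  nlinarith


lemma abs_rpow_integrable : IntegrableOn (fun x : ℝ => |x| ^ (-(4/5) : ℝ)) (Ioc (-(1/2)) (1/2)) := by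
  have h0 : IntervalIntegrable (fun x : ℝ => |x| ^ (-(4/5) : ℝ)) volume 0 (1/2) := by
    have := intervalIntegral.intervalIntegrable_rpow' (a := 0) (b := 1/2) (r := -(4/5)) (by norm_num)
    refine this.congr ?_
    intro x hx
    rw [uIoc_of_le (by norm_num)] at hx
    simp [abs_of_pos hx.1]
  have h1 : IntervalIntegrable (fun x : ℝ => |x| ^ (-(4/5) : ℝ)) volume (-(1/2)) 0 := by
    rw [IntervalIntegrable.iff_comp_neg]
    simpa using h0.symm
  exact (intervalIntegrable_iff_integrableOn_Ioc_of_le (by norm_num)).1 (h1.trans h0)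

lemma lint_finite : ∫⁻ x : UnitAddCircle, ENNReal.ofReal (‖x‖ ^ (-(4/5) : ℝ)) ≠ ⊤ := by
  have hm : Measurable (fun x : UnitAddCircle => ENNReal.ofReal (‖x‖ ^ (-(4/5) : ℝ))) := by
    fun_prop
  rw [← (UnitAddCircle.measurePreserving_mk (-(1/2))).lintegral_comp hm]
  have h2 := abs_rpow_integrable
  rw [show (-(1/2) + 1 : ℝ) = 1/2 by norm_num]
  have := h2.lintegral_lt_top
  refine ne_of_lt (lt_of_eq_of_lt ?_ this)
  apply setLIntegral_congr_fun measurableSet_Ioc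
  intro x hx
  have : ‖(x : UnitAddCircle)‖ = |x| := by
    rw [AddCircle.norm_coe_eq_abs_iff _ one_ne_zero]
    rw [abs_one, abs_le]; exact ⟨by linarith [hx.1], hx.2⟩
  simp only
  rw [this]

lemma ae_summable_circle : ∀ᵐ x : UnitAddCircle,
    Summable (fun k : ℤ => |(k:ℝ)| ^ (-(3/2) : ℝ) * ‖k • x‖⁻¹) := by
  set F : ℤ → UnitAddCircle → ENNReal := fun k x =>
    ENNReal.ofReal ((|(k:ℝ)| ^ (-(3/2) : ℝ) * ‖k • x‖⁻¹) ^ (4/5 : ℝ)) with hF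
  have hFm : ∀ k, Measurable (F k) := by intro k; simp only [hF]; fun_prop
  have hg : Measurable (fun x : UnitAddCircle => ENNReal.ofReal (‖x‖ ^ (-(4/5) : ℝ))) := by
    fun_prop
  have hFk : ∀ k, ∫⁻ x, F k x = ENNReal.ofReal (|(k:ℝ)| ^ (-(6/5) : ℝ)) *
      ∫⁻ x : UnitAddCircle, ENNReal.ofReal (‖x‖ ^ (-(4/5) : ℝ)) := by
    intro k
    have e : ∀ x, F k x = ENNReal.ofReal (|(k:ℝ)| ^ (-(6/5) : ℝ)) *
        ENNReal.ofReal (‖k • x‖ ^ (-(4/5) : ℝ)) := by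
      intro x
      simp only [hF]
      rw [← ENNReal.ofReal_mul (by positivity), Real.mul_rpow (by positivity) (by positivity),
        ← Real.rpow_mul (by positivity), ← Real.rpow_neg_one ‖k • x‖,
        ← Real.rpow_mul (by positivity)]
      norm_num
    simp_rw [e]
    rw [lintegral_const_mul _ (by fun_prop)]
    by_cases hk : k = 0
    · subst hk; norm_num
    · congr 1
      exact (Measure.measurePreserving_zsmul (volume : Measure UnitAddCircle) hk).lintegral_comp hg
  have hsum : ∫⁻ x, ∑' k, F k x ≠ ⊤ := by
    rw [lintegral_tsum (fun k => (hFm k).aemeasurable)]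
    simp_rw [hFk]
    rw [ENNReal.tsum_mul_right]
    exact ENNReal.mul_ne_top (Real.summable_abs_int_rpow (by norm_num)).tsum_ofReal_ne_top lint_finite
  have hae := ae_lt_top (Measurable.tsum hFm) hsum
  filter_upwards [hae] with x hx
  have hs := ENNReal.summable_toReal hx.ne
  have hs' : Summable (fun k : ℤ => (|(k:ℝ)| ^ (-(3/2) : ℝ) * ‖k • x‖⁻¹) ^ (4/5 : ℝ)) := by
    refine hs.congr (fun k => ?_)
    simp only [hF]
    rw [ENNReal.toReal_ofReal (by positivity)]
  refine Summable.of_norm_bounded_eventually hs' ?_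
  have hev := hs'.tendsto_cofinite_zero.eventually (gt_mem_nhds (one_pos))
  filter_upwards [hev] with k hk
  set A := |(k:ℝ)| ^ (-(3/2) : ℝ) * ‖k • x‖⁻¹ with hA
  have hA0 : 0 ≤ A := by positivity
  rw [Real.norm_of_nonneg hA0]
  have hA1 : A < 1 := by
    by_contra hcon
    exact absurd hk (not_lt.2 (Real.one_le_rpow (not_lt.1 hcon) (by norm_num)))
  rcases hA0.eq_or_lt with h | h
  · rw [← h]; positivity
  · calc A = A ^ (1:ℝ) := (Real.rpow_one A).symm
      _ ≤ A ^ (4/5:ℝ) := Real.rpow_le_rpow_of_exponent_ge h hA1.le (by norm_num)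

lemma fourier_sub_one_lower (k : ℤ) (x : UnitAddCircle) : 4 * ‖k • x‖ ≤ ‖fourier k x - 1‖ := by
  have h1 : ∀ y : UnitAddCircle, 4 * ‖y‖ ≤ ‖((AddCircle.toCircle y : Circle) : ℂ) - 1‖ := by
    intro y
    obtain ⟨t, ht, rfl⟩ : ∃ t ∈ Ioc (-(1/2) : ℝ) (-(1/2) + 1), (t : UnitAddCircle) = y := by
      have := AddCircle.coe_image_Ioc_eq (1:ℝ) (-(1/2))
      have hy : y ∈ (univ : Set UnitAddCircle) := mem_univ y
      rw [← this] at hy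
      exact hy
    have ht' : |t| ≤ 1/2 := by rw [abs_le]; exact ⟨by linarith [ht.1], by linarith [ht.2]⟩
    have : ‖(t : UnitAddCircle)‖ = |t| := by
      rw [AddCircle.norm_coe_eq_abs_iff _ one_ne_zero, abs_one]; exact ht'
    rw [this, AddCircle.toCircle_apply_mk, Circle.coe_exp]
    rw [mul_comm _ Complex.I, Complex.norm_exp_I_mul_ofReal_sub_one]
    have h3 := Real.mul_abs_le_abs_sin (x := Real.pi * t) (by
      rw [abs_mul, abs_of_pos Real.pi_pos]; nlinarith [Real.pi_pos])
    rw [abs_mul, abs_of_pos Real.pi_pos] at h3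
    rw [show 2 * Real.pi / 1 * t / 2 = Real.pi * t by ring, norm_mul]
    simp only [Real.norm_eq_abs, abs_two]
    have h4 : 2 / Real.pi * (Real.pi * |t|) = 2 * |t| := by field_simp
    linarith
  exact h1 (k • x)

lemma ae_summable : ∀ᵐ α : ℝ, Irrational α ∧
    Summable (fun k : ℤ => |(k:ℝ)| ^ (-(3/2) : ℝ) * ‖fourier k (α : UnitAddCircle) - 1‖⁻¹) := by
  have hirr : ∀ᵐ α : ℝ, Irrational α := by
    have : (range ((↑) : ℚ → ℝ)).Countable := countable_range _
    have h0 := this.measure_zero volume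
    exact compl_mem_ae_iff.2 h0
  have hc : ∀ᵐ α : ℝ, Summable (fun k : ℤ => |(k:ℝ)| ^ (-(3/2) : ℝ) * ‖k • (α : UnitAddCircle)‖⁻¹) := by
    rw [← Measure.restrict_univ (μ := (volume : Measure ℝ)), ← iUnion_Ioc_intCast ℝ,
      ae_restrict_iUnion_iff]
    intro n
    exact (UnitAddCircle.measurePreserving_mk (n : ℝ)).quasiMeasurePreserving.ae ae_summable_circle
  filter_upwards [hirr, hc] with α h1 h2
  refine ⟨h1, Summable.of_nonneg_of_le (fun k => by positivity) (fun k => ?_) h2⟩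
  by_cases hk : k = 0
  · subst hk; norm_num
  have hne : k • (α : UnitAddCircle) ≠ 0 := by
    intro h0
    have : ((k * α : ℝ) : UnitAddCircle) = 0 := by
      rw [← h0]; simp
    rw [AddCircle.coe_eq_zero_iff] at this
    obtain ⟨n, hn⟩ := this
    have h3 : Irrational (k * α) := h1.intCast_mul hk
    exact h3 ⟨n, by simpa using hn⟩
  have hpos : 0 < ‖k • (α : UnitAddCircle)‖ := norm_pos_iff.2 hne
  gcongr
  have := fourier_sub_one_lower k α
  linarith


lemma birkhoff_bound (f : ℝ → ℝ) (hf : Continuous f) (hsupp : HasCompactSupport f) (C : ℝ)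
    (hdec : ∀ k : ℤ, k ≠ 0 → ‖𝓕 (fun y => (f y : ℂ)) (k : ℝ)‖ ≤ C * |(k:ℝ)| ^ (-(3/2) : ℝ))
    (α : ℝ) (hα : Irrational α)
    (hs : Summable (fun k : ℤ => |(k:ℝ)| ^ (-(3/2) : ℝ) * ‖fourier k (α : UnitAddCircle) - 1‖⁻¹)) :
    ∃ M : ℝ, ∀ (y : ℝ) (N : ℕ),
      |∑ n ∈ Finset.range N, ∑' m : ℤ, f (y + n * α + m) - N * ∫ t, f t| ≤ M := by
  set c : ℤ → ℂ := fun k => 𝓕 (fun y => (f y : ℂ)) (k : ℝ) with hc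
  set d : ℤ → ℝ := fun k => |(k:ℝ)| ^ (-(3/2) : ℝ) with hd
  have hds : Summable d := Real.summable_abs_int_rpow (by norm_num)
  have hcs : Summable c := by
    refine Summable.of_norm_bounded_eventually (hds.mul_left C) ?_
    filter_upwards [(finite_singleton (0:ℤ)).compl_mem_cofinite] with k hk
    exact hdec k hk
  have hpoisson : ∀ x : ℝ, ((∑' m : ℤ, f (x + m) : ℝ) : ℂ) =
      ∑' k : ℤ, c k * fourier k (x : UnitAddCircle) := by
    intro x
    rw [Complex.ofReal_tsum]
    refine Real.tsum_eq_tsum_fourier_of_rpow_decay_of_summable (f := fun y => (f y : ℂ))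
      (by fun_prop) (b := 2) (by norm_num) ?_ hcs x
    have hz : (fun y => (f y : ℂ)) =ᶠ[cocompact ℝ] fun _ => 0 := by
      have := hasCompactSupport_iff_eventuallyEq.1 hsupp
      rw [coclosedCompact_eq_cocompact] at this
      filter_upwards [this] with y hy
      simp [hy]
    exact hz.trans_isBigO (Asymptotics.isBigO_zero _ _)
  set M : ℝ := ∑' k : ℤ, 2 * C * (d k * ‖fourier k (α : UnitAddCircle) - 1‖⁻¹) with hM
  refine ⟨M, fun y N => ?_⟩
  set z : ℤ → ℂ := fun k => fourier k (α : UnitAddCircle) with hz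
  have hzn : ∀ k, ‖z k‖ = 1 := fun k => Circle.norm_coe _
  have hfn : ∀ (k : ℤ) (x : UnitAddCircle), ‖(fourier k x : ℂ)‖ = 1 := fun k x => Circle.norm_coe _
  have hadd : ∀ (k : ℤ) (n : ℕ), fourier k ((y + n * α : ℝ) : UnitAddCircle) =
      fourier k (y : UnitAddCircle) * z k ^ n := by
    intro k n
    simp only [hz, fourier_coe_apply]
    rw [← Complex.exp_nat_mul, ← Complex.exp_add]
    congr 1; push_cast; ring
  have hc0 : c 0 = ((∫ t, f t : ℝ) : ℂ) := by
    simp only [hc]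
    rw [Real.fourier_real_eq]
    simp only [Int.cast_zero, mul_zero, neg_zero, AddChar.map_zero_eq_one, one_smul]
    exact integral_ofReal
  have hsumk : ∀ x : ℝ, Summable (fun k => c k * fourier k (x : UnitAddCircle)) := by
    intro x
    refine Summable.of_norm_bounded hcs.norm (fun k => ?_)
    rw [norm_mul, hfn, mul_one]
  set g : ℤ → ℂ := fun k => ∑ n ∈ Finset.range N,
    c k * fourier k ((y + n * α : ℝ) : UnitAddCircle) with hg
  have hgs : Summable g := summable_sum (fun n _ => hsumk _)
  have htot : ((∑ n ∈ Finset.range N, ∑' m : ℤ, f (y + n * α + m) : ℝ) : ℂ) = ∑' k, g k := by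
    rw [Complex.ofReal_sum, Summable.tsum_finsetSum (fun n _ => hsumk _)]
    exact Finset.sum_congr rfl (fun n _ => hpoisson _)
  have hg0 : g 0 = ((N * ∫ t, f t : ℝ) : ℂ) := by
    simp [hg, hc0]
  have hg' : ∀ k, k ≠ 0 → ‖g k‖ ≤ 2 * C * (d k * ‖z k - 1‖⁻¹) := by
    intro k hk
    have hz1 : z k ≠ 1 := by
      intro h
      simp only [hz, fourier_coe_apply] at h
      rw [Complex.exp_eq_one_iff] at h
      obtain ⟨n, hn⟩ := h
      have h2 : (k : ℂ) * α = n := by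
        have hpi : (2 * Real.pi * Complex.I : ℂ) ≠ 0 := by
          simp [Real.pi_ne_zero, Complex.I_ne_zero]
        apply mul_left_cancel₀ hpi
        simp at hn
        linear_combination hn
      have h3 : (k : ℝ) * α = n := by exact_mod_cast h2
      exact (hα.intCast_mul hk) ⟨n, by simp [h3]⟩
    have e : g k = c k * (fourier k (y : UnitAddCircle) * ((z k ^ N - 1) / (z k - 1))) := by
      rw [← geom_sum_eq hz1, Finset.mul_sum, Finset.mul_sum]
      exact Finset.sum_congr rfl (fun n _ => by rw [hadd])
    rw [e, norm_mul, norm_mul, hfn, one_mul, norm_div, div_eq_mul_inv]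
    have h1 : ‖z k ^ N - 1‖ ≤ 2 := by
      refine (norm_sub_le _ _).trans ?_
      rw [norm_pow, hzn]; norm_num
    calc ‖c k‖ * (‖z k ^ N - 1‖ * ‖z k - 1‖⁻¹) ≤ (C * d k) * (2 * ‖z k - 1‖⁻¹) := by
          have := hdec k hk
          have h0 : 0 ≤ C * d k := (norm_nonneg _).trans this
          gcongr
      _ = _ := by ring
  have hgg : ∑' k, g k - g 0 = ∑' k, (if k = 0 then 0 else g k) := by
    rw [hgs.tsum_eq_add_tsum_ite 0]; ring
  have hbd : ∀ k, ‖(if k = 0 then 0 else g k)‖ ≤ 2 * C * (d k * ‖z k - 1‖⁻¹) := by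
    intro k
    split_ifs with h
    · subst h; simp [hd, Real.zero_rpow]
    · exact hg' k h
  have hfinal := tsum_of_norm_bounded (hs.mul_left (2 * C)).hasSum hbd
  rw [← hgg, ← htot, hg0, ← Complex.ofReal_sub, Complex.norm_real] at hfinal
  exact hfinal


def slice (S : Set (ℝ × ℝ)) (α y : ℝ) : Set ℝ := {t | (t, y + α * t) ∈ S}

lemma slice_convex {S : Set (ℝ × ℝ)} (hconv : Convex ℝ S) (α : ℝ) {y z p q s t : ℝ}
    (hp : p ∈ slice S α y) (hq : q ∈ slice S α z) (hs : 0 ≤ s) (ht : 0 ≤ t) (hst : s + t = 1) :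
    s * p + t * q ∈ slice S α (s * y + t * z) := by
  have := hconv (show (p, y + α * p) ∈ S from hp) (show (q, z + α * q) ∈ S from hq) hs ht hst
  have e : s • (p, y + α * p) + t • (q, z + α * q) =
      (s * p + t * q, s * y + t * z + α * (s * p + t * q)) := by
    ext
    · simp
    · simp; ring
  rw [e] at this
  exact this

lemma slice_ordConnected {S : Set (ℝ × ℝ)} (hconv : Convex ℝ S) (α y : ℝ) :
    (slice S α y).OrdConnected := by
  apply Convex.ordConnected
  intro p hp q hq s t hs ht hst
  have := slice_convex hconv α hp hq hs ht hst
  rw [← add_mul, hst, one_mul] at this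
  exact this

lemma slice_measurable {S : Set (ℝ × ℝ)} (hconv : Convex ℝ S) (α y : ℝ) :
    MeasurableSet (slice S α y) := (slice_ordConnected hconv α y).measurableSet

lemma slice_subset {S : Set (ℝ × ℝ)} (hS : S ⊆ Set.Ico (0:ℝ) 1 ×ˢ Set.Ico (0:ℝ) 1) (α y : ℝ) :
    slice S α y ⊆ Ico 0 1 := fun _ ht => (hS ht).1

lemma slice_ne_top {S : Set (ℝ × ℝ)} (hS : S ⊆ Set.Ico (0:ℝ) 1 ×ˢ Set.Ico (0:ℝ) 1) (α y : ℝ) :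
    volume (slice S α y) ≠ ⊤ :=
  ((measure_mono (slice_subset hS α y)).trans_lt (by simp)).ne

lemma exists_long (A : Set ℝ) (hA : A ⊆ Ico 0 1) (hne : A.Nonempty) (δ : ℝ) (hδ : 0 < δ) :
    ∃ p ∈ A, ∃ q ∈ A, volume.real A - δ ≤ q - p := by
  have hbb : BddBelow A := ⟨0, fun x hx => (hA hx).1⟩
  have hba : BddAbove A := ⟨1, fun x hx => (hA hx).2.le⟩
  obtain ⟨p, hp, hp'⟩ := exists_lt_of_csInf_lt hne (show sInf A < sInf A + δ / 2 by linarith)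
  obtain ⟨q, hq, hq'⟩ := exists_lt_of_lt_csSup hne (show sSup A - δ / 2 < sSup A by linarith)
  refine ⟨p, hp, q, hq, ?_⟩
  have hle : sInf A ≤ sSup A := (csInf_le hbb hp).trans (le_csSup hba hp)
  have : volume.real A ≤ sSup A - sInf A := by
    apply ENNReal.toReal_le_of_le_ofReal (by linarith)
    rw [← Real.volume_Icc]
    exact measure_mono (fun x hx => ⟨csInf_le hbb hx, le_csSup hba hx⟩)
  linarith

lemma slice_concave {S : Set (ℝ × ℝ)} (hS : S ⊆ Set.Ico (0:ℝ) 1 ×ˢ Set.Ico (0:ℝ) 1)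
    (hconv : Convex ℝ S) (α a b : ℝ) (hne : ∀ y ∈ Ioo a b, (slice S α y).Nonempty) :
    ConcaveOn ℝ (Ioo a b) (fun y => volume.real (slice S α y)) := by
  refine ⟨convex_Ioo a b, ?_⟩
  intro y hy z hz s t hs ht hst
  simp only [smul_eq_mul]
  apply le_of_forall_pos_le_add
  intro δ hδ
  obtain ⟨p₁, hp₁, q₁, hq₁, h₁⟩ := exists_long _ (slice_subset hS α y) (hne y hy) δ hδ
  obtain ⟨p₂, hp₂, q₂, hq₂, h₂⟩ := exists_long _ (slice_subset hS α z) (hne z hz) δ hδ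
  have hP := slice_convex hconv α hp₁ hp₂ hs ht hst
  have hQ := slice_convex hconv α hq₁ hq₂ hs ht hst
  have hkey : (s * q₁ + t * q₂) - (s * p₁ + t * p₂) ≤ volume.real (slice S α (s * y + t * z)) := by
    rcases le_total (s * p₁ + t * p₂) (s * q₁ + t * q₂) with h | h
    · have := measureReal_mono ((slice_ordConnected hconv α (s * y + t * z)).out hP hQ)
        (slice_ne_top hS α _)
      rwa [Real.volume_real_Icc_of_le h] at this
    · have : 0 ≤ volume.real (slice S α (s * y + t * z)) := measureReal_nonneg
      linarith
  have e1 := mul_le_mul_of_nonneg_left h₁ hs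
  have e2 := mul_le_mul_of_nonneg_left h₂ ht
  have e3 : s * δ + t * δ = δ := by rw [← add_mul, hst, one_mul]
  nlinarith

lemma slice_nonempty {S : Set (ℝ × ℝ)} (hconv : Convex ℝ S) (α : ℝ) (p q : ℝ × ℝ)
    (hp : p ∈ closure S) (hq : q ∈ closure S) (y : ℝ)
    (hy : y ∈ Ioo (p.2 - α * p.1) (q.2 - α * q.1)) : (slice S α y).Nonempty := by
  have hw : Continuous (fun p : ℝ × ℝ => p.2 - α * p.1) := by fun_prop
  obtain ⟨p', hp'1, hp'2⟩ := mem_closure_iff.1 hp _ (isOpen_lt hw continuous_const) hy.1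
  obtain ⟨q', hq'1, hq'2⟩ := mem_closure_iff.1 hq _ (isOpen_lt continuous_const hw) hy.2
  have h1 : p'.2 - α * p'.1 < y := hp'1
  have h2 : y < q'.2 - α * q'.1 := hq'1
  set A := p'.2 - α * p'.1 with hA
  set B := q'.2 - α * q'.1 with hB
  have hBA : 0 < B - A := by linarith
  have hs1 : p'.1 ∈ slice S α A := by
    change (p'.1, A + α * p'.1) ∈ S
    rw [hA, sub_add_cancel]; exact hp'2
  have hs2 : q'.1 ∈ slice S α B := by
    change (q'.1, B + α * q'.1) ∈ S
    rw [hB, sub_add_cancel]; exact hq'2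
  have := slice_convex hconv α hs1 hs2 (s := (B - y) / (B - A)) (t := (y - A) / (B - A))
    (div_nonneg (by linarith) hBA.le) (div_nonneg (by linarith) hBA.le) (by field_simp; ring)
  rw [show (B - y) / (B - A) * A + (y - A) / (B - A) * B = y by field_simp; ring] at this
  exact ⟨_, this⟩

lemma slice_sqrt {S : Set (ℝ × ℝ)} (α C e : ℝ) (p₀ : ℝ × ℝ) (σ : ℝ) (hC : 0 ≤ C)
    (h : ∀ p ∈ closure S, (p.1 - p₀.1) ^ 2 + (p.2 - p₀.2) ^ 2 ≤
      C * (σ * (p.2 - α * p.1) - e)) (y : ℝ) :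
    volume.real (slice S α y) ≤ 2 * √C * √(σ * y - e) := by
  have hsub : slice S α y ⊆ Icc (p₀.1 - √(C * (σ * y - e))) (p₀.1 + √(C * (σ * y - e))) := by
    intro t ht
    have h1 := h _ (subset_closure ht)
    simp only at h1
    rw [show y + α * t - α * t = y by ring] at h1
    have h2 : (t - p₀.1) ^ 2 ≤ C * (σ * y - e) := by nlinarith [sq_nonneg (y + α * t - p₀.2)]
    have h3 := Real.abs_le_sqrt h2
    rw [abs_le] at h3
    exact ⟨by linarith, by linarith⟩
  rw [mul_assoc, ← Real.sqrt_mul hC]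
  apply ENNReal.toReal_le_of_le_ofReal (by positivity)
  refine (measure_mono hsub).trans ?_
  rw [Real.volume_Icc]
  apply ENNReal.ofReal_le_ofReal
  linarith

lemma cont_of_conc (f : ℝ → ℝ) (hf0 : ∀ y, 0 ≤ f y) (a b K : ℝ)
    (hfa : ∀ y, f y ≤ K * √(y - a)) (hfb : ∀ y, f y ≤ K * √(b - y))
    (hconc : ConcaveOn ℝ (Ioo a b) f) : Continuous f := by
  rw [continuous_iff_continuousAt]
  intro y
  have sq : ∀ g : ℝ → ℝ, Continuous g → (∀ x, f x ≤ g x) → g y = 0 → ContinuousAt f y := by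
    intro g hg hfg hgy
    have hfy : f y = 0 := le_antisymm (hgy ▸ hfg y) (hf0 y)
    unfold ContinuousAt
    rw [hfy]
    refine squeeze_zero hf0 hfg ?_
    have := hg.tendsto y
    rwa [hgy] at this
  rcases le_or_gt y a with h | h
  · exact sq _ (by fun_prop) hfa (by rw [Real.sqrt_eq_zero_of_nonpos (by linarith), mul_zero])
  rcases le_or_gt b y with h' | h'
  · exact sq _ (by fun_prop) hfb (by rw [Real.sqrt_eq_zero_of_nonpos (by linarith), mul_zero])
  exact (hconc.continuousOn isOpen_Ioo).continuousAt (isOpen_Ioo.mem_nhds ⟨h, h'⟩)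

lemma supp_of_conc (f : ℝ → ℝ) (hf0 : ∀ y, 0 ≤ f y) (a b K : ℝ)
    (hfa : ∀ y, f y ≤ K * √(y - a)) (hfb : ∀ y, f y ≤ K * √(b - y)) : HasCompactSupport f := by
  refine HasCompactSupport.intro (isCompact_Icc (a := a) (b := b)) ?_
  intro y hy
  rcases lt_or_ge y a with h | h
  · refine le_antisymm ((hfa y).trans ?_) (hf0 y)
    rw [Real.sqrt_eq_zero_of_nonpos (by linarith), mul_zero]
  · have : b < y := by
      by_contra hcon; exact hy ⟨h, not_lt.1 hcon⟩
    refine le_antisymm ((hfb y).trans ?_) (hf0 y)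
    rw [Real.sqrt_eq_zero_of_nonpos (by linarith), mul_zero]

lemma slice_integral {S : Set (ℝ × ℝ)} (hS : S ⊆ Set.Ico (0:ℝ) 1 ×ˢ Set.Ico (0:ℝ) 1)
    (hconv : Convex ℝ S) (α : ℝ) : ∫ y, volume.real (slice S α y) = (volume S).toReal := by
  have hnull : NullMeasurableSet S (volume : Measure (ℝ × ℝ)) := hconv.nullMeasurableSet volume
  have hfin : volume S ≠ ⊤ := by
    refine ((measure_mono hS).trans_lt ?_).ne
    rw [Measure.volume_eq_prod, Measure.prod_prod]; simp
  have hmp : MeasurePreserving (fun p : ℝ × ℝ => (p.1, p.2 + α * p.1)) volume volume := by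
    rw [Measure.volume_eq_prod]
    refine (MeasurePreserving.id volume).skew_product (g := fun t u => u + α * t) (by fun_prop) ?_
    exact Eventually.of_forall (fun t => (measurePreserving_add_right volume (α * t)).map_eq)
  set S' : Set (ℝ × ℝ) := (fun p : ℝ × ℝ => (p.1, p.2 + α * p.1)) ⁻¹' S with hS'
  have hS'n : NullMeasurableSet S' volume := hnull.preimage hmp.quasiMeasurePreserving
  have hvol : volume S' = volume S := hmp.measure_preimage hnull
  have hitg : Integrable (S'.indicator (fun _ => (1:ℝ))) (volume.prod volume) := by
    rw [← Measure.volume_eq_prod]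
    exact (integrableOn_const (hs := by rw [hvol]; exact hfin)).integrable_indicator₀ hS'n
  have h1 : ∫ p, S'.indicator (fun _ => (1:ℝ)) p ∂(volume.prod volume) = (volume S').toReal := by
    rw [← Measure.volume_eq_prod, integral_indicator₀ hS'n]; simp [Measure.real]
  rw [integral_prod_symm _ hitg] at h1
  rw [← hvol, ← h1]
  congr 1
  funext y
  have : (fun x : ℝ => S'.indicator (fun _ => (1:ℝ)) (x, y)) = (slice S α y).indicator (fun _ => 1) := by
    funext x; rfl
  rw [this, integral_indicator_const _ (slice_measurable hconv α y)]; simp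


lemma slice_birkhoff {S : Set (ℝ × ℝ)} (hS : S ⊆ Set.Ico (0:ℝ) 1 ×ˢ Set.Ico (0:ℝ) 1)
    (hconv : Convex ℝ S) (hbd : HasC2PosCurvBoundary S) (α : ℝ) (hα : Irrational α)
    (hs : Summable (fun k : ℤ => |(k:ℝ)| ^ (-(3/2) : ℝ) * ‖fourier k (α : UnitAddCircle) - 1‖⁻¹)) :
    ∃ M : ℝ, ∀ (y : ℝ) (N : ℕ),
      |∑ n ∈ Finset.range N, ∑' m : ℤ, volume.real (slice S α (y + n * α + m))
        - N * (volume S).toReal| ≤ M := by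
  obtain ⟨L, c₁, c₂, hL, hc₁, hc₂, hp₁, hp₂, hu, hk, hfr⟩ := hbd
  have hB : Bornology.IsBounded S :=
    ((Metric.isBounded_Ico (0:ℝ) 1).prod (Metric.isBounded_Ico (0:ℝ) 1)).subset hS
  obtain ⟨p₀, hp₀, C₁, hC₁, h₁⟩ := geom S hB hconv L c₁ c₂ hL hc₁ hc₂ hp₁ hp₂ hu hk hfr (-α) 1
    (by positivity)
  obtain ⟨q₀, hq₀, C₂, hC₂, h₂⟩ := geom S hB hconv L c₁ c₂ hL hc₁ hc₂ hp₁ hp₂ hu hk hfr α (-1)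
    (by positivity)
  set a := p₀.2 - α * p₀.1 with ha
  set b := q₀.2 - α * q₀.1 with hb
  set f : ℝ → ℝ := fun y => volume.real (slice S α y) with hf
  have hf0 : ∀ y, 0 ≤ f y := fun y => measureReal_nonneg
  set K := 2 * √C₁ + 2 * √C₂ with hK
  have hK0 : 0 ≤ K := by positivity
  have hfa : ∀ y, f y ≤ K * √(y - a) := by
    intro y
    have h := slice_sqrt (S := S) α C₁ a p₀ 1 hC₁ (fun p hp => (h₁ p hp).trans_eq (by rw [ha]; ring)) y
    rw [one_mul] at h
    refine h.trans (mul_le_mul_of_nonneg_right ?_ (Real.sqrt_nonneg _))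
    have := Real.sqrt_nonneg C₂
    linarith
  have hfb : ∀ y, f y ≤ K * √(b - y) := by
    intro y
    have h := slice_sqrt (S := S) α C₂ (-b) q₀ (-1) hC₂
      (fun p hp => (h₂ p hp).trans_eq (by rw [hb]; ring)) y
    rw [show -1 * y - -b = b - y by ring] at h
    refine h.trans (mul_le_mul_of_nonneg_right ?_ (Real.sqrt_nonneg _))
    have := Real.sqrt_nonneg C₁
    linarith
  have hconc : ConcaveOn ℝ (Ioo a b) f :=
    slice_concave hS hconv α a b (fun y hy => slice_nonempty hconv α p₀ q₀ hp₀ hq₀ y hy)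
  have hcont := cont_of_conc f hf0 a b K hfa hfb hconc
  have hsupp := supp_of_conc f hf0 a b K hfa hfb
  have hitg : Integrable f := hcont.integrable_of_hasCompactSupport hsupp
  have hdec := fourier_decay f hcont hf0 a b K hK0 hfa hfb hconc hitg
  obtain ⟨M, hM⟩ := birkhoff_bound f hcont hsupp (2 * K) hdec α hα hs
  refine ⟨M, fun y N => ?_⟩
  have := hM y N
  rwa [show ∫ t, f t = (volume S).toReal from slice_integral hS hconv α] at this

def orbitSet (S : Set (ℝ × ℝ)) (α y : ℝ) : Set ℝ := {t | (Int.fract t, Int.fract (y + α * t)) ∈ S}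

lemma orbit_inter {S : Set (ℝ × ℝ)} (hS : S ⊆ Set.Ico (0:ℝ) 1 ×ˢ Set.Ico (0:ℝ) 1)
    (α y : ℝ) (n : ℤ) : orbitSet S α y ∩ Ico (n:ℝ) (n + 1) =
      ⋃ m : ℤ, (fun t : ℝ => t - n) ⁻¹' slice S α (y + n * α + m) := by
  ext t
  constructor
  · rintro ⟨h1, h2⟩
    have hfl : ⌊t⌋ = n := Int.floor_eq_iff.2 h2
    refine mem_iUnion.2 ⟨-⌊y + α * t⌋, ?_⟩
    change (t - n, y + n * α + ((-⌊y + α * t⌋ : ℤ) : ℝ) + α * (t - n)) ∈ S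
    change (Int.fract t, Int.fract (y + α * t)) ∈ S at h1
    convert h1 using 2
    · rw [Int.fract, hfl]
    · rw [Int.fract]; push_cast; ring
  · intro h
    obtain ⟨m, hm⟩ := mem_iUnion.1 h
    change (t - n, y + n * α + (m : ℝ) + α * (t - n)) ∈ S at hm
    have e : y + n * α + (m : ℝ) + α * (t - n) = y + α * t + m := by ring
    rw [e] at hm
    obtain ⟨h1, h2⟩ := hS hm
    simp only [mem_Ico] at h1 h2
    have hfl : ⌊t⌋ = n := Int.floor_eq_iff.2 ⟨by linarith, by linarith⟩
    have hfl2 : ⌊y + α * t⌋ = -m := Int.floor_eq_iff.2 ⟨by push_cast; linarith, by push_cast; linarith⟩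
    refine ⟨?_, by linarith, by linarith⟩
    change (Int.fract t, Int.fract (y + α * t)) ∈ S
    convert hm using 2
    · rw [Int.fract, hfl]
    · rw [Int.fract, hfl2]; push_cast; ring

lemma orbit_piece_measurable {S : Set (ℝ × ℝ)} (hconv : Convex ℝ S) (α y : ℝ) (n : ℤ) (m : ℤ) :
    MeasurableSet ((fun t : ℝ => t - n) ⁻¹' slice S α (y + n * α + m)) :=
  (slice_measurable hconv α _).preimage (by fun_prop)

lemma orbit_measurable {S : Set (ℝ × ℝ)} (hS : S ⊆ Set.Ico (0:ℝ) 1 ×ˢ Set.Ico (0:ℝ) 1)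
    (hconv : Convex ℝ S) (α y : ℝ) : MeasurableSet (orbitSet S α y) := by
  have : orbitSet S α y = ⋃ n : ℤ, orbitSet S α y ∩ Ico (n:ℝ) (n + 1) := by
    rw [← inter_iUnion, iUnion_Ico_intCast, inter_univ]
  rw [this]
  refine MeasurableSet.iUnion fun n => ?_
  rw [orbit_inter hS]
  exact MeasurableSet.iUnion fun m => orbit_piece_measurable hconv α y n m

lemma orbit_volume {S : Set (ℝ × ℝ)} (hS : S ⊆ Set.Ico (0:ℝ) 1 ×ˢ Set.Ico (0:ℝ) 1)
    (hconv : Convex ℝ S) (α y : ℝ) (n : ℤ) : volume.real (orbitSet S α y ∩ Ico (n:ℝ) (n + 1)) =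
      ∑' m : ℤ, volume.real (slice S α (y + n * α + m)) := by
  rw [orbit_inter hS, measureReal_def, measure_iUnion]
  · rw [ENNReal.tsum_toReal_eq]
    · congr 1; funext m
      rw [(measurePreserving_sub_right volume (n:ℝ)).measure_preimage
        (slice_measurable hconv α _).nullMeasurableSet, measureReal_def]
    · intro m
      rw [(measurePreserving_sub_right volume (n:ℝ)).measure_preimage
        (slice_measurable hconv α _).nullMeasurableSet]
      exact slice_ne_top hS α _
  · intro m m' hmm
    refine Set.disjoint_left.2 fun t h1 h2 => hmm ?_
    change (t - n, y + n * α + (m : ℝ) + α * (t - n)) ∈ S at h1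
    change (t - n, y + n * α + (m' : ℝ) + α * (t - n)) ∈ S at h2
    have g1 := (hS h1).2
    have g2 := (hS h2).2
    simp only [mem_Ico] at g1 g2
    have a1 : (m:ℝ) < m' + 1 := by linarith
    have a2 : (m':ℝ) < m + 1 := by linarith
    have a1' : m < m' + 1 := by exact_mod_cast a1
    have a2' : m' < m + 1 := by exact_mod_cast a2
    omega
  · exact fun m => orbit_piece_measurable hconv α y n m

lemma orbit_intervalIntegrable {W : Set ℝ} (hW : MeasurableSet W) (a b : ℝ) :
    IntervalIntegrable (W.indicator (fun _ => (1:ℝ))) volume a b := by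
  rw [intervalIntegrable_iff]
  exact (integrableOn_const (by simp [uIoc])).indicator hW

lemma orbit_interval_bound {W : Set ℝ} (a b : ℝ) :
    |∫ t in a..b, W.indicator (fun _ => (1:ℝ)) t| ≤ |b - a| := by
  have := intervalIntegral.norm_integral_le_of_norm_le_const (a := a) (b := b) (C := 1)
    (f := W.indicator (fun _ => (1:ℝ))) (fun t _ => by
      by_cases h : t ∈ W <;> simp [h])
  simpa using this

lemma orbit_sum {S : Set (ℝ × ℝ)} (hS : S ⊆ Set.Ico (0:ℝ) 1 ×ˢ Set.Ico (0:ℝ) 1)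
    (hconv : Convex ℝ S) (α y : ℝ) (N : ℕ) :
    ∫ t in (0:ℝ)..N, (orbitSet S α y).indicator (fun _ => (1:ℝ)) t =
      ∑ n ∈ Finset.range N, ∑' m : ℤ, volume.real (slice S α (y + n * α + m)) := by
  have hW := orbit_measurable hS hconv α y
  have h := intervalIntegral.sum_integral_adjacent_intervals (μ := volume)
    (f := (orbitSet S α y).indicator (fun _ => (1:ℝ))) (a := fun n : ℕ => (n:ℝ)) (n := N)
    (fun k _ => orbit_intervalIntegrable hW _ _)
  rw [Nat.cast_zero] at h
  rw [← h]
  refine Finset.sum_congr rfl fun n _ => ?_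
  have hv := orbit_volume hS hconv α y (n : ℤ)
  simp only [Int.cast_natCast] at hv
  rw [← hv, intervalIntegral.integral_of_le (by push_cast; linarith), ← integral_Ico_eq_integral_Ioc,
    integral_indicator_const _ hW]
  simp [measureReal_def, Measure.restrict_apply hW]

lemma bounded_of_birkhoff {S : Set (ℝ × ℝ)} (hS : S ⊆ Set.Ico (0:ℝ) 1 ×ˢ Set.Ico (0:ℝ) 1)
    (hconv : Convex ℝ S) (α M : ℝ) (hM : ∀ (y : ℝ) (N : ℕ),
      |∑ n ∈ Finset.range N, ∑' m : ℤ, volume.real (slice S α (y + n * α + m))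
        - N * (volume S).toReal| ≤ M) (x₁ x₂ : ℝ) (hx : x₁ ∈ Ico (0:ℝ) 1) :
    IsBoundedRemainderSet S α x₁ x₂ := by
  set lam := (volume S).toReal with hlam
  have hl0 : 0 ≤ lam := ENNReal.toReal_nonneg
  refine ⟨M + 3 + lam, fun T hT => ?_⟩
  set y := x₂ - α * x₁ with hy
  have hW := orbit_measurable hS hconv α y
  set g : ℝ → ℝ := (orbitSet S α y).indicator (fun _ => (1:ℝ)) with hg
  have e1 : (∫ t in (0:ℝ)..T,
      Set.indicator S (fun _ => (1:ℝ)) (Int.fract (x₁ + t), Int.fract (x₂ + α * t))) =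
      ∫ t in x₁..(x₁ + T), g t := by
    have h := intervalIntegral.integral_comp_add_left (a := 0) (b := T) g x₁
    rw [add_zero] at h
    rw [← h]
    refine intervalIntegral.integral_congr fun t _ => ?_
    have : x₂ + α * t = y + α * (x₁ + t) := by rw [hy]; ring
    simp only [this]
    rfl
  have hii : ∀ a b, IntervalIntegrable g volume a b := fun a b => orbit_intervalIntegrable hW a b
  set N := ⌊T⌋₊ with hN
  have hN1 : (N:ℝ) ≤ T := Nat.floor_le hT.le
  have hN2 : T < N + 1 := Nat.lt_floor_add_one T
  have e2 : ∫ t in x₁..(x₁ + T), g t = (∫ t in x₁..0, g t) + (∫ t in (0:ℝ)..N, g t)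
      + ∫ t in (N:ℝ)..(x₁ + T), g t := by
    rw [intervalIntegral.integral_add_adjacent_intervals (hii _ _) (hii _ _),
      intervalIntegral.integral_add_adjacent_intervals (hii _ _) (hii _ _)]
  have b1 : |∫ t in x₁..0, g t| ≤ 1 := (orbit_interval_bound x₁ 0).trans (by
    rw [abs_le]; constructor <;> linarith [hx.1, hx.2])
  have b2 : |∫ t in (N:ℝ)..(x₁ + T), g t| ≤ 2 := (orbit_interval_bound _ _).trans (by
    rw [abs_le]; constructor <;> linarith [hx.1, hx.2])
  have b3 := hM y N
  rw [← orbit_sum hS hconv α y N] at b3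
  rw [rotDelta, e1, e2]
  have b4 : (T - N) * lam ≤ 1 * lam := mul_le_mul_of_nonneg_right (by linarith) hl0
  have b5 : 0 ≤ (T - N) * lam := mul_nonneg (by linarith) hl0
  rw [← hg] at b3
  rw [← hlam]
  rw [abs_le] at *
  constructor <;> nlinarith [b1.1, b1.2, b2.1, b2.2, b3.1, b3.2]

end Aux

theorem statement4 (S : Set (ℝ × ℝ))
    (hS : S ⊆ Set.Ico (0:ℝ) 1 ×ˢ Set.Ico (0:ℝ) 1)
    (hconv : Convex ℝ S) (hbd : HasC2PosCurvBoundary S) :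
    ∀ᵐ α : ℝ ∂volume, 0 < α →
      ∀ x₁ x₂ : ℝ, x₁ ∈ Set.Ico (0:ℝ) 1 → x₂ ∈ Set.Ico (0:ℝ) 1 →
        IsBoundedRemainderSet S α x₁ x₂ := by
  filter_upwards [ae_summable] with α hα _ x₁ x₂ hx₁ _
  obtain ⟨M, hM⟩ := slice_birkhoff hS hconv hbd α hα.1 hα.2
  exact bounded_of_birkhoff hS hconv α M hM x₁ x₂ hx₁
end

section
/- There exist uncountably many irrational α > 0 with the following property: there exists a triangle S ⊆ [0,1)² none of whose edges has slope α such that for every starting point x ∈ [0,1)², the set S is not a bounded remainder set for the continuous irrational rotation with slope α and starting point x. -/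
open MeasureTheory

/-- The triangle. -/
def triS : Set (ℝ × ℝ) := convexHull ℝ ({(0,0), (1/2,0), (0,1/2)} : Set (ℝ × ℝ))

theorem mem_triS (a b : ℝ) : (a, b) ∈ triS ↔ 0 ≤ a ∧ 0 ≤ b ∧ a + b ≤ 1/2 := by
  unfold triS
  rw [convexHull_insert (by simp), convexHull_pair]
  simp only [mem_convexJoin, Set.mem_singleton_iff, exists_eq_left]
  constructor
  · rintro ⟨y, ⟨s, t, hs, ht, hst, rfl⟩, ⟨s', t', hs', ht', hst', h⟩⟩
    simp only [Prod.smul_mk, Prod.mk_add_mk, smul_eq_mul, Prod.mk.injEq] at h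
    obtain ⟨h1, h2⟩ := h
    have e1 : t' * s ≥ 0 := by positivity
    have e2 : t' * t ≥ 0 := by positivity
    have e3 : t' * s + t' * t = t' := by rw [← mul_add, hst, mul_one]
    refine ⟨by nlinarith, by nlinarith, by nlinarith⟩
  · rintro ⟨ha, hb, hab⟩
    rcases eq_or_lt_of_le (add_nonneg ha hb) with h0 | h0
    · have : a = 0 := by linarith
      have : b = 0 := by linarith
      subst a; subst b
      exact ⟨(1/2, 0), left_mem_segment _ _ _, left_mem_segment _ _ _⟩
    · refine ⟨(a/(a+b)/2, b/(a+b)/2), ⟨a/(a+b), b/(a+b), by positivity, by positivity, by field_simp, ?_⟩,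
        ⟨1 - 2*(a+b), 2*(a+b), by linarith, by linarith, by ring, ?_⟩⟩
      · ext <;> simp <;> ring
      · ext <;> simp <;> field_simp

/-- Indicator of the periodised triangle. -/
noncomputable def tf (a b : ℝ) : ℝ := if Int.fract a + Int.fract b ≤ 1/2 then 1 else 0

theorem tf_eq (a b : ℝ) :
    Set.indicator triS (fun _ => (1:ℝ)) (Int.fract a, Int.fract b) = tf a b := by
  classical
  rw [Set.indicator_apply]
  simp [mem_triS, tf, Int.fract_nonneg]

theorem tf_meas {f g : ℝ → ℝ} (hf : Measurable f) (hg : Measurable g) :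
    Measurable (fun t => tf (f t) (g t)) := by
  unfold tf
  refine Measurable.ite ?_ measurable_const measurable_const
  exact measurableSet_le (hf.fract.add hg.fract) measurable_const

theorem tf_bdd (a b : ℝ) : ‖tf a b‖ ≤ 1 := by
  unfold tf; split_ifs <;> simp

theorem tf_int {f g : ℝ → ℝ} (hf : Measurable f) (hg : Measurable g) (a b : ℝ) :
    IntervalIntegrable (fun t => tf (f t) (g t)) volume a b := by
  refine (intervalIntegrable_const (c := (1:ℝ))).mono_fun (tf_meas hf hg).aestronglyMeasurable ?_
  filter_upwards with t
  simpa using tf_bdd (f t) (g t)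

theorem fract_int {f : ℝ → ℝ} (hf : Measurable f) (a b : ℝ) :
    IntervalIntegrable (fun t => Int.fract (f t)) volume a b := by
  refine (intervalIntegrable_const (c := (1:ℝ))).mono_fun hf.fract.aestronglyMeasurable ?_
  filter_upwards with t
  rw [Real.norm_of_nonneg (Int.fract_nonneg _), norm_one]
  exact (Int.fract_lt_one (f t)).le

theorem tf_add_int (a b : ℝ) (m n : ℤ) : tf (a + m) (b + n) = tf a b := by
  simp [tf]

theorem tf_cont {a b : ℝ} (ha : ∀ n : ℤ, a ≠ n) (hb : ∀ n : ℤ, b ≠ n)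
    (hab : ∀ n : ℤ, a + b ≠ 1/2 + n) : ContinuousAt (fun z : ℝ × ℝ => tf z.1 z.2) (a, b) := by
  have h1 : ContinuousAt (fun z : ℝ × ℝ => Int.fract z.1 + Int.fract z.2) (a, b) := by
    have c1 : ContinuousAt (Int.fract : ℝ → ℝ) a := continuousAt_fract (fun h => ha _ h)
    have c2 : ContinuousAt (Int.fract : ℝ → ℝ) b := continuousAt_fract (fun h => hb _ h)
    exact (ContinuousAt.comp (x := (a, b)) (f := Prod.fst) c1 continuousAt_fst).add
      (ContinuousAt.comp (x := (a, b)) (f := Prod.snd) c2 continuousAt_snd)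
  have hne : Int.fract a + Int.fract b ≠ 1/2 := by
    intro h
    apply hab (⌊a⌋ + ⌊b⌋)
    have := Int.floor_add_fract a
    have := Int.floor_add_fract b
    push_cast; linarith
  rcases lt_or_gt_of_ne hne with h | h
  · have : (fun z : ℝ × ℝ => tf z.1 z.2) =ᶠ[nhds (a, b)] fun _ => 1 := by
      filter_upwards [h1.eventually (gt_mem_nhds h)] with z hz
      simp only [tf]; rw [if_pos hz.le]
    exact this.continuousAt
  · have : (fun z : ℝ × ℝ => tf z.1 z.2) =ᶠ[nhds (a, b)] fun _ => 0 := by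
      filter_upwards [h1.eventually (lt_mem_nhds h)] with z hz
      simp only [tf]; rw [if_neg (not_le.mpr hz)]
    exact this.continuousAt

/-- one closed period -/
noncomputable def FF (q : ℕ) (β y : ℝ) : ℝ := ∫ t in (0:ℝ)..q, tf t (y + β * t)

theorem FF_cont (q : ℕ) (β y : ℝ) (h0 : β ≠ 0) (h1 : 1 + β ≠ 0) :
    ContinuousAt (fun z : ℝ × ℝ => FF q z.1 z.2) (β, y) := by
  unfold FF
  refine intervalIntegral.continuousAt_of_dominated_interval (bound := fun _ => 1) ?_ ?_ ?_ ?_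
  · filter_upwards with z
    exact (tf_meas measurable_id (by fun_prop)).aestronglyMeasurable
  · filter_upwards with z
    filter_upwards with t _
    exact tf_bdd _ _
  · exact intervalIntegrable_const
  · have hc : (⋃ n : ℤ, ({(n:ℝ), (n - y)/β, (1/2 + n - y)/(1+β)} : Set ℝ)).Countable :=
      Set.countable_iUnion fun n => Set.Finite.countable (by simp)
    have := hc.ae_notMem volume
    filter_upwards [this] with t ht _
    simp only [Set.mem_iUnion, Set.mem_insert_iff, Set.mem_singleton_iff, not_exists, not_or] at ht
    have c := tf_cont (a := t) (b := y + β * t) (fun n => (ht n).1)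
      (fun n h => (ht n).2.1 (by field_simp; linarith))
      (fun n h => (ht n).2.2 (by field_simp; linarith))
    have c2 : ContinuousAt (fun z : ℝ × ℝ => (t, z.2 + z.1 * t)) (β, y) := by fun_prop
    exact ContinuousAt.comp (g := fun z : ℝ × ℝ => tf z.1 z.2)
      (f := fun z : ℝ × ℝ => (t, z.2 + z.1 * t)) c c2

theorem ind_eq (s z : ℝ) (h0 : 0 ≤ s) (h1 : s < 1) :
    (if Int.fract z ≤ s then (1:ℝ) else 0) = 1 + s - Int.fract z - Int.fract (s - z) := by
  have hz := Int.floor_add_fract z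
  have e : Int.fract (s - z) = Int.fract (s - Int.fract z) := by
    rw [Int.fract_eq_fract]
    refine ⟨-⌊z⌋, ?_⟩
    push_cast; linarith
  have p0 := Int.fract_nonneg z
  have p1 := Int.fract_lt_one z
  rw [e]
  split_ifs with h
  · rw [Int.fract_eq_self (a := s - Int.fract z) |>.mpr ⟨by linarith, by linarith⟩]; ring
  · have : Int.fract (s - Int.fract z) = s - Int.fract z + 1 := by
      rw [Int.fract_eq_iff]
      refine ⟨by linarith, by linarith, -1, by push_cast; ring⟩
    rw [this]; ring

theorem sum_mod (q : ℕ) (hq : 0 < q) (p n : ℤ) (hpq : IsCoprime p (q:ℤ)) :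
    ∑ j ∈ Finset.range q, (n + p * j) % (q:ℤ) = ∑ j ∈ Finset.range q, (j:ℤ) := by
  have hq' : (0:ℤ) < q := by exact_mod_cast hq
  have maps : Set.MapsTo (fun j : ℕ => ((n + p * j) % (q:ℤ)).toNat) (Finset.range q) (Finset.range q) := by
    intro j _
    have := Int.emod_lt_of_pos (n + p * j) hq'
    have := Int.emod_nonneg (n + p * j) hq'.ne'
    simp; omega
  have inj : Set.InjOn (fun j : ℕ => ((n + p * j) % (q:ℤ)).toNat) (Finset.range q) := by
    intro i hi j hj h
    simp only [Finset.coe_range, Set.mem_Iio] at hi hj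
    have a1 := Int.emod_nonneg (n + p * j) hq'.ne'
    have a2 := Int.emod_nonneg (n + p * i) hq'.ne'
    have h' : (n + p * i) % (q:ℤ) = (n + p * j) % (q:ℤ) := by
      simp only at h; omega
    have d : (q:ℤ) ∣ p * ((i:ℤ) - j) := by
      have := Int.ModEq.dvd (show Int.ModEq q (n + p * j) (n + p * i) from h'.symm)
      convert this using 1; ring
    have d2 := hpq.symm.dvd_of_dvd_mul_left d
    have := Int.eq_zero_of_abs_lt_dvd d2 (by rw [abs_lt]; omega)
    omega
  have := Finset.sum_nbij (s := Finset.range q) (t := Finset.range q)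
    (f := fun j : ℕ => (n + p * j) % (q:ℤ)) (g := fun j : ℕ => (j:ℤ)) _ maps inj
    (Finset.surjOn_of_injOn_of_card_le _ maps inj le_rfl) (by
      intro j _
      have := Int.emod_nonneg (n + p * j) hq'.ne'
      omega)
  exact this

/-- the constant -/
noncomputable def CC (q : ℕ) : ℝ := (∑ j ∈ Finset.range q, (j:ℝ)) / q

theorem sum_fract (q : ℕ) (hq : 0 < q) (p : ℤ) (hpq : IsCoprime p (q:ℤ)) (z : ℝ) :
    ∑ j ∈ Finset.range q, Int.fract (z + p * j / q) = Int.fract (q * z) + CC q := by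
  have hq' : (0:ℤ) < q := by exact_mod_cast hq
  have hqr : (0:ℝ) < q := by exact_mod_cast hq
  have key : ∀ j ∈ Finset.range q, Int.fract (z + p * j / q) =
      Int.fract (q * z) / q + (((⌊q * z⌋ + p * j) % (q:ℤ) : ℤ) : ℝ) / q := by
    intro j _
    set n := ⌊q * z⌋ with hn
    have f0 := Int.fract_nonneg (q * z)
    have f1 := Int.fract_lt_one (q * z)
    have hz := Int.floor_add_fract (q * z)
    have m0 := Int.emod_nonneg (n + p * j) hq'.ne'
    have m1 := Int.emod_lt_of_pos (n + p * j) hq'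
    have m2 : (((n + p * j) % (q:ℤ) : ℤ) : ℝ) + 1 ≤ q := by exact_mod_cast m1
    have m3 : (0:ℝ) ≤ (((n + p * j) % (q:ℤ) : ℤ) : ℝ) := by exact_mod_cast m0
    have m4 : ((q:ℝ) * (((n + p * j) / (q:ℤ) : ℤ) : ℝ)) + (((n + p * j) % (q:ℤ) : ℤ) : ℝ) = n + p * j := by
      exact_mod_cast Int.mul_ediv_add_emod (n + p * j) q
    rw [Int.fract_eq_iff]
    refine ⟨by positivity, ?_, (n + p * j) / (q:ℤ), ?_⟩
    · rw [← add_div, div_lt_one hqr]; linarith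
    · have : z = (n + Int.fract (q * z)) / q := by rw [hn, hz]; field_simp
      field_simp
      rw [mul_comm z (q:ℝ)]
      linarith
  rw [Finset.sum_congr rfl key, Finset.sum_add_distrib]
  congr 1
  · simp; field_simp
  · rw [← Finset.sum_div, CC]
    congr 1
    have := sum_mod q hq p ⌊q * z⌋ hpq
    have h2 := congrArg (Int.cast : ℤ → ℝ) this
    push_cast at h2 ⊢
    exact h2

theorem FF_formula (q : ℕ) (hq : 0 < q) (p : ℤ) (hpq : IsCoprime p (q:ℤ)) (y : ℝ) :
    FF q (p/q) y = (∫ t in (0:ℝ)..(1/2), (q * (1 + (1/2 - t)) - 2 * CC q))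
      - (∫ t in (0:ℝ)..(1/2), Int.fract (q * y + p * t))
      - (∫ t in (0:ℝ)..(1/2), Int.fract ((q / 2 - q * y) - (p + q) * t)) := by
  have hqr : (0:ℝ) < q := by exact_mod_cast hq
  have s1 : FF q (p/q) y = ∑ j ∈ Finset.range q, ∫ t in (0:ℝ)..1, tf t (y + p / q * (t + j)) := by
    unfold FF
    have := intervalIntegral.sum_integral_adjacent_intervals (a := fun k : ℕ => (k:ℝ)) (n := q)
      (f := fun t => tf t (y + p / q * t)) (μ := volume)
      (fun k _ => tf_int measurable_id (by fun_prop) _ _)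
    simp only [Nat.cast_zero] at this
    rw [← this]
    refine Finset.sum_congr rfl fun j _ => ?_
    have h := intervalIntegral.integral_comp_add_right (a := 0) (b := 1)
      (fun t => tf t (y + p / q * t)) (j:ℝ)
    rw [zero_add, add_comm (1:ℝ)] at h
    push_cast
    rw [← h]
    refine intervalIntegral.integral_congr fun t _ => ?_
    have := tf_add_int t (y + p / q * (t + j)) j 0
    simpa using this
  have J : ∀ (j : ℕ) (a b : ℝ), IntervalIntegrable (fun t => tf t (y + p / q * (t + j))) volume a b :=
    fun j a b => tf_int measurable_id (by fun_prop) a b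
  have s2 : ∀ j : ℕ, ∫ t in (0:ℝ)..1, tf t (y + p / q * (t + j)) =
      ∫ t in (0:ℝ)..(1/2), tf t (y + p / q * (t + j)) := by
    intro j
    rw [← intervalIntegral.integral_add_adjacent_intervals (b := 1/2)
      (J j 0 (1/2)) (J j (1/2) 1)]
    have : ∫ t in (1/2:ℝ)..1, tf t (y + p / q * (t + j)) = ∫ t in (1/2:ℝ)..1, (0:ℝ) := by
      refine intervalIntegral.integral_congr_ae ?_
      filter_upwards [(Set.countable_singleton (1:ℝ)).ae_notMem volume] with t ht hm
      rw [Set.uIoc_of_le (by norm_num)] at hm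
      have h1 : t < 1 := lt_of_le_of_ne hm.2 ht
      have h2 : Int.fract t = t := Int.fract_eq_self.mpr ⟨by linarith [hm.1], h1⟩
      have h3 := Int.fract_nonneg (y + p / q * (t + j))
      rw [tf, if_neg]
      rw [h2]; linarith [hm.1]
    rw [this]; simp
  rw [s1, Finset.sum_congr rfl fun j _ => s2 j, ← intervalIntegral.integral_finsetSum
    (fun j _ => J j _ _), ← intervalIntegral.integral_sub
    (by apply Continuous.intervalIntegrable; fun_prop) (fract_int (by fun_prop) _ _),
    ← intervalIntegral.integral_sub (by
      apply IntervalIntegrable.sub _ (fract_int (by fun_prop) _ _)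
      apply Continuous.intervalIntegrable; fun_prop) (fract_int (by fun_prop) _ _)]
  refine intervalIntegral.integral_congr fun t ht => ?_
  rw [Set.uIcc_of_le (by norm_num)] at ht
  have h2 : Int.fract t = t := Int.fract_eq_self.mpr ⟨ht.1, by linarith [ht.2]⟩
  have key : ∀ j ∈ Finset.range q, tf t (y + p / q * (t + j)) =
      1 + (1/2 - t) - Int.fract ((y + p * t / q) + p * j / q)
        - Int.fract ((1/2 - t - y - p * t / q) + ((-p : ℤ) : ℝ) * j / q) := by
    intro j _
    have := ind_eq (1/2 - t) (y + p / q * (t + j)) (by linarith [ht.2]) (by linarith [ht.1])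
    rw [tf, h2]
    have e : (t + Int.fract (y + p / q * (t + j)) ≤ 1/2) ↔
      (Int.fract (y + p / q * (t + j)) ≤ 1/2 - t) := by constructor <;> intro <;> linarith
    simp only [e]
    rw [this]
    congr 2
    · congr 1; ring
    · push_cast; ring
  rw [Finset.sum_congr rfl key, Finset.sum_sub_distrib, Finset.sum_sub_distrib,
    sum_fract q hq p hpq, sum_fract q hq (-p) hpq.neg_left]
  simp only [Finset.sum_const, Finset.card_range, nsmul_eq_mul]
  have e1 : (q:ℝ) * (y + p * t / q) = q * y + p * t := by field_simp
  have e2 : (q:ℝ) * (1/2 - t - y - p * t / q) = (q / 2 - q * y) - (p + q) * t := by field_simp; ring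
  rw [e1, e2]; ring

theorem fract_per (n : ℤ) : Function.Periodic (Int.fract : ℝ → ℝ) (n:ℝ) := by
  intro x; simp

theorem FF_ne (q : ℕ) (r k : ℤ) (hk : (q:ℤ) = 2 * k + 1) (hr : r ≠ 0) (hq : 0 < q)
    (hpq : IsCoprime (2 * r) (q:ℤ)) :
    FF q ((2 * r : ℤ) / q) 0 ≠ FF q ((2 * r : ℤ) / q) (1 / (2 * q)) := by
  have hqr : (0:ℝ) < q := by exact_mod_cast hq
  have hkr : (q:ℝ) = 2 * k + 1 := by exact_mod_cast hk
  have hrr : (r:ℝ) ≠ 0 := by exact_mod_cast hr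
  have hpqr : ((2 * r : ℤ) : ℝ) + q ≠ 0 := by
    have : (2 * r : ℤ) + (q:ℤ) ≠ 0 := by omega
    exact_mod_cast this
  rw [FF_formula q hq _ hpq, FF_formula q hq _ hpq]
  have ew : (q:ℝ) * (1 / (2 * q)) = 1/2 := by field_simp
  rw [ew, mul_zero]
  have p2 : ((2 * r : ℤ) : ℝ) ≠ 0 := by push_cast; simpa using hrr
  have W : (∫ t in (0:ℝ)..(1/2), Int.fract (0 + ((2 * r : ℤ) : ℝ) * t)) =
      ∫ t in (0:ℝ)..(1/2), Int.fract (1/2 + ((2 * r : ℤ) : ℝ) * t) := by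
    rw [intervalIntegral.integral_comp_add_mul (f := Int.fract) p2,
      intervalIntegral.integral_comp_add_mul (f := Int.fract) p2]
    congr 1
    have := (fract_per r).intervalIntegral_add_eq 0 (1/2)
    push_cast
    convert this using 2 <;> ring
  have I : ∀ a b : ℝ, IntervalIntegrable (Int.fract : ℝ → ℝ) volume a b :=
    fun a b => fract_int measurable_id a b
  rw [W]
  intro h
  have h' : (∫ t in (0:ℝ)..(1/2), Int.fract ((q / 2 - 0) - (((2 * r : ℤ) : ℝ) + q) * t)) =
    (∫ t in (0:ℝ)..(1/2), Int.fract (((q:ℝ) / 2 - 1/2) - (((2 * r : ℤ) : ℝ) + q) * t)) := by linarith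
  rw [intervalIntegral.integral_comp_sub_mul (f := Int.fract) hpqr,
      intervalIntegral.integral_comp_sub_mul (f := Int.fract) hpqr] at h'
  have h'' := smul_right_injective ℝ (inv_ne_zero hpqr) h'
  have a1 : (q:ℝ)/2 - 0 - (((2 * r : ℤ) : ℝ) + q) * (1/2) = -r := by push_cast; ring
  have a2 : (q:ℝ)/2 - 1/2 - (((2 * r : ℤ) : ℝ) + q) * (1/2) = -r - 1/2 := by push_cast; ring
  have a3 : (q:ℝ)/2 - 0 - (((2 * r : ℤ) : ℝ) + q) * 0 = k + 1/2 := by rw [hkr]; ring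
  have a4 : (q:ℝ)/2 - 1/2 - (((2 * r : ℤ) : ℝ) + q) * 0 = k := by rw [hkr]; ring
  rw [a1, a2, a3, a4] at h''
  have b1 := intervalIntegral.integral_add_adjacent_intervals (I (-r) k) (I k (k + 1/2))
  have b2 := intervalIntegral.integral_add_adjacent_intervals (I (-r - 1/2) (-r)) (I (-r) k)
  have b3 : ∫ t in (k:ℝ)..(k + 1/2), Int.fract t = ∫ t in (0:ℝ)..(1/2), t := by
    have := intervalIntegral.integral_comp_add_right (a := 0) (b := 1/2)
      (Int.fract : ℝ → ℝ) (k:ℝ)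
    rw [zero_add, add_comm (1/2:ℝ)] at this
    rw [← this]
    refine intervalIntegral.integral_congr fun t ht => ?_
    rw [Set.uIcc_of_le (by norm_num)] at ht
    simp only [Int.fract_add_intCast]
    exact Int.fract_eq_self.mpr ⟨ht.1, by linarith [ht.2]⟩
  have b4 : ∫ t in (-r - 1/2:ℝ)..(-r), Int.fract t = ∫ t in (0:ℝ)..(1/2), (t + 1/2) := by
    have := intervalIntegral.integral_comp_add_right (a := 0) (b := 1/2)
      (Int.fract : ℝ → ℝ) (-r - 1/2 :ℝ)
    have e1 : (1/2:ℝ) + (-r - 1/2) = -r := by ring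
    rw [zero_add, e1] at this
    rw [← this]
    refine intervalIntegral.integral_congr_ae ?_
    filter_upwards [(Set.countable_singleton (1/2:ℝ)).ae_notMem volume] with t ht hm
    rw [Set.uIoc_of_le (by norm_num)] at hm
    have h1 : t < 1/2 := lt_of_le_of_ne hm.2 ht
    rw [Int.fract_eq_iff]
    exact ⟨by linarith [hm.1], by linarith, -r - 1, by push_cast; ring⟩
  have c3 : ∫ t in (0:ℝ)..(1/2), t = 1/8 := by rw [integral_id]; norm_num
  have c4 : ∫ t in (0:ℝ)..(1/2), (t + 1/2) = (3/8:ℝ) := by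
    rw [intervalIntegral.integral_add (by simp) (by simp), integral_id]; norm_num
  rw [c3] at b3
  rw [c4] at b4
  linarith

theorem delta_eq (α x₁ x₂ T : ℝ) : rotDelta triS α x₁ x₂ T =
    (∫ t in (0:ℝ)..T, tf (x₁ + t) (x₂ + α * t)) - T * (volume triS).toReal := by
  simp only [rotDelta, tf_eq]

theorem delta_step (q : ℕ) (p : ℤ) (α x₁ x₂ T : ℝ) (n m : ℤ) (hT : x₁ + T = n) (N : ℕ) :
    rotDelta triS α x₁ x₂ (T + N * q) - rotDelta triS α x₁ x₂ T =
      ∑ i ∈ Finset.range N, (FF q α (x₂ + α * T - m + i * (α * q - p)) - q * (volume triS).toReal) := by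
  induction N with
  | zero => simp
  | succ N ih =>
    rw [Finset.sum_range_succ, ← ih, delta_eq, delta_eq, delta_eq]
    have I : ∀ a b : ℝ, IntervalIntegrable (fun t => tf (x₁ + t) (x₂ + α * t)) volume a b :=
      fun a b => tf_int (by fun_prop) (by fun_prop) a b
    rw [← intervalIntegral.integral_add_adjacent_intervals (I 0 (T + N * q))
      (I (T + N * q) (T + (N + 1 : ℕ) * q))]
    have : ∫ t in (T + N * q)..(T + (N + 1 : ℕ) * q), tf (x₁ + t) (x₂ + α * t) =
        FF q α (x₂ + α * T - m + N * (α * q - p)) := by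
      have h := intervalIntegral.integral_comp_add_right (a := 0) (b := q)
        (fun t => tf (x₁ + t) (x₂ + α * t)) (T + N * q)
      have e1 : (q:ℝ) + (T + N * q) = T + (N + 1 : ℕ) * q := by push_cast; ring
      rw [zero_add, e1] at h
      rw [← h, FF]
      refine intervalIntegral.integral_congr fun t _ => ?_
      have := tf_add_int t (x₂ + α * T - m + N * (α * q - p) + α * t) (n + N * q) (m + N * p)
      rw [← this]
      congr 1
      · push_cast; linarith
      · push_cast; ring
    rw [this]; push_cast; ring

theorem dense_orbit (α c y η : ℝ) (hα : Irrational α) (hη : 0 < η) :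
    ∃ n : ℕ, ∃ m : ℤ, |c + α * n - m - y| < η := by
  have h : DenseRange (· • (α : AddCircle (1:ℝ)) : ℤ → AddCircle (1:ℝ)) := by
    rw [AddCircle.denseRange_zsmul_coe_iff]; simpa using hα
  rw [denseRange_zsmul_iff_nsmul] at h
  obtain ⟨n, hn⟩ := h.exists_dist_lt ((y - c : ℝ) : AddCircle (1:ℝ)) hη
  have e : ((y - c : ℝ) : AddCircle (1:ℝ)) - n • (α : AddCircle (1:ℝ)) =
    ((y - c - n * α : ℝ) : AddCircle (1:ℝ)) := by
    simp
  rw [dist_eq_norm, e, AddCircle.norm_eq] at hn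
  refine ⟨n, -round (y - c - n * α), ?_⟩
  rw [abs_sub_comm] at hn
  convert hn using 2
  push_cast; simp; ring

theorem main_step (q : ℕ) (r k : ℤ) (hk : (q:ℤ) = 2 * k + 1) (hr : r ≠ 0) (hq : 0 < q)
    (hpq : IsCoprime (2 * r) (q:ℤ)) (C : ℝ) :
    ∃ ε > 0, ∀ α : ℝ, Irrational α → |α - (2 * r : ℤ) / q| < ε → ∀ x₁ x₂ : ℝ, x₁ < 1 →
      ¬ ∀ T : ℝ, 0 < T → |rotDelta triS α x₁ x₂ T| ≤ C := by
  have hqr : (0:ℝ) < q := by exact_mod_cast hq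
  set p : ℤ := 2 * r with hp
  set L := (q:ℝ) * (volume triS).toReal with hL
  obtain ⟨y, hy⟩ : ∃ y, FF q (p / q) y - L ≠ 0 := by
    by_contra! h
    have := FF_ne q r k hk hr hq hpq
    apply this
    have h1 := h 0
    have h2 := h (1 / (2 * q))
    linarith
  set d := FF q (p / q) y - L with hd
  have hd0 : 0 < |d| := abs_pos.mpr hy
  have b0 : (p:ℝ) / q ≠ 0 := by
    have : (p:ℝ) ≠ 0 := by exact_mod_cast (show p ≠ 0 by omega)
    positivity
  have b1 : 1 + (p:ℝ) / q ≠ 0 := by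
    have : (q:ℝ) + p ≠ 0 := by exact_mod_cast (show (q:ℤ) + p ≠ 0 by omega)
    intro h; apply this; field_simp at h; simpa using h
  have hc := FF_cont q (p / q) y b0 b1
  rw [Metric.continuousAt_iff] at hc
  obtain ⟨η, hη, hc⟩ := hc (|d| / 2) (by positivity)
  obtain ⟨N, hN⟩ := exists_nat_gt (2 * C / (|d| / 2))
  rw [div_lt_iff₀ (by positivity)] at hN
  refine ⟨min η (η / (2 * (N * q + 1))), by positivity, ?_⟩
  intro α hα hαε x₁ x₂ hx hbd
  have e1 : |α - p / q| < η := lt_of_lt_of_le hαε (min_le_left _ _)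
  have e2 : |α - p / q| < η / (2 * (N * q + 1)) := lt_of_lt_of_le hαε (min_le_right _ _)
  rw [lt_div_iff₀ (by positivity)] at e2
  obtain ⟨n, m, hnm⟩ := dense_orbit α (x₂ + α * (1 - x₁)) y (η / 2) hα (by positivity)
  set T : ℝ := n + 1 - x₁ with hT
  have hn0 : (0:ℝ) ≤ n := n.cast_nonneg
  have hTpos : 0 < T := by rw [hT]; linarith
  have hst := delta_step q p α x₁ x₂ T (n + 1) m (by rw [hT]; push_cast; ring) N
  have hb1 := hbd T hTpos
  have hb2 := hbd (T + N * q) (by positivity)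
  have each : ∀ i ∈ Finset.range N,
      |FF q α (x₂ + α * T - m + i * (α * q - p)) - FF q (p / q) y| < |d| / 2 := by
    intro i hi
    have hi' : (i:ℝ) ≤ N := by exact_mod_cast (Finset.mem_range.mp hi).le
    have := @hc (α, x₂ + α * T - m + i * (α * q - p)) ?_
    · rwa [Real.dist_eq] at this
    · rw [Prod.dist_eq, max_lt_iff, Real.dist_eq, Real.dist_eq]
      refine ⟨e1, ?_⟩
      have t1 : x₂ + α * T - m + i * (α * q - p) - y =
        (x₂ + α * (1 - x₁) + α * n - m - y) + i * q * (α - p / q) := by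
        rw [hT]; field_simp; ring
      have t2 : |(i:ℝ) * q * (α - p / q)| ≤ N * q * |α - p / q| := by
        rw [abs_mul, abs_of_nonneg (by positivity)]
        gcongr
      simp only
      rw [t1]
      have := abs_add_le (x₂ + α * (1 - x₁) + α * n - m - y) (i * q * (α - p / q))
      have := abs_nonneg (α - p / q)
      linarith
  have dist : |(rotDelta triS α x₁ x₂ (T + N * q) - rotDelta triS α x₁ x₂ T) - N * d| ≤ N * (|d| / 2) := by
    rw [hst]
    have : (N:ℝ) * d = ∑ i ∈ Finset.range N, d := by simp
    rw [this, ← Finset.sum_sub_distrib]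
    refine (Finset.abs_sum_le_sum_abs _ _).trans ?_
    refine (Finset.sum_le_sum (g := fun _ => |d| / 2) ?_).trans (by simp)
    intro i hi
    have := each i hi
    have e : FF q α (x₂ + α * T - m + i * (α * q - p)) - L - d =
      FF q α (x₂ + α * T - m + i * (α * q - p)) - FF q (p / q) y := by rw [hd]; ring
    rw [e]; exact this.le
  have f1 : |(N:ℝ) * d| = N * |d| := by rw [abs_mul, abs_of_nonneg (Nat.cast_nonneg _)]
  have f2 := abs_sub_abs_le_abs_sub ((N:ℝ) * d)
    (rotDelta triS α x₁ x₂ (T + N * q) - rotDelta triS α x₁ x₂ T)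
  rw [abs_sub_comm ((N:ℝ) * d)] at f2
  have f3 := abs_sub (rotDelta triS α x₁ x₂ (T + N * q)) (rotDelta triS α x₁ x₂ T)
  linarith

theorem good_step (m : ℤ) (k C : ℕ) :
    ∃ ε > 0, ∀ α : ℝ, Irrational α → |α - (2 * (3 * m + 1) : ℝ) / 3 ^ k| < ε → ∀ x₁ x₂ : ℝ, x₁ < 1 →
      ¬ ∀ T : ℝ, 0 < T → |rotDelta triS α x₁ x₂ T| ≤ C := by
  obtain ⟨j, hj⟩ : Odd ((3:ℤ)^k) := Odd.pow (by decide)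
  have := main_step (3 ^ k) (3 * m + 1) j (by push_cast; exact hj) (by omega) (by positivity) (by
    push_cast
    apply IsCoprime.pow_right
    exact ⟨-1, 2 * m + 1, by ring⟩) C
  push_cast at this
  exact this

theorem statement5 :
    ∃ A : Set ℝ, ¬ A.Countable ∧
      ∀ α ∈ A, 0 < α ∧ Irrational α ∧
        ∃ v₀ v₁ v₂ : ℝ × ℝ, ¬ Collinear ℝ ({v₀, v₁, v₂} : Set (ℝ × ℝ)) ∧
          (convexHull ℝ ({v₀, v₁, v₂} : Set (ℝ × ℝ))) ⊆
            Set.Ico (0:ℝ) 1 ×ˢ Set.Ico (0:ℝ) 1 ∧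
          -- no edge of the triangle has slope `α`
          v₁.2 - v₀.2 ≠ α * (v₁.1 - v₀.1) ∧
          v₂.2 - v₁.2 ≠ α * (v₂.1 - v₁.1) ∧
          v₀.2 - v₂.2 ≠ α * (v₀.1 - v₂.1) ∧
          ∀ x₁ x₂ : ℝ, x₁ ∈ Set.Ico (0:ℝ) 1 → x₂ ∈ Set.Ico (0:ℝ) 1 →
            ¬ IsBoundedRemainderSet (convexHull ℝ ({v₀, v₁, v₂} : Set (ℝ × ℝ)))
                α x₁ x₂ := by
  choose ε hε hgood using good_step
  let U : ℕ → Set ℝ := fun C => ⋃ (m : ℤ) (k : ℕ),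
    Metric.ball ((2 * (3 * m + 1) : ℝ) / 3 ^ k) (ε m k C)
  have hUo : ∀ C, IsOpen (U C) := fun C =>
    isOpen_iUnion fun m => isOpen_iUnion fun k => Metric.isOpen_ball
  have hUd : ∀ C, Dense (U C) := by
    intro C
    rw [Metric.dense_iff]
    intro x δ hδ
    obtain ⟨k, hk⟩ := exists_pow_lt_of_lt_one (show 0 < δ / 6 by positivity)
      (show (1/3:ℝ) < 1 by norm_num)
    have h3 : (0:ℝ) < 3 ^ k := by positivity
    set m : ℤ := ⌊(x * 3 ^ k / 2 - 1) / 3⌋ with hm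
    refine ⟨(2 * (3 * m + 1) : ℝ) / 3 ^ k, ?_, Set.mem_iUnion₂.mpr ⟨m, k, Metric.mem_ball_self (hε _ _ _)⟩⟩
    have f1 := Int.floor_le ((x * 3 ^ k / 2 - 1) / 3)
    have f2 := Int.lt_floor_add_one ((x * 3 ^ k / 2 - 1) / 3)
    rw [← hm] at f1 f2
    have h6 : 6 < δ * 3 ^ k := by
      rw [div_pow, one_pow, div_lt_iff₀ h3] at hk; linarith
    rw [Metric.mem_ball, Real.dist_eq, abs_lt]
    have e : (2 * (3 * m + 1) : ℝ) / 3 ^ k - x = (2 * (3 * m + 1) - x * 3 ^ k) / 3 ^ k := by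
      field_simp
    rw [e, lt_div_iff₀ h3, div_lt_iff₀ h3]
    constructor <;> linarith
  refine ⟨{α | 0 < α ∧ Irrational α ∧ ∀ C, α ∈ U C}, ?_, ?_⟩
  · intro hcount
    have r1 : ∀ᶠ x in residual ℝ, ∀ C, x ∈ U C :=
      eventually_countable_forall.mpr fun C => residual_of_dense_open (hUo C) (hUd C)
    have r2 : ∀ᶠ x in residual ℝ, ∀ a ∈ {α | 0 < α ∧ Irrational α ∧ ∀ C, α ∈ U C}, x ≠ a :=
      (eventually_countable_ball hcount).mpr fun a _ =>
        residual_of_dense_open isOpen_ne (dense_compl_singleton a)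
    have d := dense_of_mem_residual ((eventually_residual_irrational.and r1).and r2)
    obtain ⟨x, hx0, ⟨hx1, hx2⟩, hx3⟩ := d.inter_open_nonempty (Set.Ioi 0) isOpen_Ioi ⟨1, by simp⟩
    exact hx3 x ⟨hx0, hx1, hx2⟩ rfl
  · rintro α ⟨h0, hirr, hU⟩
    refine ⟨h0, hirr, (0,0), (1/2,0), (0,1/2), ?_, ?_, ?_, ?_, ?_, ?_⟩
    · rw [collinear_iff_of_mem (p₀ := ((0:ℝ),(0:ℝ))) (by simp)]
      rintro ⟨v, hv⟩
      obtain ⟨a, ha⟩ := hv (1/2, 0) (by simp)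
      obtain ⟨b, hb⟩ := hv (0, 1/2) (by simp)
      simp only [Prod.ext_iff, vadd_eq_add, Prod.fst_add, Prod.snd_add, Prod.smul_fst, Prod.smul_snd,
        smul_eq_mul, add_zero] at ha hb
      obtain ⟨a1, a2⟩ := ha
      obtain ⟨b1, b2⟩ := hb
      have : (1/2:ℝ) * (1/2) = 0 * 0 := by
        calc (1/2:ℝ) * (1/2) = (a * v.1) * (b * v.2) := by rw [← a1, ← b2]
          _ = (b * v.1) * (a * v.2) := by ring
          _ = 0 * 0 := by rw [← b1, ← a2]
      norm_num at this
    · rintro ⟨a, b⟩ hab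
      obtain ⟨h1, h2, h3⟩ := (mem_triS a b).mp hab
      exact ⟨⟨h1, by simp only; linarith⟩, ⟨h2, by simp only; linarith⟩⟩
    · simp; exact h0.ne'
    · simp only; intro h; linarith
    · simp
    · rintro x₁ x₂ hx₁ _ ⟨C, hC⟩
      obtain ⟨K, hK⟩ := exists_nat_ge C
      obtain ⟨m, k, hmk⟩ := Set.mem_iUnion₂.mp (hU K)
      exact hgood m k K α hirr hmk x₁ x₂ hx₁.2 fun T hT => (hC T hT).trans hK
end

section
/- There exist uncountably many irrational α > 0 with the following property: there exists a closed disc S ⊆ [0,1)² such that for every starting point x ∈ [0,1)², the set S is not a bounded remainder set for the continuous irrational rotation with slope α and starting point x. -/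
open MeasureTheory

/-- The closed Euclidean disc with center `c` and radius `r`. -/
def closedDisc (c : ℝ × ℝ) (r : ℝ) : Set (ℝ × ℝ) :=
  {y : ℝ × ℝ | (y.1 - c.1) ^ 2 + (y.2 - c.2) ^ 2 ≤ r ^ 2}

open MeasureTheory Filter Topology Set

/-- Periodized squared distance to the centre `(1/2, 1/2)`. -/
noncomputable def gq (a b : ℝ) : ℝ := (Int.fract a - 1 / 2) ^ 2 + (Int.fract b - 1 / 2) ^ 2

/-- Periodized indicator of the disc. -/
noncomputable def chi (r a b : ℝ) : ℝ := if gq a b ≤ r ^ 2 then 1 else 0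

/-- The disc considered. -/
def DD (r : ℝ) : Set (ℝ × ℝ) := closedDisc (1 / 2, 1 / 2) r

lemma rot_eq_s6 (r α x₁ x₂ T : ℝ) : rotDelta (DD r) α x₁ x₂ T =
    (∫ t in (0:ℝ)..T, chi r (x₁ + t) (x₂ + α * t)) - T * (volume (DD r)).toReal := by
  unfold rotDelta
  congr 1

lemma hq_cont : Continuous fun a : ℝ => (Int.fract a - 1 / 2) ^ 2 := by
  have : ContinuousOn (fun a : ℝ => (a - 1 / 2) ^ 2) (Icc 0 1) := by fun_prop
  exact this.comp_fract'' (by norm_num)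

lemma gq_cont : Continuous fun p : ℝ × ℝ => gq p.1 p.2 := by
  unfold gq
  exact (hq_cont.comp continuous_fst).add (hq_cont.comp continuous_snd)

lemma chi_meas (r : ℝ) : Measurable fun p : ℝ × ℝ => chi r p.1 p.2 := by
  unfold chi
  exact Measurable.ite (measurableSet_le gq_cont.measurable measurable_const)
    measurable_const measurable_const

lemma chi_bound (r a b : ℝ) : ‖chi r a b‖ ≤ 1 := by
  unfold chi; split_ifs <;> simp

lemma chi_line_meas (r α x y : ℝ) : Measurable fun t : ℝ => chi r (x + t) (y + α * t) :=
  (chi_meas r).comp (f := fun t : ℝ => (x + t, y + α * t)) (by fun_prop)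

lemma chi_int (r α x y a b : ℝ) :
    IntervalIntegrable (fun t : ℝ => chi r (x + t) (y + α * t)) volume a b := by
  refine (intervalIntegrable_const (c := (1:ℝ))).mono_fun
    (chi_line_meas r α x y).aestronglyMeasurable ?_
  exact Eventually.of_forall fun t => by simpa using chi_bound r _ _

lemma chi_contAt (r : ℝ) (p : ℝ × ℝ) (h : gq p.1 p.2 ≠ r ^ 2) :
    ContinuousAt (fun p : ℝ × ℝ => chi r p.1 p.2) p := by
  rcases lt_or_gt_of_ne h with h | h
  · have : (fun p : ℝ × ℝ => chi r p.1 p.2) =ᶠ[𝓝 p] fun _ => 1 := by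
      filter_upwards [gq_cont.continuousAt.eventually_lt continuousAt_const h] with q hq
      simp [chi, hq.le]
    exact continuousAt_const.congr this.symm
  · have : (fun p : ℝ × ℝ => chi r p.1 p.2) =ᶠ[𝓝 p] fun _ => 0 := by
      filter_upwards [continuousAt_const.eventually_lt gq_cont.continuousAt h] with q hq
      simp [chi, hq]
    exact continuousAt_const.congr this.symm

lemma quad_finite (α x y s : ℝ) : {t : ℝ | (x + t) ^ 2 + (y + α * t) ^ 2 = s}.Finite := by
  by_cases hne : ∃ t₀, (x + t₀) ^ 2 + (y + α * t₀) ^ 2 = s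
  · obtain ⟨t₀, h0⟩ := hne
    refine (Set.toFinite {t₀, -t₀ - 2 * (x + α * y) / (1 + α ^ 2)}).subset fun t ht => ?_
    have ht : (x + t) ^ 2 + (y + α * t) ^ 2 = s := ht
    have hpos : (1 + α ^ 2) ≠ 0 := by positivity
    have : (t - t₀) * ((1 + α ^ 2) * (t + t₀) + 2 * (x + α * y)) = 0 := by
      linear_combination ht - h0
    rcases mul_eq_zero.1 this with h | h
    · left; linarith
    · right
      simp only [mem_singleton_iff]
      field_simp
      linear_combination h
  · push Not at hne
    convert Set.finite_empty
    ext t; simpa using hne t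

lemma bad_countable (r α x y : ℝ) : {t : ℝ | gq (x + t) (y + α * t) = r ^ 2}.Countable := by
  refine (Set.countable_iUnion fun m : ℤ => Set.countable_iUnion fun n : ℤ =>
    (quad_finite α (x - m - 1 / 2) (y - n - 1 / 2) (r ^ 2)).countable).mono fun t ht => ?_
  simp only [mem_iUnion]
  refine ⟨⌊x + t⌋, ⌊y + α * t⌋, ?_⟩
  have ht : gq (x + t) (y + α * t) = r ^ 2 := ht
  simp only [gq, Int.fract] at ht
  show _ = _
  rw [← ht]; ring

lemma rot_cont (r T : ℝ) :
    Continuous fun p : ℝ × ℝ × ℝ => rotDelta (DD r) p.1 p.2.1 p.2.2 T := by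
  simp only [rot_eq_s6]
  refine Continuous.sub ?_ continuous_const
  rw [continuous_iff_continuousAt]
  rintro ⟨α, x, y⟩
  refine intervalIntegral.continuousAt_of_dominated_interval (bound := fun _ => 1) ?_ ?_ ?_ ?_
  · exact Eventually.of_forall fun p => (chi_line_meas r _ _ _).aestronglyMeasurable
  · exact Eventually.of_forall fun p => Eventually.of_forall fun t _ => chi_bound _ _ _
  · exact intervalIntegrable_const
  · filter_upwards [(bad_countable r α x y).ae_notMem volume] with t ht _
    have h1 : ContinuousAt (fun p : ℝ × ℝ × ℝ => (p.2.1 + t, p.2.2 + p.1 * t)) (α, x, y) := by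
      fun_prop
    exact ContinuousAt.comp (f := fun p : ℝ × ℝ × ℝ => (p.2.1 + t, p.2.2 + p.1 * t))
      (g := fun p : ℝ × ℝ => chi r p.1 p.2) (chi_contAt r _ ht) h1

lemma rot_cocycle (r α x y s T : ℝ) :
    rotDelta (DD r) α (x + s) (y + α * s) T =
      rotDelta (DD r) α x y (s + T) - rotDelta (DD r) α x y s := by
  simp only [rot_eq_s6]
  have h1 : (∫ t in (0:ℝ)..T, chi r (x + s + t) (y + α * s + α * t)) =
      ∫ t in s..(s + T), chi r (x + t) (y + α * t) := by
    have := intervalIntegral.integral_comp_add_left (a := 0) (b := T)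
      (fun t => chi r (x + t) (y + α * t)) s
    rw [add_zero] at this
    rw [← this]
    congr 1; ext t; congr 1 <;> ring
  rw [h1, ← intervalIntegral.integral_interval_sub_left (chi_int r α x y 0 (s + T))
    (chi_int r α x y 0 s)]
  ring

lemma chi_per (r a b : ℝ) (m n : ℤ) : chi r (a + m) (b + n) = chi r a b := by
  simp [chi, gq]

lemma rot_per (r α x y T : ℝ) (m n : ℤ) :
    rotDelta (DD r) α (x + m) (y + n) T = rotDelta (DD r) α x y T := by
  simp only [rot_eq_s6]
  congr 2; ext t
  rw [← chi_per r (x + t) (y + α * t) m n]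
  congr 1 <;> ring

lemma dense_fwd (α : ℝ) (hα : Irrational α) (z ε : ℝ) (hε : 0 < ε) :
    ∃ (m : ℕ) (n : ℤ), |m * α + n - z| < ε := by
  have hd : DenseRange (· • (α : AddCircle (1:ℝ)) : ℕ → AddCircle (1:ℝ)) := by
    rw [← denseRange_zsmul_iff_nsmul, AddCircle.denseRange_zsmul_coe_iff]
    simpa using hα
  have ho : IsOpen ((fun w : ℝ => (w : AddCircle (1:ℝ))) '' Metric.ball z ε) :=
    QuotientAddGroup.isOpenMap_coe _ Metric.isOpen_ball
  obtain ⟨m, w, hw, hm⟩ := hd.exists_mem_open ho ⟨_, z, Metric.mem_ball_self hε, rfl⟩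
  simp only at hm
  have h2 : (w : AddCircle (1:ℝ)) = ((m * α : ℝ) : AddCircle (1:ℝ)) := by
    rw [hm]; simp [← nsmul_eq_mul]
  have h3 : ((w - m * α : ℝ) : AddCircle (1:ℝ)) = 0 := by
    rw [AddCircle.coe_sub, h2, sub_self]
  obtain ⟨n, hn⟩ := (AddCircle.coe_eq_zero_iff _).1 h3
  refine ⟨m, n, ?_⟩
  rw [Metric.mem_ball, Real.dist_eq] at hw
  have : (n : ℝ) = w - m * α := by simpa using hn
  rw [this]
  convert hw using 2
  ring

lemma rot_bound (r α x y C : ℝ) (hα : Irrational α)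
    (h : ∀ T : ℝ, 0 < T → |rotDelta (DD r) α x y T| ≤ C) (u v T : ℝ) (hT : 0 < T) :
    |rotDelta (DD r) α u v T| ≤ 2 * C := by
  by_contra! hlt
  have hc : Continuous fun w : ℝ => |rotDelta (DD r) α u w T| :=
    ((rot_cont r T).comp (f := fun w : ℝ => (α, u, w)) (by fun_prop)).abs
  obtain ⟨ε, hε, hb⟩ := Metric.isOpen_iff.1 (isOpen_lt continuous_const hc) v hlt
  obtain ⟨k, hk⟩ := exists_nat_gt (x - u)
  obtain ⟨m, n, hmn⟩ := dense_fwd α hα (v - y - α * (u - x + k)) ε hε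
  set s : ℝ := u - x + k + m with hs
  have hspos : 0 < s := by have : (0:ℝ) ≤ m := m.cast_nonneg; linarith
  have h1 : |rotDelta (DD r) α (x + s) (y + α * s) T| ≤ 2 * C := by
    rw [rot_cocycle]
    have := abs_sub (rotDelta (DD r) α x y (s + T)) (rotDelta (DD r) α x y s)
    linarith [h (s + T) (by linarith), h s hspos]
  have h2 : (y + α * s + n) ∈ Metric.ball v ε := by
    rw [Metric.mem_ball, Real.dist_eq]
    convert hmn using 2
    rw [hs]; ring
  have h3 := hb h2
  simp only [mem_ofPred_eq] at h3
  rw [← rot_per r α u _ T ((k + m : ℕ) : ℤ) 0] at h3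
  rw [← rot_per r α _ _ T 0 n] at h1
  have e : u + (((k + m : ℕ) : ℤ) : ℝ) = x + s + ((0 : ℤ) : ℝ) := by rw [hs]; push_cast; ring
  rw [e, Int.cast_zero, add_zero, add_zero] at h3
  rw [Int.cast_zero, add_zero] at h1
  linarith

/-- Chord length. -/
noncomputable def Lc (r α v : ℝ) : ℝ := 2 * √((1 + α ^ 2) * r ^ 2 - v ^ 2) / (1 + α ^ 2)

lemma chord (r α v : ℝ) (h0 : 0 < r) (h1 : r < 1 / 2) :
    (∫ u in (0:ℝ)..1,
      (if (u - 1 / 2) ^ 2 + (v + α * (u - 1 / 2)) ^ 2 ≤ r ^ 2 then (1:ℝ) else 0)) = Lc r α v := by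
  set S : Set ℝ := {u | (u - 1 / 2) ^ 2 + (v + α * (u - 1 / 2)) ^ 2 ≤ r ^ 2} with hS
  have hSm : MeasurableSet S := by
    apply IsClosed.measurableSet
    exact isClosed_le (by fun_prop) continuous_const
  have hsub : S ⊆ Ioc 0 1 := by
    intro u hu
    have hu : (u - 1 / 2) ^ 2 + (v + α * (u - 1 / 2)) ^ 2 ≤ r ^ 2 := hu
    have : (u - 1 / 2) ^ 2 ≤ r ^ 2 := by nlinarith [sq_nonneg (v + α * (u - 1 / 2))]
    have := abs_le_of_sq_le_sq' this h0.le
    constructor <;> linarith [this.1, this.2]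
  have e1 : (fun u : ℝ => if (u - 1 / 2) ^ 2 + (v + α * (u - 1 / 2)) ^ 2 ≤ r ^ 2
      then (1:ℝ) else 0) = S.indicator (fun _ => 1) := by
    ext u; simp [hS, Set.indicator]
  rw [e1, intervalIntegral.integral_of_le zero_le_one, setIntegral_indicator hSm,
    inter_eq_self_of_subset_right hsub]
  simp only [integral_const, smul_eq_mul, mul_one, measureReal_restrict_apply_univ]
  have hA : 0 < 1 + α ^ 2 := by positivity
  have key : ∀ u : ℝ, u ∈ S ↔
      ((1 + α ^ 2) * (u - 1 / 2) + α * v) ^ 2 ≤ (1 + α ^ 2) * r ^ 2 - v ^ 2 := by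
    intro u
    have : u ∈ S ↔ (u - 1 / 2) ^ 2 + (v + α * (u - 1 / 2)) ^ 2 ≤ r ^ 2 := Iff.rfl
    rw [this, ← mul_le_mul_iff_right₀ hA]
    constructor <;> intro h <;> nlinarith
  unfold Lc
  rcases lt_or_ge ((1 + α ^ 2) * r ^ 2 - v ^ 2) 0 with hD | hD
  · have : S = ∅ := by
      ext u; rw [key]; simp only [mem_empty_iff_false, iff_false, not_le]
      exact hD.trans_le (sq_nonneg _)
    rw [this, Real.sqrt_eq_zero_of_nonpos hD.le]; simp
  · set d := √((1 + α ^ 2) * r ^ 2 - v ^ 2) with hd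
    have hd0 : 0 ≤ d := Real.sqrt_nonneg _
    have hd2 : d ^ 2 = (1 + α ^ 2) * r ^ 2 - v ^ 2 := Real.sq_sqrt hD
    have : S = Icc ((-d - α * v) / (1 + α ^ 2) + 1 / 2) ((d - α * v) / (1 + α ^ 2) + 1 / 2) := by
      ext u
      rw [key, ← hd2, sq_le_sq, abs_of_nonneg hd0, abs_le, mem_Icc,
        ← le_sub_iff_add_le (c := u), ← sub_le_iff_le_add (a := u), div_le_iff₀ hA, le_div_iff₀ hA]
      constructor <;> rintro ⟨ha, hb⟩ <;> constructor <;> linarith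
    rw [this, Real.volume_real_Icc_of_le (by gcongr; linarith)]
    ring

lemma chi_sum (r u b : ℝ) (N : ℕ) (h0 : 0 < r) (h1 : r < 1 / 2) (hu : u ∈ Ico (0:ℝ) 1)
    (hb : |b| < N) : chi r u b =
    ∑ n ∈ Finset.Icc (-(N:ℤ)) N,
      (if (u - 1 / 2) ^ 2 + (b - n - 1 / 2) ^ 2 ≤ r ^ 2 then (1:ℝ) else 0) := by
  have hb' := abs_lt.1 hb
  rw [Finset.sum_eq_single ⌊b⌋]
  · simp only [chi, gq, Int.fract_eq_self.2 hu]
    rw [Int.fract]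
  · intro n _ hn
    rw [if_neg]
    intro h
    apply hn
    have : (b - n - 1 / 2) ^ 2 ≤ r ^ 2 := by nlinarith [sq_nonneg (u - 1 / 2)]
    have := abs_le_of_sq_le_sq' this h0.le
    symm
    rw [Int.floor_eq_iff]
    constructor <;> linarith [this.1, this.2]
  · intro h
    exfalso; apply h
    rw [Finset.mem_Icc]
    constructor
    · rw [Int.le_floor]; push_cast; exact hb'.1.le
    · rw [← Int.cast_le (R := ℝ)]
      exact (Int.floor_le b).trans (by push_cast; exact hb'.2.le)

lemma f_sum (r α w : ℝ) (N : ℕ) (h0 : 0 < r) (h1 : r < 1 / 2) (hb : |w| + |α| < N) :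
    (∫ u in (0:ℝ)..1, chi r u (w + α * u)) =
      ∑ n ∈ Finset.Icc (-(N:ℤ)) N, Lc r α (w + α / 2 - n - 1 / 2) := by
  have e : (∫ u in (0:ℝ)..1, chi r u (w + α * u)) = ∫ u in (0:ℝ)..1,
      ∑ n ∈ Finset.Icc (-(N:ℤ)) N, (if (u - 1 / 2) ^ 2 +
        ((w + α / 2 - n - 1 / 2) + α * (u - 1 / 2)) ^ 2 ≤ r ^ 2 then (1:ℝ) else 0) := by
    rw [intervalIntegral.integral_of_le zero_le_one, intervalIntegral.integral_of_le zero_le_one,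
      integral_Ioc_eq_integral_Ioo, integral_Ioc_eq_integral_Ioo]
    refine setIntegral_congr_fun measurableSet_Ioo fun u hu => ?_
    rw [chi_sum r u _ N h0 h1 ⟨hu.1.le, hu.2⟩]
    · refine Finset.sum_congr rfl fun n _ => ?_
      congr 3; ring
    · have := abs_add_le w (α * u)
      rw [abs_mul, abs_of_pos hu.1] at this
      nlinarith [abs_nonneg α, hu.2, hu.1]
  rw [e, intervalIntegral.integral_finsetSum]
  · exact Finset.sum_congr rfl fun n _ => chord r α _ h0 h1
  · intro n _
    refine (intervalIntegrable_const (c := (1:ℝ))).mono_fun ?_ ?_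
    · refine (Measurable.ite ?_ measurable_const measurable_const).aestronglyMeasurable
      exact (isClosed_le (by fun_prop) continuous_const).measurableSet
    · refine Eventually.of_forall fun t => ?_
      simp only; split_ifs <;> simp

lemma int_cells (r α y : ℝ) (q : ℕ) :
    (∫ t in (0:ℝ)..q, chi r (0 + t) (y + α * t)) =
      ∑ i ∈ Finset.range q, ∫ u in (0:ℝ)..1, chi r u (y + α * i + α * u) := by
  have := intervalIntegral.sum_integral_adjacent_intervals (a := fun i : ℕ => (i:ℝ)) (n := q)
    (f := fun t => chi r (0 + t) (y + α * t)) (μ := volume) (fun k _ => chi_int r α 0 y _ _)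
  simp only [Nat.cast_zero] at this
  rw [← this]
  refine Finset.sum_congr rfl fun i _ => ?_
  have h := intervalIntegral.integral_comp_add_left (a := 0) (b := 1)
      (fun t => chi r (0 + t) (y + α * t)) (i : ℝ)
  rw [add_zero] at h
  push_cast
  rw [← h]
  congr 1; ext t
  rw [← chi_per r t _ (i : ℤ) 0]
  congr 1
  · push_cast; ring
  · push_cast; ring

lemma Lc_conc (r α v : ℝ) (hD : (1 + α ^ 2) * r ^ 2 - v ^ 2 ≠ 0) :
    ∀ᶠ ε in 𝓝[>] (0:ℝ), Lc r α (v + ε) + Lc r α (v - ε) ≤ 2 * Lc r α v ∧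
      (0 < (1 + α ^ 2) * r ^ 2 - v ^ 2 → 
        Lc r α (v + ε) + Lc r α (v - ε) < 2 * Lc r α v) := by
  have hA : 0 < 1 + α ^ 2 := by positivity
  have c1 : ContinuousAt (fun ε : ℝ => (1 + α ^ 2) * r ^ 2 - (v + ε) ^ 2) 0 := by fun_prop
  have c2 : ContinuousAt (fun ε : ℝ => (1 + α ^ 2) * r ^ 2 - (v - ε) ^ 2) 0 := by fun_prop
  rcases lt_or_gt_of_ne hD with hD | hD
  · have l1 := nhdsWithin_le_nhds (s := Ioi 0) (c1.eventually_lt (continuousAt_const (y := (0:ℝ)))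
      (by simpa using hD))
    have l2 := nhdsWithin_le_nhds (s := Ioi 0) (c2.eventually_lt (continuousAt_const (y := (0:ℝ)))
      (by simpa using hD))
    filter_upwards [l1, l2] with ε h1 h2
    refine ⟨?_, fun h => absurd h hD.not_gt⟩
    simp [Lc, Real.sqrt_eq_zero_of_nonpos h1.le, Real.sqrt_eq_zero_of_nonpos h2.le,
      Real.sqrt_eq_zero_of_nonpos hD.le]
  · have l1 := nhdsWithin_le_nhds (s := Ioi 0) ((continuousAt_const (y := (0:ℝ))).eventually_lt c1
      (by simpa using hD))
    have l2 := nhdsWithin_le_nhds (s := Ioi 0) ((continuousAt_const (y := (0:ℝ))).eventually_lt c2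
      (by simpa using hD))
    filter_upwards [l1, l2, self_mem_nhdsWithin] with ε h1 h2 h3
    have h3 : 0 < ε := h3
    have key : Lc r α (v + ε) + Lc r α (v - ε) < 2 * Lc r α v := by
      unfold Lc
      rw [← add_div, mul_div_assoc', div_lt_div_iff_of_pos_right hA]
      have s1 := Real.sq_sqrt h1.le
      have s2 := Real.sq_sqrt h2.le
      have s3 := Real.sq_sqrt hD.le
      have p3 := Real.sqrt_nonneg ((1 + α ^ 2) * r ^ 2 - v ^ 2)
      set a := √((1 + α ^ 2) * r ^ 2 - (v + ε) ^ 2)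
      set b := √((1 + α ^ 2) * r ^ 2 - (v - ε) ^ 2)
      set c := √((1 + α ^ 2) * r ^ 2 - v ^ 2)
      have : (a + b) < 2 * c := by
        apply lt_of_pow_lt_pow_left₀ 2 (by positivity)
        nlinarith [sq_nonneg (a - b), pow_pos h3 2]
      linarith
    exact ⟨key.le, fun _ => key⟩

lemma rat_ne (r : ℝ) (h0 : 0 < r) (h1 : r < 1 / 2) (hr : Irrational (r ^ 2)) (α : ℚ) (q : ℕ)
    (hq : 0 < q) : ∃ y : ℝ, rotDelta (DD r) α 0 y q ≠ 0 := by
  by_contra! hall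
  simp only [rot_eq_s6, int_cells] at hall
  set y₀ : ℝ := 1 / 2 - α / 2 with hy
  obtain ⟨N, hN⟩ := exists_nat_gt (|y₀| + 1 + |(α:ℝ)| * q + |(α:ℝ)|)
  have hF : ∀ ε : ℝ, |ε| < 1 → ∑ i ∈ Finset.range q, ∑ n ∈ Finset.Icc (-(N:ℤ)) N,
      Lc r α (α * i - n + ε) = q * (volume (DD r)).toReal := by
    intro ε hε
    rw [← sub_eq_zero, ← hall (y₀ + ε)]
    congr 1
    refine Finset.sum_congr rfl fun i hi => ?_
    rw [f_sum r α _ N h0 h1]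
    · refine Finset.sum_congr rfl fun n _ => ?_
      congr 1; rw [hy]; ring
    · have hi' : (i:ℝ) ≤ q := by exact_mod_cast (Finset.mem_range.1 hi).le
      have a1 := abs_add_le (y₀ + ε) (α * i)
      have a2 := abs_add_le y₀ ε
      rw [abs_mul, Nat.abs_cast] at a1
      have : |(α:ℝ)| * i ≤ |(α:ℝ)| * q := by gcongr
      linarith
  have hD : ∀ (i : ℕ) (n : ℤ), (1 + (α:ℝ) ^ 2) * r ^ 2 - (α * i - n) ^ 2 ≠ 0 := by
    intro i n h
    apply hr
    refine ⟨(α * i - n) ^ 2 / (1 + α ^ 2), ?_⟩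
    have : (1 + (α:ℝ) ^ 2) ≠ 0 := by positivity
    push_cast
    field_simp
    linarith
  have hev : ∀ᶠ ε in 𝓝[>] (0:ℝ), ∀ i ∈ Finset.range q, ∀ n ∈ Finset.Icc (-(N:ℤ)) N,
      (Lc r α (α * i - n + ε) + Lc r α (α * i - n - ε) ≤ 2 * Lc r α (α * i - n) ∧
      (0 < (1 + (α:ℝ) ^ 2) * r ^ 2 - (α * i - n) ^ 2 → 
        Lc r α (α * i - n + ε) + Lc r α (α * i - n - ε) < 2 * Lc r α (α * i - n))) := by
    rw [Filter.eventually_all_finset]; intro i _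
    rw [Filter.eventually_all_finset]; intro n _
    exact Lc_conc r α _ (hD i n)
  have hlt : ∀ᶠ ε in 𝓝[>] (0:ℝ), ε < 1 := nhdsWithin_le_nhds (eventually_lt_nhds one_pos)
  obtain ⟨ε, ⟨he, hl⟩, hpos⟩ := ((hev.and hlt).and self_mem_nhdsWithin).exists
  have hpos : 0 < ε := hpos
  have F0 := hF 0 (by simp)
  have F1 := hF ε (by rw [abs_of_pos hpos]; exact hl)
  have F2 := hF (-ε) (by rw [abs_neg, abs_of_pos hpos]; exact hl)
  simp only [add_zero, ← sub_eq_add_neg] at F0 F2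
  have : ∑ i ∈ Finset.range q, ∑ n ∈ Finset.Icc (-(N:ℤ)) N,
      (Lc r α (α * i - n + ε) + Lc r α (α * i - n - ε)) <
      ∑ i ∈ Finset.range q, ∑ n ∈ Finset.Icc (-(N:ℤ)) N, 2 * Lc r α (α * i - n) := by
    refine Finset.sum_lt_sum (fun i hi => Finset.sum_le_sum fun n hn => (he i hi n hn).1)
      ⟨0, Finset.mem_range.2 hq, ?_⟩
    refine Finset.sum_lt_sum (fun n hn => (he 0 (Finset.mem_range.2 hq) n hn).1)
      ⟨0, by simp, ?_⟩
    refine (he 0 (Finset.mem_range.2 hq) 0 (by simp)).2 ?_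
    simp; positivity
  simp only [Finset.sum_add_distrib, ← Finset.mul_sum] at this
  linarith

lemma rat_mul (r α y : ℝ) (p : ℤ) (q : ℕ) (h : α * q = p) (k : ℕ) :
    rotDelta (DD r) α 0 y (k * q) = k * rotDelta (DD r) α 0 y q := by
  induction k with
  | zero => simp [rot_eq_s6]
  | succ k ih =>
    have h1 := rot_cocycle r α 0 y (q:ℝ) (k * q)
    have h2 := rot_per r α 0 y (k * q) (q : ℤ) p
    rw [h] at h1
    push_cast at h2 ⊢
    rw [h2, ih] at h1
    have e : ((k:ℝ) + 1) * q = q + k * q := by ring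
    rw [e]; linarith

lemma U_res (r : ℝ) (h0 : 0 < r) (h1 : r < 1 / 2) (hr : Irrational (r ^ 2)) (k : ℕ) :
    {α : ℝ | ∃ y T : ℝ, 0 < T ∧ (k:ℝ) < |rotDelta (DD r) α 0 y T|} ∈ residual ℝ := by
  apply residual_of_dense_open
  · have : {α : ℝ | ∃ y T : ℝ, 0 < T ∧ (k:ℝ) < |rotDelta (DD r) α 0 y T|} =
      ⋃ (y : ℝ) (T : ℝ) (_ : 0 < T), {α : ℝ | (k:ℝ) < |rotDelta (DD r) α 0 y T|} := by
      ext α; simp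
    rw [this]
    refine isOpen_iUnion fun y => isOpen_iUnion fun T => isOpen_iUnion fun _ => ?_
    exact isOpen_lt continuous_const
      ((rot_cont r T).comp (f := fun w : ℝ => (w, (0:ℝ), y)) (by fun_prop)).abs
  · refine Rat.denseRange_cast.mono ?_
    rintro _ ⟨a, rfl⟩
    obtain ⟨y, hy⟩ := rat_ne r h0 h1 hr a a.den a.den_pos
    obtain ⟨j, hj⟩ := exists_nat_gt (k / |rotDelta (DD r) a 0 y a.den|)
    have hpos := abs_pos.2 hy
    rw [div_lt_iff₀ hpos] at hj
    have hj0 : (0:ℝ) < j := by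
      by_contra! hh
      have : (0:ℝ) ≤ k := k.cast_nonneg
      nlinarith
    refine ⟨y, j * a.den, mul_pos hj0 (by exact_mod_cast a.den_pos), ?_⟩
    rw [rat_mul r a y a.num a.den (by exact_mod_cast Rat.mul_den_eq_num a) j, abs_mul,
      Nat.abs_cast]
    exact hj

theorem statement6 :
    ∃ A : Set ℝ, ¬ A.Countable ∧
      ∀ α ∈ A, 0 < α ∧ Irrational α ∧
        ∃ (c : ℝ × ℝ) (r : ℝ), 0 < r ∧
          closedDisc c r ⊆ Set.Ico (0:ℝ) 1 ×ˢ Set.Ico (0:ℝ) 1 ∧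
          ∀ x₁ x₂ : ℝ, x₁ ∈ Set.Ico (0:ℝ) 1 → x₂ ∈ Set.Ico (0:ℝ) 1 →
            ¬ IsBoundedRemainderSet (closedDisc c r) α x₁ x₂ := by

  obtain ⟨r, h0, h1, hr⟩ : ∃ r : ℝ, 0 < r ∧ r < 1 / 2 ∧ Irrational (r ^ 2) := by
    obtain ⟨s, hs, ha, hb⟩ : ∃ s : ℝ, Irrational s ∧ 0 < s ∧ s < 1 / 4 := by
      obtain ⟨s, hs, h⟩ := exists_irrational_btwn (show (0:ℝ) < 1 / 4 by norm_num)
      exact ⟨s, hs, h⟩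
    refine ⟨√s, Real.sqrt_pos.2 ha, ?_, by rwa [Real.sq_sqrt ha.le]⟩
    rw [Real.sqrt_lt' (by norm_num)]
    linarith
  have hres : {α : ℝ | Irrational α ∧ ∀ k : ℕ, ∃ y T : ℝ, 0 < T ∧
      (k:ℝ) < |rotDelta (DD r) α 0 y T|} ∈ residual ℝ := by
    have h2 : ∀ᶠ α in residual ℝ, ∀ k : ℕ, ∃ y T : ℝ, 0 < T ∧
      (k:ℝ) < |rotDelta (DD r) α 0 y T| := eventually_countable_forall.2 (U_res r h0 h1 hr)
    exact eventually_residual_irrational.and h2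
  refine ⟨{α | 0 < α ∧ Irrational α ∧ ∀ k : ℕ, ∃ y T : ℝ, 0 < T ∧
      (k:ℝ) < |rotDelta (DD r) α 0 y T|}, ?_, ?_⟩
  · intro hc
    have hc' := residual_of_dense_Gδ hc.isGδ_compl (hc.dense_compl ℝ)
    obtain ⟨a, ha, hpos⟩ := (dense_of_mem_residual (inter_mem hres hc')).inter_open_nonempty
      (Ioi 0) isOpen_Ioi ⟨1, by simp⟩
    exact hpos.2 ⟨ha, hpos.1.1, hpos.1.2⟩
  · rintro α ⟨hpos, hirr, hub⟩
    refine ⟨hpos, hirr, (1 / 2, 1 / 2), r, h0, ?_, ?_⟩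
    · rintro ⟨a, b⟩ hab
      have hab : (a - 1 / 2) ^ 2 + (b - 1 / 2) ^ 2 ≤ r ^ 2 := hab
      have ha := abs_le_of_sq_le_sq' (show (a - 1 / 2) ^ 2 ≤ r ^ 2 by
        nlinarith [sq_nonneg (b - 1 / 2)]) h0.le
      have hb := abs_le_of_sq_le_sq' (show (b - 1 / 2) ^ 2 ≤ r ^ 2 by
        nlinarith [sq_nonneg (a - 1 / 2)]) h0.le
      refine ⟨⟨?_, ?_⟩, ⟨?_, ?_⟩⟩ <;> simp only <;> linarith [ha.1, ha.2, hb.1, hb.2]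
    · rintro x₁ x₂ - - ⟨C, hC⟩
      obtain ⟨k, hk⟩ := exists_nat_gt (2 * C)
      obtain ⟨y, T, hT, hlt⟩ := hub k
      have := rot_bound r α x₁ x₂ C hirr hC 0 y T hT
      linarith
end

section
/- Let S be the triangle with vertices (0,0), (1,0) and (0,1), i.e. S = {(u,v) ∈ [0,1)² : u + v ≤ 1}. Then for every irrational α > 0 and every starting point x ∈ [0,1)², S is a bounded remainder set for the continuous irrational rotation with slope α and starting point x. -/
open MeasureTheory

theorem vol_tri : (volume {p : ℝ × ℝ | p ∈ Set.Ico (0:ℝ) 1 ×ˢ Set.Ico (0:ℝ) 1 ∧ p.1 + p.2 ≤ 1}).toReal = 1/2 := by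
  have hm : MeasurableSet {p : ℝ × ℝ | p ∈ Set.Ico (0:ℝ) 1 ×ˢ Set.Ico (0:ℝ) 1 ∧ p.1 + p.2 ≤ 1} := by
    apply MeasurableSet.inter (measurableSet_Ico.prod measurableSet_Ico)
    exact measurableSet_le (f := fun p : ℝ × ℝ => p.1 + p.2) (g := fun _ => (1:ℝ)) (by fun_prop) (by fun_prop)
  rw [Measure.volume_eq_prod, Measure.prod_apply hm]
  have h : ∀ x : ℝ, volume (Prod.mk x ⁻¹' {p : ℝ × ℝ | p ∈ Set.Ico (0:ℝ) 1 ×ˢ Set.Ico (0:ℝ) 1 ∧ p.1 + p.2 ≤ 1})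
      = (Set.Ico (0:ℝ) 1).indicator (fun x => ENNReal.ofReal (1 - x)) x := by
    intro x
    by_cases hx : x ∈ Set.Ico (0:ℝ) 1
    · rw [Set.indicator_of_mem hx]
      obtain ⟨h0, h1⟩ := hx
      rcases h0.eq_or_lt with h | h
      · subst h
        have : (Prod.mk (0:ℝ) ⁻¹' {p : ℝ × ℝ | p ∈ Set.Ico (0:ℝ) 1 ×ˢ Set.Ico (0:ℝ) 1 ∧ p.1 + p.2 ≤ 1}) = Set.Ico 0 1 := by
          ext y
          simp
          intros; linarith
        rw [this, Real.volume_Ico]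
      · have : (Prod.mk x ⁻¹' {p : ℝ × ℝ | p ∈ Set.Ico (0:ℝ) 1 ×ˢ Set.Ico (0:ℝ) 1 ∧ p.1 + p.2 ≤ 1}) = Set.Icc 0 (1-x) := by
          ext y
          simp only [Set.mem_preimage, Set.mem_ofPred_eq, Set.mem_prod, Set.mem_Ico, Set.mem_Icc]
          constructor
          · rintro ⟨⟨_, h3, _⟩, h5⟩
            exact ⟨h3, by linarith⟩
          · rintro ⟨h3, h4⟩
            exact ⟨⟨⟨h0, h1⟩, h3, by linarith⟩, by linarith⟩
        rw [this, Real.volume_Icc, sub_zero]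
    · rw [Set.indicator_of_notMem hx]
      convert measure_empty (μ := (volume : Measure ℝ))
      ext y
      simp only [Set.mem_preimage, Set.mem_ofPred_eq, Set.mem_prod, Set.mem_empty_iff_false, iff_false]
      exact fun h => hx h.1.1
  simp_rw [h]
  rw [lintegral_indicator measurableSet_Ico, setLIntegral_congr Ico_ae_eq_Ioc,
    ← ofReal_integral_eq_lintegral_ofReal, ← intervalIntegral.integral_of_le zero_le_one]
  · rw [ENNReal.toReal_ofReal]
    · rw [intervalIntegral.integral_sub (by simp) (by simp)]
      simp; norm_num
    · rw [intervalIntegral.integral_sub (by simp) (by simp)]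
      simp; norm_num
  · exact (Continuous.integrableOn_Ioc (by fun_prop))
  · refine (ae_restrict_iff' measurableSet_Ioc).2 (.of_forall fun x hx => ?_)
    simpa using hx.2

theorem countable_int (c β : ℝ) (hβ : 0 < β) : {t : ℝ | ∃ n : ℤ, c + β * t = n}.Countable := by
  apply (Set.countable_range (fun n : ℤ => ((n : ℝ) - c) / β)).mono
  rintro t ⟨n, hn⟩
  refine ⟨n, ?_⟩
  simp only
  rw [← hn]; field_simp; ring

theorem fract_ii (c β a b : ℝ) : IntervalIntegrable (fun t => Int.fract (c + β * t)) volume a b := by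
  apply IntervalIntegrable.mono_fun (g := fun t => Int.fract (c + β * t)) (f := fun _ => (1:ℝ)) (by simp)
  · exact (measurable_fract.comp (by fun_prop)).aestronglyMeasurable
  · refine .of_forall fun x => ?_
    simp only [norm_one, Real.norm_eq_abs]
    rw [abs_of_nonneg (Int.fract_nonneg _)]
    exact (Int.fract_lt_one _).le

theorem fract_int_s7 (c β : ℝ) (hβ : 0 < β) : ∀ T : ℝ,
    |(∫ t in (0:ℝ)..T, Int.fract (c + β * t)) - T / 2| ≤ 1 / β := by
  intro T
  have hc : Continuous fun s : ℝ => Int.fract s * (Int.fract s - 1) / (2 * β) := by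
    have := ContinuousOn.comp_fract'' (f := fun s : ℝ => s * (s - 1) / (2 * β)) (by fun_prop) (by simp)
    exact this
  have key := MeasureTheory.integral_eq_of_hasDerivAt_off_countable
    (fun t => Int.fract (c + β * t) * (Int.fract (c + β * t) - 1) / (2 * β))
    (fun t => Int.fract (c + β * t) - 1/2) (a := 0) (b := T) (countable_int c β hβ)
    (hc.comp (by fun_prop : Continuous fun t => c + β * t)).continuousOn
    (by
      rintro x ⟨-, hx⟩
      have hne : c + β * x ≠ ⌊c + β * x⌋ := fun h => hx ⟨_, h⟩
      have hlt := lt_of_le_of_ne (Int.floor_le (c + β * x)) hne.symm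
      have hev : ∀ᶠ t in nhds x, Int.fract (c + β * t) = c + β * t - ⌊c + β * x⌋ := by
        have hcont : Continuous fun t => c + β * t := by fun_prop
        filter_upwards [hcont.continuousAt.eventually (Ioo_mem_nhds hlt (Int.lt_floor_add_one _))] with t ht
        have : ⌊c + β * t⌋ = ⌊c + β * x⌋ := Int.floor_eq_iff.2 ⟨ht.1.le, ht.2⟩
        rw [Int.fract, this]
      have h1 : HasDerivAt (fun t => c + β * t - ⌊c + β * x⌋) β x := by
        simpa using (((hasDerivAt_id x).const_mul β).const_add c).sub_const (⌊c + β * x⌋ : ℝ)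
      have h2 := h1.congr_of_eventuallyEq hev
      have h3 := (h2.mul (h2.sub_const 1)).div_const (2 * β)
      refine h3.congr_deriv ?_
      field_simp; ring)
    ((fract_ii c β 0 T).sub (by simp))
  rw [intervalIntegral.integral_sub (fract_ii c β 0 T) (by simp)] at key
  simp only [intervalIntegral.integral_const, smul_eq_mul, sub_zero] at key
  have e : T / 2 = T * (1/2) := by ring
  rw [e, key, ← sub_div, abs_div, abs_of_pos (by positivity : 0 < 2 * β), div_le_div_iff₀ (by positivity) hβ]
  have hb : |Int.fract (c + β * T) * (Int.fract (c + β * T) - 1) - Int.fract (c + β * 0) * (Int.fract (c + β * 0) - 1)| ≤ 2 := by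
    have a1 := Int.fract_nonneg (c + β * T)
    have a2 := Int.fract_lt_one (c + β * T)
    have b1 := Int.fract_nonneg (c + β * 0)
    have b2 := Int.fract_lt_one (c + β * 0)
    rw [abs_le]
    constructor <;> nlinarith
  nlinarith

theorem ind_eq_s7 (a b : ℝ) (h : ¬ ∃ n : ℤ, a + b = n) :
    Set.indicator {p : ℝ × ℝ | p ∈ Set.Ico (0:ℝ) 1 ×ˢ Set.Ico (0:ℝ) 1 ∧ p.1 + p.2 ≤ 1} (fun _ => (1:ℝ))
      (Int.fract a, Int.fract b) = 1 - Int.fract a - Int.fract b + Int.fract (a + b) := by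
  have a1 := Int.fract_nonneg a
  have a2 := Int.fract_lt_one a
  have b1 := Int.fract_nonneg b
  have b2 := Int.fract_lt_one b
  have ea := Int.floor_add_fract a
  have eb := Int.floor_add_fract b
  have hne : Int.fract a + Int.fract b ≠ 1 := fun h1 => h ⟨⌊a⌋ + ⌊b⌋ + 1, by push_cast; linarith⟩
  rcases lt_or_gt_of_ne hne with hl | hl
  · rw [Set.indicator_of_mem (by exact ⟨⟨⟨a1, a2⟩, b1, b2⟩, hl.le⟩)]
    have : Int.fract (a + b) = Int.fract a + Int.fract b :=
      Int.fract_eq_iff.2 ⟨by linarith, hl, ⌊a⌋ + ⌊b⌋, by push_cast; linarith⟩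
    linarith
  · rw [Set.indicator_of_notMem (by rintro ⟨_, h'⟩; exact absurd h' (not_le.2 hl))]
    have : Int.fract (a + b) = Int.fract a + Int.fract b - 1 :=
      Int.fract_eq_iff.2 ⟨by linarith, by linarith, ⌊a⌋ + ⌊b⌋ + 1, by push_cast; linarith⟩
    linarith

theorem statement7 (α : ℝ) (hα : 0 < α) (hirr : Irrational α)
    (x₁ x₂ : ℝ) (hx₁ : x₁ ∈ Set.Ico (0:ℝ) 1) (hx₂ : x₂ ∈ Set.Ico (0:ℝ) 1) :
    IsBoundedRemainderSet
      {p : ℝ × ℝ | p ∈ Set.Ico (0:ℝ) 1 ×ˢ Set.Ico (0:ℝ) 1 ∧ p.1 + p.2 ≤ 1}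
      α x₁ x₂ := by
  refine ⟨1 / 1 + 1 / α + 1 / (1 + α), fun T _ => ?_⟩
  unfold rotDelta
  rw [vol_tri]
  have hE : (∫ t in (0:ℝ)..T,
      Set.indicator {p : ℝ × ℝ | p ∈ Set.Ico (0:ℝ) 1 ×ˢ Set.Ico (0:ℝ) 1 ∧ p.1 + p.2 ≤ 1}
        (fun _ => (1:ℝ)) (Int.fract (x₁ + t), Int.fract (x₂ + α * t))) =
      ∫ t in (0:ℝ)..T, (1 - Int.fract (x₁ + 1 * t) - Int.fract (x₂ + α * t)
        + Int.fract ((x₁ + x₂) + (1 + α) * t)) := by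
    apply intervalIntegral.integral_congr_ae
    have hz := (countable_int (x₁ + x₂) (1 + α) (by linarith)).ae_notMem volume
    filter_upwards [hz] with t ht _
    have e : (x₁ + t) + (x₂ + α * t) = (x₁ + x₂) + (1 + α) * t := by ring
    rw [ind_eq_s7 _ _ (by rw [e]; exact ht), e, one_mul]
  have i1 := fract_ii x₁ 1 0 T
  have i2 := fract_ii x₂ α 0 T
  have i3 := fract_ii (x₁ + x₂) (1 + α) 0 T
  have i0 : IntervalIntegrable (fun _ : ℝ => (1:ℝ)) volume 0 T := by simp
  rw [hE, intervalIntegral.integral_add ((i0.sub i1).sub i2) i3,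
    intervalIntegral.integral_sub (i0.sub i1) i2, intervalIntegral.integral_sub i0 i1]
  simp only [intervalIntegral.integral_const, smul_eq_mul, sub_zero, mul_one]
  have b1 := abs_le.1 (fract_int_s7 x₁ 1 one_pos T)
  have b2 := abs_le.1 (fract_int_s7 x₂ α hα T)
  have b3 := abs_le.1 (fract_int_s7 (x₁ + x₂) (1 + α) (by linarith) T)
  rw [abs_le]
  constructor <;> linarith [b1.1, b1.2, b2.1, b2.2, b3.1, b3.2]
end
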